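/- (Characterization, maximality.) Let U be a bounded, continuous subsolution of the equation ∂_t U(t,m) + (1/2) ∫_{ℝ^d} div[D_m U](t,m,x) dm(x) + H(t,m) = 0 on [0,T) × 𝒫₂ which is convex in m and satisfies U(T,m) = 0 for all m ∈ 𝒫₂. Then U ≤ V on [0,T] × 𝒫₂; consequently, V is the largest bounded continuous subsolution of this equation that is convex in m and vanishes at time T. -/

import Mathlib

open MeasureTheory Filter Set
open scoped Topology ENNReal NNReal BoundedContinuousFunction

noncomputable section

/-- Euclidean space `ℝ^d`. -/
abbrev Ed (d : ℕ) : Type := EuclideanSpace ℝ (Fin d)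

/-- `m ∈ 𝒫_p` : Borel probability measure on `ℝ^d` with finite `p`-th moment. -/
def MemP (d : ℕ) (p : ℝ) (m : Measure (Ed d)) : Prop :=
  IsProbabilityMeasure m ∧ Integrable (fun x => ‖x‖ ^ p) m

/-- `γ` is a coupling of `m` and `m'`. -/
def IsCoupling (d : ℕ) (γ : Measure (Ed d × Ed d)) (m m' : Measure (Ed d)) : Prop :=
  γ.map Prod.fst = m ∧ γ.map Prod.snd = m'

/-- The `p`-Wasserstein distance. -/
def wdist (d : ℕ) (p : ℝ) (m m' : Measure (Ed d)) : ℝ :=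
  sInf { c : ℝ | ∃ γ : Measure (Ed d × Ed d), IsProbabilityMeasure γ ∧ IsCoupling d γ m m' ∧
      c = (∫ q, ‖q.1 - q.2‖ ^ p ∂γ) ^ (1 / p) }

/-- The Gaussian kernel `ρ_δ`. -/
def gaussDensity (d : ℕ) (δ : ℝ) (x : Ed d) : ℝ :=
  (2 * Real.pi * δ) ^ (-(d : ℝ) / 2) * Real.exp (-‖x‖ ^ 2 / (2 * δ))

/-- The centered Gaussian measure with variance `δ` on `ℝ^d`. -/
def gaussMeasure (d : ℕ) (δ : ℝ) : Measure (Ed d) :=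
  volume.withDensity fun x => ENNReal.ofReal (gaussDensity d δ x)

/-- The heat flow `p^{t,m}_s` : the law at time `s` of a Brownian motion started
at time `t` with initial law `m`. -/
def heatFlow (d : ℕ) (t s : ℝ) (m : Measure (Ed d)) : Measure (Ed d) :=
  if s ≤ t then m
  else Measure.map (fun q : Ed d × Ed d => q.1 + q.2) (m.prod (gaussMeasure d (s - t)))

/-- The natural filtration of a measure-valued process, made right-continuous:
`𝓕^M_s = ⋂_{u > s} σ(M_r, r ∈ [t,u])`. -/
def genFiltration {Ω : Type} (d : ℕ) (M : ℝ → Ω → Measure (Ed d)) (t s : ℝ) :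
    MeasurableSpace Ω :=
  ⨅ u ∈ Set.Ioi s, ⨆ r ∈ Set.Icc t u, MeasurableSpace.comap (M r) inferInstance

/-- A path `[t,T] → (𝒫₁,d₁)` is càdlàg: right-continuous with left limits (for `d₁`). -/
def CadlagD1 (d : ℕ) (t T : ℝ) (g : ℝ → Measure (Ed d)) : Prop :=
  (∀ s ∈ Set.Ico t T, Tendsto (fun r => wdist d 1 (g r) (g s)) (𝓝[Set.Ici s] s) (𝓝 0)) ∧
  (∀ s ∈ Set.Ioc t T, ∃ μ : Measure (Ed d),
      Tendsto (fun r => wdist d 1 (g r) μ) (𝓝[Set.Ico t s] s) (𝓝 0))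

/-- An element of `𝓜(t,m)` : a càdlàg `(𝒫₁,d₁)`-valued process `M = (M_s)_{s∈[t,T]}`
on some probability space such that (i) `E[M_t(φ)] = m(φ)` for all bounded continuous `φ`
and (ii) `E[M_{t₂}(φ) | 𝓕^M_{t₁}] = p^{t₁,M_{t₁}}_{t₂}(φ)` for all `t ≤ t₁ ≤ t₂ ≤ T` and
all bounded continuous `φ`. -/
structure MVP (d : ℕ) (T t : ℝ) (m : Measure (Ed d)) where
  Ω : Type
  mΩ : MeasurableSpace Ω
  P : @Measure Ω mΩ
  probP : IsProbabilityMeasure P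
  M : ℝ → Ω → Measure (Ed d)
  meas : ∀ s, @Measurable Ω (Measure (Ed d)) mΩ inferInstance (M s)
  inP1 : ∀ s ∈ Set.Icc t T, ∀ ω, MemP d 1 (M s ω)
  cadlag : ∀ ω, CadlagD1 d t T (fun s => M s ω)
  init : ∀ φ : Ed d →ᵇ ℝ, ∫ ω, (∫ x, φ x ∂(M t ω)) ∂P = ∫ x, φ x ∂m
  cond : ∀ t₁ t₂ : ℝ, t ≤ t₁ → t₁ ≤ t₂ → t₂ ≤ T → ∀ φ : Ed d →ᵇ ℝ,
    P[(fun ω => ∫ x, φ x ∂(M t₂ ω)) | genFiltration d M t t₁]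
      =ᵐ[P] fun ω => ∫ x, φ x ∂(heatFlow d t₁ t₂ (M t₁ ω))
/-- The Hamiltonian `H(t,m) = inf_u sup_v ∫ f(t,x,u,v) dm(x)`. -/
def hamiltonian {d : ℕ} {A B : Type} (f : ℝ → Ed d → A → B → ℝ)
    (t : ℝ) (m : Measure (Ed d)) : ℝ :=
  ⨅ u : A, ⨆ v : B, ∫ x, f t x u v ∂m

/-- The cost `E[∫_t^T H(s, M_s) ds]` of a measure-valued process. -/
def mvCost {d : ℕ} {A B : Type} (f : ℝ → Ed d → A → B → ℝ)
    {T t : ℝ} {m : Measure (Ed d)} (X : MVP d T t m) : ℝ :=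
  ∫ ω, (∫ s in Set.Icc t T, hamiltonian f s (X.M s ω)) ∂X.P

/-- The value function `V(t,m) = inf_{M ∈ 𝓜(t,m)} E[∫_t^T H(s, M_s) ds]`. -/
def gameValue (d : ℕ) {A B : Type} (f : ℝ → Ed d → A → B → ℝ)
    (T t : ℝ) (m : Measure (Ed d)) : ℝ :=
  sInf { r : ℝ | ∃ X : MVP d T t m, r = mvCost f X }
/-- The Laplacian of a function on `ℝ^d` (the spatial divergence of its gradient),
`div[∇g](x) = Σ_i ∂²g/∂x_i²(x)`. -/
def lapl (d : ℕ) (g : Ed d → ℝ) (x : Ed d) : ℝ :=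
  ∑ i : Fin d, iteratedFDeriv ℝ 2 g x (fun _ => EuclideanSpace.single i (1:ℝ))

/-- A test function satisfying condition (A3): `φ` is lower semicontinuous (for `d₁`) and
`d₂`-continuous, the derivatives `∂φ/∂t`, `δφ/δm`, `∇_x(δφ/δm)`, `∇²_x(δφ/δm)` exist and
are `d₂`-continuous on `[0,T) × 𝒫₂ × ℝ^d`, and `δφ/δm` and its first and second spatial
derivatives have at most quadratic growth in `x`, uniformly in `(t,m)`. -/
structure TestFn (d : ℕ) (T : ℝ) where
  /-- the test function `φ(t,m)` -/
  φ : ℝ → Measure (Ed d) → ℝ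
  /-- the time derivative `∂φ/∂t` -/
  φt : ℝ → Measure (Ed d) → ℝ
  /-- the linear functional derivative `δφ/δm (t,m,x)` -/
  δφ : ℝ → Measure (Ed d) → Ed d → ℝ
  lsc : ∀ t ∈ Set.Icc 0 T, ∀ m : Measure (Ed d), MemP d 2 m → ∀ ε > (0:ℝ), ∃ η > (0:ℝ),
    ∀ t' ∈ Set.Icc 0 T, ∀ m' : Measure (Ed d), MemP d 2 m' →
      |t' - t| < η → wdist d 1 m m' < η → φ t m - ε < φ t' m'
  d2cont : ∀ t ∈ Set.Icc 0 T, ∀ m : Measure (Ed d), MemP d 2 m → ∀ ε > (0:ℝ), ∃ η > (0:ℝ),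
    ∀ t' ∈ Set.Icc 0 T, ∀ m' : Measure (Ed d), MemP d 2 m' →
      |t' - t| < η → wdist d 2 m m' < η → |φ t' m' - φ t m| < ε
  timeDeriv : ∀ m : Measure (Ed d), MemP d 2 m → ∀ t ∈ Set.Ico 0 T,
    HasDerivWithinAt (fun s => φ s m) (φt t m) (Set.Icc 0 T) t
  measDeriv : ∀ t ∈ Set.Ico 0 T, ∀ m : Measure (Ed d), MemP d 2 m →
    ∀ m' : Measure (Ed d), MemP d 2 m' →
      Tendsto (fun r : ℝ =>
          (φ t ((1 - ENNReal.ofReal r) • m + ENNReal.ofReal r • m') - φ t m) / r)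
        (𝓝[>] 0) (𝓝 (∫ x, δφ t m x ∂m'))
  normalized : ∀ t ∈ Set.Ico 0 T, ∀ m : Measure (Ed d), MemP d 2 m →
    ∫ x, δφ t m x ∂m = 0
  smoothX : ∀ t ∈ Set.Ico 0 T, ∀ m : Measure (Ed d), MemP d 2 m → ContDiff ℝ 2 (δφ t m)
  quadGrowth : ∃ c : ℝ, ∀ t ∈ Set.Ico 0 T, ∀ m : Measure (Ed d), MemP d 2 m → ∀ x : Ed d,
    |δφ t m x| ≤ c * (1 + ‖x‖ ^ 2) ∧ ‖fderiv ℝ (δφ t m) x‖ ≤ c * (1 + ‖x‖ ^ 2) ∧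
      ‖iteratedFDeriv ℝ 2 (δφ t m) x‖ ≤ c * (1 + ‖x‖ ^ 2)
  d2contDeriv : ∀ t ∈ Set.Ico 0 T, ∀ m : Measure (Ed d), MemP d 2 m → ∀ x : Ed d,
    ∀ ε > (0:ℝ), ∃ η > (0:ℝ), ∀ t' ∈ Set.Ico 0 T, ∀ m' : Measure (Ed d), MemP d 2 m' →
      ∀ x' : Ed d, |t' - t| < η → wdist d 2 m m' < η → ‖x' - x‖ < η →
        |φt t' m' - φt t m| < ε ∧ |δφ t' m' x' - δφ t m x| < ε ∧
          ‖fderiv ℝ (δφ t' m') x' - fderiv ℝ (δφ t m) x‖ < ε ∧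
          ‖iteratedFDeriv ℝ 2 (δφ t' m') x' - iteratedFDeriv ℝ 2 (δφ t m) x‖ < ε

/-- `φ − u` has a local minimum at `(t,m)` (locality for `|·|` in time and `d₁` in measure). -/
def LocalMinAt (d : ℕ) (T : ℝ) (g : ℝ → Measure (Ed d) → ℝ)
    (t : ℝ) (m : Measure (Ed d)) : Prop :=
  ∃ η > (0:ℝ), ∀ t' ∈ Set.Icc 0 T, ∀ m' : Measure (Ed d), MemP d 2 m' →
    |t' - t| ≤ η → wdist d 1 m m' ≤ η → g t m ≤ g t' m'

/-- `u` is a (viscosity) subsolution on `[0,T) × 𝒫₂` of the Hamilton-Jacobi equation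
`∂_t U(t,m) + ½ ∫ div[D_m U](t,m,x) dm(x) + F(t,m) = 0` : for every `(t,m) ∈ [0,T) × 𝒫₂`
and every test function `φ` satisfying (A3) such that `φ − u` has a local minimum at
`(t,m)`, one has `∂_t φ(t,m) + ½ ∫ div[D_m φ](t,m,x) dm(x) + F(t,m) ≥ 0`. -/
def IsSubsolution (d : ℕ) (T : ℝ) (F : ℝ → Measure (Ed d) → ℝ)
    (u : ℝ → Measure (Ed d) → ℝ) : Prop :=
  ∀ t ∈ Set.Ico 0 T, ∀ m : Measure (Ed d), MemP d 2 m → ∀ ψ : TestFn d T,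
    LocalMinAt d T (fun s μ => ψ.φ s μ - u s μ) t m →
      ψ.φt t m + (1 / 2) * (∫ x, lapl d (ψ.δφ t m) x ∂m) + F t m ≥ 0

/-- `u : [0,T] × 𝒫₂ → ℝ` is (jointly) continuous for the distance `|·| + d₁`. -/
def ContD1 (d : ℕ) (T : ℝ) (u : ℝ → Measure (Ed d) → ℝ) : Prop :=
  ∀ t ∈ Set.Icc 0 T, ∀ m : Measure (Ed d), MemP d 2 m → ∀ ε > (0:ℝ), ∃ η > (0:ℝ),
    ∀ t' ∈ Set.Icc 0 T, ∀ m' : Measure (Ed d), MemP d 2 m' →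
      |t' - t| < η → wdist d 1 m m' < η → |u t' m' - u t m| < ε

/-- `u : [0,T] × 𝒫₂ → ℝ` is bounded. -/
def BddD1 (d : ℕ) (T : ℝ) (u : ℝ → Measure (Ed d) → ℝ) : Prop :=
  ∃ c : ℝ, ∀ t ∈ Set.Icc 0 T, ∀ m : Measure (Ed d), MemP d 2 m → |u t m| ≤ c

/-- The data of condition (A1) for a source term `F` : `F` is bounded and continuous, and
`δF/δm`, `∇_x(δF/δm)`, `∇²_x(δF/δm)` exist and are bounded and continuous. -/
structure A1Data (d : ℕ) (T : ℝ) where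
  /-- the source term `F(t,m)` -/
  F : ℝ → Measure (Ed d) → ℝ
  /-- the linear functional derivative `δF/δm (t,m,x)` -/
  δF : ℝ → Measure (Ed d) → Ed d → ℝ
  bddF : BddD1 d T F
  contF : ContD1 d T F
  measDeriv : ∀ t ∈ Set.Icc 0 T, ∀ m : Measure (Ed d), MemP d 2 m →
    ∀ m' : Measure (Ed d), MemP d 2 m' →
      Tendsto (fun r : ℝ =>
          (F t ((1 - ENNReal.ofReal r) • m + ENNReal.ofReal r • m') - F t m) / r)
        (𝓝[>] 0) (𝓝 (∫ x, δF t m x ∂m'))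
  normalized : ∀ t ∈ Set.Icc 0 T, ∀ m : Measure (Ed d), MemP d 2 m →
    ∫ x, δF t m x ∂m = 0
  smoothX : ∀ t ∈ Set.Icc 0 T, ∀ m : Measure (Ed d), MemP d 2 m → ContDiff ℝ 2 (δF t m)
  bddDeriv : ∃ c : ℝ, ∀ t ∈ Set.Icc 0 T, ∀ m : Measure (Ed d), MemP d 2 m → ∀ x : Ed d,
    |δF t m x| ≤ c ∧ ‖fderiv ℝ (δF t m) x‖ ≤ c ∧ ‖iteratedFDeriv ℝ 2 (δF t m) x‖ ≤ c
  contDeriv : ∀ t ∈ Set.Icc 0 T, ∀ m : Measure (Ed d), MemP d 2 m → ∀ x : Ed d,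
    ∀ ε > (0:ℝ), ∃ η > (0:ℝ), ∀ t' ∈ Set.Icc 0 T, ∀ m' : Measure (Ed d), MemP d 2 m' →
      ∀ x' : Ed d, |t' - t| < η → wdist d 1 m m' < η → ‖x' - x‖ < η →
        |δF t' m' x' - δF t m x| < ε ∧
          ‖fderiv ℝ (δF t' m') x' - fderiv ℝ (δF t m) x‖ < ε ∧
          ‖iteratedFDeriv ℝ 2 (δF t' m') x' - iteratedFDeriv ℝ 2 (δF t m) x‖ < ε

/-- The data of condition (A2) for a terminal condition `ψ` : `ψ` is continuous with at
most linear growth, and `δψ/δm`, `∇_x(δψ/δm)`, `∇²_x(δψ/δm)` exist, are continuous, and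
have linear growth in `x` uniformly in `m`. -/
structure A2Data (d : ℕ) where
  /-- the terminal condition `ψ(m)` -/
  ψ : Measure (Ed d) → ℝ
  /-- the linear functional derivative `δψ/δm (m,x)` -/
  δψ : Measure (Ed d) → Ed d → ℝ
  growth : ∃ c : ℝ, ∀ m : Measure (Ed d), MemP d 2 m → |ψ m| ≤ c * (1 + ∫ x, ‖x‖ ∂m)
  contψ : ∀ m : Measure (Ed d), MemP d 2 m → ∀ ε > (0:ℝ), ∃ η > (0:ℝ),
    ∀ m' : Measure (Ed d), MemP d 2 m' → wdist d 1 m m' < η → |ψ m' - ψ m| < ε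
  measDeriv : ∀ m : Measure (Ed d), MemP d 2 m → ∀ m' : Measure (Ed d), MemP d 2 m' →
    Tendsto (fun r : ℝ =>
        (ψ ((1 - ENNReal.ofReal r) • m + ENNReal.ofReal r • m') - ψ m) / r)
      (𝓝[>] 0) (𝓝 (∫ x, δψ m x ∂m'))
  normalized : ∀ m : Measure (Ed d), MemP d 2 m → ∫ x, δψ m x ∂m = 0
  smoothX : ∀ m : Measure (Ed d), MemP d 2 m → ContDiff ℝ 2 (δψ m)
  derivGrowth : ∃ c : ℝ, ∀ m : Measure (Ed d), MemP d 2 m → ∀ x : Ed d,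
    |δψ m x| ≤ c * (1 + ‖x‖) ∧ ‖fderiv ℝ (δψ m) x‖ ≤ c * (1 + ‖x‖) ∧
      ‖iteratedFDeriv ℝ 2 (δψ m) x‖ ≤ c * (1 + ‖x‖)
  contDeriv : ∀ m : Measure (Ed d), MemP d 2 m → ∀ x : Ed d, ∀ ε > (0:ℝ), ∃ η > (0:ℝ),
    ∀ m' : Measure (Ed d), MemP d 2 m' → ∀ x' : Ed d,
      wdist d 1 m m' < η → ‖x' - x‖ < η →
        |δψ m' x' - δψ m x| < ε ∧ ‖fderiv ℝ (δψ m') x' - fderiv ℝ (δψ m) x‖ < ε ∧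
          ‖iteratedFDeriv ℝ 2 (δψ m') x' - iteratedFDeriv ℝ 2 (δψ m) x‖ < ε

/-! ### Moments and couplings -/

lemma memP_one_iff {d : ℕ} {m : Measure (Ed d)} :
    MemP d 1 m ↔ IsProbabilityMeasure m ∧ Integrable (fun x => ‖x‖) m := by
  simp [MemP]

lemma memP_two_iff {d : ℕ} {m : Measure (Ed d)} :
    MemP d 2 m ↔ IsProbabilityMeasure m ∧ Integrable (fun x => ‖x‖ ^ 2) m := by
  simp [MemP]

lemma MemP.one_of_two {d : ℕ} {m : Measure (Ed d)} (h : MemP d 2 m) : MemP d 1 m := by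
  rw [memP_two_iff] at h
  obtain ⟨h1, h2⟩ := h
  refine memP_one_iff.2 ⟨h1, ((integrable_const (1 : ℝ)).add h2).mono' (by fun_prop) ?_⟩
  filter_upwards with x
  simp only [norm_norm, Pi.add_apply]
  nlinarith [sq_nonneg (‖x‖ - 1)]

section Coupling

variable {d : ℕ} {m m' : Measure (Ed d)} {γ : Measure (Ed d × Ed d)}

lemma IsCoupling.integrable_fst {g : Ed d → ℝ} (h : IsCoupling d γ m m')
    (hg : Integrable g m) : Integrable (fun q : Ed d × Ed d => g q.1) γ := by
  rw [← h.1] at hg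
  exact hg.comp_measurable measurable_fst

lemma IsCoupling.integrable_snd {g : Ed d → ℝ} (h : IsCoupling d γ m m')
    (hg : Integrable g m') : Integrable (fun q : Ed d × Ed d => g q.2) γ := by
  rw [← h.2] at hg
  exact hg.comp_measurable measurable_snd

lemma IsCoupling.integral_fst {g : Ed d → ℝ} (h : IsCoupling d γ m m')
    (hg : Integrable g m) : ∫ q, g q.1 ∂γ = ∫ x, g x ∂m := by
  rw [← h.1] at hg ⊢
  rw [integral_map measurable_fst.aemeasurable hg.1]

lemma IsCoupling.integral_snd {g : Ed d → ℝ} (h : IsCoupling d γ m m')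
    (hg : Integrable g m') : ∫ q, g q.2 ∂γ = ∫ x, g x ∂m' := by
  rw [← h.2] at hg ⊢
  rw [integral_map measurable_snd.aemeasurable hg.1]

lemma IsCoupling.integrable_norm_sub (h : IsCoupling d γ m m') (hm : MemP d 1 m)
    (hm' : MemP d 1 m') : Integrable (fun q : Ed d × Ed d => ‖q.1 - q.2‖) γ := by
  rw [memP_one_iff] at hm hm'
  refine ((h.integrable_fst hm.2).add (h.integrable_snd hm'.2)).mono' (by fun_prop) ?_
  filter_upwards with q
  simpa using norm_sub_le q.1 q.2

lemma IsCoupling.integrable_norm_sub_sq (h : IsCoupling d γ m m') (hm : MemP d 2 m)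
    (hm' : MemP d 2 m') : Integrable (fun q : Ed d × Ed d => ‖q.1 - q.2‖ ^ 2) γ := by
  rw [memP_two_iff] at hm hm'
  refine (((h.integrable_fst hm.2).add (h.integrable_snd hm'.2)).const_mul 2).mono'
    (by fun_prop) ?_
  filter_upwards with q
  simp only [norm_pow, norm_norm, Pi.add_apply]
  nlinarith [norm_sub_le q.1 q.2, norm_nonneg (q.1 - q.2), sq_nonneg (‖q.1‖ - ‖q.2‖)]

lemma isCoupling_prod [IsProbabilityMeasure m] [IsProbabilityMeasure m'] :
    IsCoupling d (m.prod m') m m' := by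
  constructor <;> simp

lemma wdist_set_bddBelow (p : ℝ) :
    BddBelow { c : ℝ | ∃ γ : Measure (Ed d × Ed d), IsProbabilityMeasure γ ∧
      IsCoupling d γ m m' ∧ c = (∫ q, ‖q.1 - q.2‖ ^ p ∂γ) ^ (1 / p) } := by
  refine ⟨0, ?_⟩
  rintro c ⟨γ, -, -, rfl⟩
  exact Real.rpow_nonneg (integral_nonneg fun q => Real.rpow_nonneg (norm_nonneg _) _) _

lemma wdist_nonneg (p : ℝ) : 0 ≤ wdist d p m m' := by
  refine Real.sInf_nonneg ?_
  rintro c ⟨γ, -, -, rfl⟩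
  exact Real.rpow_nonneg (integral_nonneg fun q => Real.rpow_nonneg (norm_nonneg _) _) _

lemma wdist_one_le [IsProbabilityMeasure γ] (h : IsCoupling d γ m m') :
    wdist d 1 m m' ≤ ∫ q, ‖q.1 - q.2‖ ∂γ :=
  csInf_le (wdist_set_bddBelow 1) ⟨γ, inferInstance, h, by simp⟩

lemma exists_coupling_of_wdist_one_lt {c : ℝ} (hm : MemP d 1 m) (hm' : MemP d 1 m')
    (h : wdist d 1 m m' < c) : ∃ γ : Measure (Ed d × Ed d), IsProbabilityMeasure γ ∧
      IsCoupling d γ m m' ∧ ∫ q, ‖q.1 - q.2‖ ∂γ < c := by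
  have := hm.1
  have := hm'.1
  unfold wdist at h
  obtain ⟨b, ⟨γ, h1, h2, rfl⟩, hb⟩ := exists_lt_of_csInf_lt
    (by exact ⟨_, m.prod m', inferInstance, isCoupling_prod, rfl⟩) h
  exact ⟨γ, h1, h2, by simpa using hb⟩

lemma exists_coupling_of_wdist_two_lt {c : ℝ} (hm : MemP d 2 m) (hm' : MemP d 2 m')
    (h : wdist d 2 m m' < c) : ∃ γ : Measure (Ed d × Ed d), IsProbabilityMeasure γ ∧
      IsCoupling d γ m m' ∧ ∫ q, ‖q.1 - q.2‖ ^ 2 ∂γ < c ^ 2 := by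
  have := hm.1
  have := hm'.1
  have hc : 0 ≤ c := (wdist_nonneg 2).trans h.le
  unfold wdist at h
  obtain ⟨b, ⟨γ, h1, h2, rfl⟩, hb⟩ := exists_lt_of_csInf_lt
    (by exact ⟨_, m.prod m', inferInstance, isCoupling_prod, rfl⟩) h
  refine ⟨γ, h1, h2, ?_⟩
  rw [← Real.sqrt_eq_rpow] at hb
  simp only [Real.rpow_two] at hb
  exact (Real.sqrt_lt' (lt_of_le_of_lt (Real.sqrt_nonneg _) hb)).1 hb

lemma wdist_one_le_wdist_two (hm : MemP d 2 m) (hm' : MemP d 2 m') :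
    wdist d 1 m m' ≤ wdist d 2 m m' := by
  refine le_of_forall_gt_imp_ge_of_dense fun c hc => ?_
  obtain ⟨γ, h1, h2, h3⟩ := exists_coupling_of_wdist_two_lt hm hm' hc
  have hc0 : 0 ≤ c := (wdist_nonneg 2).trans hc.le
  refine (wdist_one_le h2).trans ?_
  have i1 := h2.integrable_norm_sub hm.one_of_two hm'.one_of_two
  have i2 := h2.integrable_norm_sub_sq hm hm'
  have hv : (∫ q, ‖q.1 - q.2‖ ∂γ) ^ 2 ≤ ∫ q, ‖q.1 - q.2‖ ^ 2 ∂γ := by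
    set a := ∫ q, ‖q.1 - q.2‖ ∂γ
    have : 0 ≤ ∫ q, (‖q.1 - q.2‖ ^ 2 - 2 * a * ‖q.1 - q.2‖ + a ^ 2) ∂γ :=
      integral_nonneg fun q => by
        simp only [Pi.zero_apply]
        nlinarith [sq_nonneg (‖q.1 - q.2‖ - a)]
    rw [integral_add (by fun_prop) (by fun_prop), integral_sub i2 (by fun_prop),
      integral_const_mul] at this
    simp only [integral_const, probReal_univ, smul_eq_mul, one_mul] at this
    nlinarith
  exact (abs_le_of_sq_le_sq' (hv.trans h3.le) hc0).2

lemma abs_integral_sub_le_of_coupling {g : Ed d → ℝ} {L : ℝ} (h : IsCoupling d γ m m')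
    (hm : MemP d 1 m) (hm' : MemP d 1 m') (hg : Integrable g m) (hg' : Integrable g m')
    (hL : ∀ x y, |g x - g y| ≤ L * ‖x - y‖) :
    |∫ x, g x ∂m - ∫ x, g x ∂m'| ≤ L * ∫ q, ‖q.1 - q.2‖ ∂γ := by
  rw [← h.integral_fst hg, ← h.integral_snd hg',
    ← integral_sub (h.integrable_fst hg) (h.integrable_snd hg'), ← integral_const_mul]
  exact (abs_integral_le_integral_abs).trans (integral_mono
    ((h.integrable_fst hg).sub (h.integrable_snd hg')).abs
    ((h.integrable_norm_sub hm hm').const_mul L) fun q => hL _ _)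

lemma abs_integral_sub_le_wdist {g : Ed d → ℝ} {L : ℝ} (hL0 : 0 ≤ L)
    (hm : MemP d 1 m) (hm' : MemP d 1 m') (hg : Integrable g m) (hg' : Integrable g m')
    (hL : ∀ x y, |g x - g y| ≤ L * ‖x - y‖) :
    |∫ x, g x ∂m - ∫ x, g x ∂m'| ≤ L * wdist d 1 m m' := by
  refine le_of_forall_pos_le_add fun ε hε => ?_
  obtain ⟨γ, -, h2, h3⟩ := exists_coupling_of_wdist_one_lt (c := wdist d 1 m m' + ε / (L + 1))
    hm hm' (by have : 0 < ε / (L + 1) := by positivity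
               linarith)
  refine (abs_integral_sub_le_of_coupling h2 hm hm' hg hg' hL).trans ?_
  have h4 : L * (ε / (L + 1)) ≤ ε := by
    rw [mul_div_assoc', div_le_iff₀ (by positivity)]
    nlinarith
  nlinarith [mul_le_mul_of_nonneg_left h3.le hL0]

/-- The second moment of a measure. -/
def mom2 (m : Measure (Ed d)) : ℝ := ∫ x, ‖x‖ ^ 2 ∂m

lemma mom2_nonneg (m : Measure (Ed d)) : 0 ≤ mom2 m :=
  integral_nonneg fun _ => by positivity

/-- The square norm truncated at level `R`. -/
def truncSq (d : ℕ) (R : ℝ) (x : Ed d) : ℝ := (min ‖x‖ R) ^ 2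

lemma continuous_truncSq (R : ℝ) : Continuous (truncSq d R) := by
  unfold truncSq; fun_prop

lemma truncSq_lip {R : ℝ} (hR : 0 ≤ R) (x y : Ed d) :
    |truncSq d R x - truncSq d R y| ≤ 2 * R * ‖x - y‖ := by
  have h1 : |min ‖x‖ R - min ‖y‖ R| ≤ ‖x - y‖ :=
    (abs_min_sub_min_le_max _ _ _ _).trans (by simpa using abs_norm_sub_norm_le x y)
  have h2 : |min ‖x‖ R + min ‖y‖ R| ≤ 2 * R := by
    rw [abs_of_nonneg (by positivity)]
    linarith [min_le_right ‖x‖ R, min_le_right ‖y‖ R]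
  have : truncSq d R x - truncSq d R y
      = (min ‖x‖ R + min ‖y‖ R) * (min ‖x‖ R - min ‖y‖ R) := by
    unfold truncSq; ring
  rw [this, abs_mul]
  gcongr

lemma truncSq_nonneg (R : ℝ) (x : Ed d) : 0 ≤ truncSq d R x := sq_nonneg _

lemma truncSq_le {R : ℝ} (hR : 0 ≤ R) (x : Ed d) : truncSq d R x ≤ ‖x‖ ^ 2 := by
  unfold truncSq
  gcongr
  exact min_le_left _ _

lemma truncSq_le' {R : ℝ} (hR : 0 ≤ R) (x : Ed d) : truncSq d R x ≤ R ^ 2 := by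
  unfold truncSq
  gcongr
  exact min_le_right _ _

lemma integrable_truncSq [IsFiniteMeasure m] {R : ℝ} (hR : 0 ≤ R) :
    Integrable (truncSq d R) m :=
  (integrable_const (R ^ 2)).mono' (continuous_truncSq R).aestronglyMeasurable
    (by filter_upwards with x
        rw [Real.norm_of_nonneg (truncSq_nonneg _ _)]
        exact truncSq_le' hR x)

lemma tendsto_integral_truncSq (hm : MemP d 2 m) :
    Tendsto (fun n : ℕ => ∫ x, truncSq d n x ∂m) atTop (𝓝 (mom2 m)) := by
  have h := (memP_two_iff.1 hm).2
  refine tendsto_integral_of_dominated_convergence (fun x => ‖x‖ ^ 2)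
    (fun n => (continuous_truncSq _).aestronglyMeasurable) h (fun n => ?_) ?_
  · filter_upwards with x
    rw [Real.norm_of_nonneg (truncSq_nonneg _ _)]
    exact truncSq_le (by positivity) x
  · filter_upwards with x
    refine tendsto_const_nhds.congr' ?_
    filter_upwards [eventually_ge_atTop ⌈‖x‖⌉₊] with n hn
    rw [truncSq, min_eq_left ((Nat.le_ceil _).trans (by exact_mod_cast hn))]

lemma mom2_lsc (hm : MemP d 2 m) {ε : ℝ} (hε : 0 < ε) :
    ∃ η > (0 : ℝ), ∀ m' : Measure (Ed d), MemP d 2 m' → wdist d 1 m m' < η →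
      mom2 m - ε < mom2 m' := by
  obtain ⟨n, hn⟩ := ((tendsto_integral_truncSq hm).eventually
    (lt_mem_nhds (show mom2 m - ε / 2 < mom2 m by linarith))).exists
  refine ⟨ε / 2 / (2 * n + 1), by positivity, fun m' hm' h => ?_⟩
  have := hm.1
  have := hm'.1
  have hn0 : (0 : ℝ) ≤ n := by positivity
  have h1 := abs_integral_sub_le_wdist (L := 2 * n) (by positivity) hm.one_of_two
    hm'.one_of_two (integrable_truncSq hn0) (integrable_truncSq hn0) (truncSq_lip hn0)
  have h2 : ∫ x, truncSq d n x ∂m' ≤ mom2 m' :=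
    integral_mono (integrable_truncSq hn0) (memP_two_iff.1 hm').2 (truncSq_le hn0)
  rw [lt_div_iff₀ (by positivity)] at h
  have h3 := (abs_le.1 h1).2
  have h4 := wdist_nonneg (m := m) (m' := m') 1
  nlinarith

lemma mom2_continuous_wdist_two (hm : MemP d 2 m) {ε : ℝ} (hε : 0 < ε) :
    ∃ η > (0 : ℝ), ∀ m' : Measure (Ed d), MemP d 2 m' → wdist d 2 m m' < η →
      |mom2 m' - mom2 m| < ε := by
  have h0 := mom2_nonneg m
  set θ := ε / 2 / (mom2 m + 1) with hθ
  have hθ0 : 0 < θ := by positivity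
  have hθm : θ * mom2 m ≤ ε / 2 := by
    rw [hθ, div_mul_eq_mul_div, div_le_iff₀ (by positivity)]
    nlinarith
  obtain ⟨η, hη, hη'⟩ : ∃ η > (0 : ℝ), (1 + 1 / θ) * η ^ 2 ≤ ε / 2 :=
    ⟨√(ε / 2 / (1 + 1 / θ)), by positivity, by
      rw [Real.sq_sqrt (by positivity)]
      field_simp; rfl⟩
  refine ⟨η, hη, fun m' hm' h => ?_⟩
  obtain ⟨γ, h1, h2, h3⟩ := exists_coupling_of_wdist_two_lt hm hm' h
  have i0 := (memP_two_iff.1 hm).2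
  have i0' := (memP_two_iff.1 hm').2
  have i1 := h2.integrable_fst i0
  have i2 := h2.integrable_snd i0'
  have i3 := h2.integrable_norm_sub_sq hm hm'
  have key : |mom2 m' - mom2 m| ≤ (1 + 1 / θ) * ∫ q, ‖q.1 - q.2‖ ^ 2 ∂γ + θ * mom2 m := by
    unfold mom2
    rw [← h2.integral_fst i0, ← h2.integral_snd i0', ← integral_sub i2 i1,
      ← integral_const_mul, ← integral_const_mul, ← integral_add (by fun_prop) (by fun_prop)]
    refine (abs_integral_le_integral_abs).trans (integral_mono (i2.sub i1).abs
      ((i3.const_mul _).add (i1.const_mul _)) fun q => ?_)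
    beta_reduce
    have h4 := abs_le.1 (abs_norm_sub_norm_le q.1 q.2)
    set a := ‖q.1‖
    set b := ‖q.2‖
    set c := ‖q.1 - q.2‖
    have ha : 0 ≤ a := norm_nonneg _
    have hc : 0 ≤ c := norm_nonneg _
    have h5 : |b ^ 2 - a ^ 2| ≤ c ^ 2 + 2 * a * c := by
      have : b ^ 2 - a ^ 2 = (b - a) * (b + a) := by ring
      rw [this, abs_mul]
      have e1 : |b - a| ≤ c := abs_le.2 ⟨by linarith, by linarith⟩
      have e2 : |b + a| ≤ c + 2 * a := abs_le.2 ⟨by linarith [norm_nonneg q.2], by linarith⟩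
      calc _ ≤ c * (c + 2 * a) := by gcongr
        _ = _ := by ring
    have h6 : 2 * a * c ≤ 1 / θ * c ^ 2 + θ * a ^ 2 := by
      have : 1 / θ * c ^ 2 + θ * a ^ 2 - 2 * a * c = 1 / θ * (c - θ * a) ^ 2 := by
        field_simp; ring
      have h7 : 0 ≤ 1 / θ * (c - θ * a) ^ 2 := by positivity
      linarith
    linarith
  calc _ ≤ _ := key
    _ < (1 + 1 / θ) * η ^ 2 + ε / 2 := by
      have : (1 + 1 / θ) * ∫ q, ‖q.1 - q.2‖ ^ 2 ∂γ < (1 + 1 / θ) * η ^ 2 := by gcongr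
      linarith
    _ ≤ ε := by linarith

end Coupling

/-! ### Gaussian measures and the heat flow -/

/-- The standard Gaussian measure on `ℝ^d`. -/
abbrev stdG (d : ℕ) : Measure (Ed d) := ProbabilityTheory.stdGaussian (Ed d)

lemma integrable_gaussDensity (d : ℕ) {δ : ℝ} (hδ : 0 < δ) :
    Integrable (gaussDensity d δ) := by
  have h := (GaussianFourier.integrable_cexp_neg_mul_sq_norm_add (V := Ed d)
    (b := ((1 / (2 * δ) : ℝ) : ℂ)) (by simpa using hδ) 0 0).norm
  refine (h.const_mul ((2 * Real.pi * δ) ^ (-(d : ℝ) / 2))).congr (ae_of_all _ fun x => ?_)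
  simp only [gaussDensity, Complex.norm_exp]
  congr 2
  simp [← Complex.ofReal_pow]
  field_simp

lemma gaussDensity_nonneg (d : ℕ) {δ : ℝ} (hδ : 0 < δ) (x : Ed d) : 0 ≤ gaussDensity d δ x := by
  unfold gaussDensity; positivity

lemma isFiniteMeasure_gaussMeasure (d : ℕ) {δ : ℝ} (hδ : 0 < δ) :
    IsFiniteMeasure (gaussMeasure d δ) :=
  isFiniteMeasure_withDensity_ofReal (integrable_gaussDensity d hδ).2

lemma charFun_gaussMeasure (d : ℕ) {δ : ℝ} (hδ : 0 < δ) (t : Ed d) :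
    charFun (gaussMeasure d δ) t = Complex.exp (-(δ * ‖t‖ ^ 2 / 2 : ℝ)) := by
  have hm : Measurable (fun x : Ed d => ENNReal.ofReal (gaussDensity d δ x)) := by
    unfold gaussDensity; fun_prop
  rw [charFun_apply, gaussMeasure, integral_withDensity_eq_integral_toReal_smul hm (by simp)]
  have h := GaussianFourier.integral_cexp_neg_mul_sq_norm_add (V := Ed d)
    (b := ((1 / (2 * δ) : ℝ) : ℂ)) (by simpa using hδ) Complex.I t
  have e : ∀ x : Ed d, (ENNReal.ofReal (gaussDensity d δ x)).toReal •
      Complex.exp (inner ℝ x t * Complex.I)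
      = ((2 * Real.pi * δ) ^ (-(d : ℝ) / 2) : ℝ) *
        Complex.exp (-((1 / (2 * δ) : ℝ) : ℂ) * ‖x‖ ^ 2 + Complex.I * inner ℝ t x) := by
    intro x
    rw [ENNReal.toReal_ofReal (gaussDensity_nonneg d hδ x), Complex.real_smul, gaussDensity,
      Complex.ofReal_mul, mul_assoc, Complex.ofReal_exp, ← Complex.exp_add,
      real_inner_comm]
    congr 2
    push_cast
    field_simp
  simp_rw [e]
  rw [integral_const_mul, h]
  have hpi : (Real.pi / ((1 / (2 * δ) : ℝ) : ℂ)) = ((2 * Real.pi * δ : ℝ) : ℂ) := by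
    push_cast; field_simp
  rw [hpi]
  have h0 : 0 < 2 * Real.pi * δ := by positivity
  have : ((Module.finrank ℝ (Ed d) : ℂ) / 2) = (((d : ℝ) / 2 : ℝ) : ℂ) := by simp
  rw [this, ← Complex.ofReal_cpow h0.le, ← mul_assoc, ← Complex.ofReal_mul,
    ← Real.rpow_add h0]
  have : -(d : ℝ) / 2 + d / 2 = 0 := by ring
  rw [this, Real.rpow_zero]
  push_cast
  rw [one_mul]
  congr 1
  have : (δ : ℂ) ≠ 0 := by exact_mod_cast hδ.ne'
  rw [Complex.I_sq]
  field_simp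
  ring

lemma gaussMeasure_eq_map (d : ℕ) {δ : ℝ} (hδ : 0 < δ) :
    gaussMeasure d δ = (stdG d).map (fun z => √δ • z) := by
  have := isFiniteMeasure_gaussMeasure d hδ
  refine Measure.ext_of_charFun (funext fun t => ?_)
  rw [charFun_gaussMeasure d hδ, charFun_map_smul, ProbabilityTheory.charFun_stdGaussian]
  congr 1
  rw [norm_smul, Real.norm_of_nonneg (Real.sqrt_nonneg _)]
  push_cast
  rw [mul_pow, ← Complex.ofReal_pow (√δ), Real.sq_sqrt hδ.le]
  ring

/-- The heat flow is the law of `X + √(s-t) Z` with `X ∼ m` and `Z` an independent standard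
Gaussian vector. -/
lemma heatFlow_eq_map {d : ℕ} (t s : ℝ) (m : Measure (Ed d)) [SFinite m] :
    heatFlow d t s m = (m.prod (stdG d)).map (fun q => q.1 + √(s - t) • q.2) := by
  unfold heatFlow
  split_ifs with h
  · have : √(s - t) = 0 := Real.sqrt_eq_zero_of_nonpos (by linarith)
    simp only [this, zero_smul, add_zero]
    exact (by simp : (m.prod (stdG d)).map Prod.fst = m).symm
  · rw [gaussMeasure_eq_map d (by linarith)]
    have : (m.prod ((stdG d).map (fun z => √(s - t) • z)))
        = (m.prod (stdG d)).map (Prod.map id (fun z => √(s - t) • z)) := by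
      rw [← Measure.map_prod_map _ _ measurable_id (by fun_prop), Measure.map_id]
    rw [this, Measure.map_map (by fun_prop) (by fun_prop)]
    rfl

instance {d : ℕ} (t s : ℝ) (m : Measure (Ed d)) [IsFiniteMeasure m] :
    IsFiniteMeasure (heatFlow d t s m) := by
  rw [heatFlow_eq_map]; infer_instance

instance {d : ℕ} (t s : ℝ) (m : Measure (Ed d)) [IsProbabilityMeasure m] :
    IsProbabilityMeasure (heatFlow d t s m) := by
  rw [heatFlow_eq_map]
  exact Measure.isProbabilityMeasure_map (by fun_prop)

lemma heatFlow_of_le {d : ℕ} {t s : ℝ} (h : s ≤ t) (m : Measure (Ed d)) :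
    heatFlow d t s m = m := if_pos h

lemma memLp_two_stdG (d : ℕ) : MemLp id 2 (stdG d) :=
  ProbabilityTheory.IsGaussian.memLp_two_id

lemma integrable_norm_sq_stdG (d : ℕ) : Integrable (fun z => ‖z‖ ^ 2) (stdG d) :=
  (memLp_two_stdG d).integrable_norm_pow two_ne_zero

/-- The first absolute moment of the standard Gaussian vector. -/
def gNorm (d : ℕ) : ℝ := ∫ z, ‖z‖ ∂(stdG d)

lemma gNorm_nonneg (d : ℕ) : 0 ≤ gNorm d := integral_nonneg fun _ => norm_nonneg _

lemma memP_two_heatFlow {d : ℕ} {m : Measure (Ed d)} (hm : MemP d 2 m) (t s : ℝ) :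
    MemP d 2 (heatFlow d t s m) := by
  have := hm.1
  refine memP_two_iff.2 ⟨inferInstance, ?_⟩
  rw [heatFlow_eq_map, integrable_map_measure (by fun_prop) (by fun_prop)]
  have h1 : Integrable (fun q : Ed d × Ed d => ‖q.1‖ ^ 2) (m.prod (stdG d)) :=
    (memP_two_iff.1 hm).2.comp_fst (stdG d)
  have h2 : Integrable (fun q : Ed d × Ed d => ‖q.2‖ ^ 2) (m.prod (stdG d)) :=
    (integrable_norm_sq_stdG d).comp_snd m
  refine ((h1.const_mul 2).add (h2.const_mul (2 * √(s - t) ^ 2))).mono' (by fun_prop)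
    (ae_of_all _ fun q => ?_)
  simp only [Function.comp, Pi.add_apply, norm_pow, norm_norm]
  have h3 := norm_add_le q.1 (√(s - t) • q.2)
  rw [norm_smul, Real.norm_of_nonneg (Real.sqrt_nonneg _)] at h3
  nlinarith [norm_nonneg (q.1 + √(s - t) • q.2), sq_nonneg (‖q.1‖ - √(s - t) * ‖q.2‖)]

/-- Two times of the same heat flow are coupled through the same Gaussian vector. -/
lemma heatFlow_coupling {d : ℕ} {m : Measure (Ed d)} (hm : MemP d 1 m) (t s s' : ℝ) :
    wdist d 1 (heatFlow d t s m) (heatFlow d t s' m) ≤ |√(s - t) - √(s' - t)| * gNorm d := by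
  have := hm.1
  set F : Ed d × Ed d → Ed d × Ed d :=
    fun q => (q.1 + √(s - t) • q.2, q.1 + √(s' - t) • q.2) with hF
  have hFm : Measurable F := by fun_prop
  have : IsProbabilityMeasure ((m.prod (stdG d)).map F) :=
    Measure.isProbabilityMeasure_map hFm.aemeasurable
  have hc : IsCoupling d ((m.prod (stdG d)).map F) (heatFlow d t s m) (heatFlow d t s' m) := by
    constructor
    · rw [Measure.map_map (by fun_prop) hFm, heatFlow_eq_map]; rfl
    · rw [Measure.map_map (by fun_prop) hFm, heatFlow_eq_map]; rfl
  refine (wdist_one_le hc).trans (le_of_eq ?_)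
  rw [integral_map hFm.aemeasurable (by fun_prop)]
  have : ∀ q : Ed d × Ed d, ‖(F q).1 - (F q).2‖ = |√(s - t) - √(s' - t)| * ‖q.2‖ := by
    intro q
    simp only [hF, add_sub_add_left_eq_sub, ← sub_smul, norm_smul, Real.norm_eq_abs]
  simp_rw [this]
  rw [integral_const_mul, integral_fun_snd (f := fun z : Ed d => ‖z‖)]
  simp [gNorm]

lemma integral_heatFlow {d : ℕ} {m : Measure (Ed d)} [IsFiniteMeasure m] (t s : ℝ)
    {φ : Ed d → ℝ} (hφ : Continuous φ) {c : ℝ} (hc : ∀ x, |φ x| ≤ c) :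
    ∫ x, φ x ∂(heatFlow d t s m) = ∫ x, ∫ z, φ (x + √(s - t) • z) ∂(stdG d) ∂m := by
  rw [heatFlow_eq_map, integral_map (by fun_prop) (by fun_prop), integral_prod]
  exact (integrable_const c).mono' (by fun_prop) (ae_of_all _ fun q => hc _)

/-- The trigonometric test functions `x ↦ cos (⟨ξ, x⟩ + θ)`. -/
def trig {d : ℕ} (ξ : Ed d) (θ : ℝ) (x : Ed d) : ℝ := Real.cos (inner ℝ ξ x + θ)

lemma continuous_trig {d : ℕ} (ξ : Ed d) (θ : ℝ) : Continuous (trig ξ θ) := by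
  unfold trig; fun_prop

lemma abs_trig_le {d : ℕ} (ξ : Ed d) (θ : ℝ) (x : Ed d) : |trig ξ θ x| ≤ 1 :=
  Real.abs_cos_le_one _

lemma integrable_trig {d : ℕ} (ξ : Ed d) (θ : ℝ) {m : Measure (Ed d)} [IsFiniteMeasure m] :
    Integrable (trig ξ θ) m :=
  (integrable_const (1 : ℝ)).mono' (continuous_trig ξ θ).aestronglyMeasurable
    (ae_of_all _ fun x => abs_trig_le ξ θ x)

lemma abs_integral_trig_le {d : ℕ} (ξ : Ed d) (θ : ℝ) {m : Measure (Ed d)}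
    [IsProbabilityMeasure m] : |∫ x, trig ξ θ x ∂m| ≤ 1 := by
  have := norm_integral_le_of_norm_le_const (μ := m) (f := trig ξ θ) (C := 1)
    (ae_of_all _ fun x => abs_trig_le ξ θ x)
  simpa using this

lemma trig_lip {d : ℕ} (ξ : Ed d) (θ : ℝ) (x y : Ed d) :
    |trig ξ θ x - trig ξ θ y| ≤ ‖ξ‖ * ‖x - y‖ := by
  unfold trig
  have h : LipschitzWith 1 Real.cos := by
    refine lipschitzWith_of_nnnorm_deriv_le Real.differentiable_cos fun x => ?_
    rw [Real.deriv_cos', ← NNReal.coe_le_coe]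
    simpa using Real.abs_sin_le_one x
  have h1 := h.dist_le_mul (inner ℝ ξ x + θ) (inner ℝ ξ y + θ)
  rw [Real.dist_eq, Real.dist_eq] at h1
  refine h1.trans ?_
  have : inner ℝ ξ x + θ - (inner ℝ ξ y + θ) = inner ℝ ξ (x - y) := by
    rw [inner_sub_right]; ring
  rw [this]
  simpa using abs_real_inner_le_norm ξ (x - y)

lemma charFun_re_im {d : ℕ} (m : Measure (Ed d)) [IsFiniteMeasure m] (ξ : Ed d) :
    charFun m ξ = (∫ x, trig ξ 0 x ∂m : ℝ) + (∫ x, trig ξ (-(Real.pi / 2)) x ∂m : ℝ) * Complex.I := by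
  have h1 : Integrable (fun x => ((trig ξ 0 x : ℝ) : ℂ)) m := (integrable_trig ξ 0).ofReal
  have h2 : Integrable (fun x => ((trig ξ (-(Real.pi / 2)) x : ℝ) : ℂ) * Complex.I) m :=
    (integrable_trig ξ (-(Real.pi / 2))).ofReal.mul_const _
  rw [charFun_apply, ← integral_complex_ofReal, ← integral_complex_ofReal,
    ← integral_mul_const, ← integral_add h1 h2]
  refine integral_congr_ae (ae_of_all _ fun x => ?_)
  simp only [trig, ← sub_eq_add_neg, Real.cos_sub_pi_div_two, add_zero]
  rw [Complex.exp_mul_I, real_inner_comm]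
  push_cast
  rfl

lemma integral_trig {d : ℕ} (m : Measure (Ed d)) [IsFiniteMeasure m] (ξ : Ed d) (θ : ℝ) :
    ∫ x, trig ξ θ x ∂m = (charFun m ξ * Complex.exp (θ * Complex.I)).re := by
  have h1 := integrable_trig ξ 0 (m := m)
  have h2 := integrable_trig ξ (-(Real.pi / 2)) (m := m)
  have : ∀ x : Ed d, trig ξ θ x
      = Real.cos θ * trig ξ 0 x - Real.sin θ * trig ξ (-(Real.pi / 2)) x := by
    intro x
    simp only [trig, ← sub_eq_add_neg, Real.cos_sub_pi_div_two, add_zero, Real.cos_add]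
    ring
  simp_rw [this]
  rw [integral_sub (h1.const_mul _) (h2.const_mul _), integral_const_mul, integral_const_mul,
    charFun_re_im, Complex.exp_mul_I, ← Complex.ofReal_cos, ← Complex.ofReal_sin]
  simp only [Complex.mul_re, Complex.add_re, Complex.add_im, Complex.mul_im, Complex.ofReal_re,
    Complex.ofReal_im, Complex.I_re, Complex.I_im]
  ring

lemma charFun_heatFlow {d : ℕ} (m : Measure (Ed d)) [IsFiniteMeasure m] {t s : ℝ} (h : t ≤ s)
    (ξ : Ed d) :
    charFun (heatFlow d t s m) ξ = charFun m ξ * Real.exp (-((s - t) * ‖ξ‖ ^ 2 / 2)) := by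
  rw [heatFlow_eq_map, charFun_apply, integral_map (by fun_prop) (by fun_prop)]
  have e : ∀ q : Ed d × Ed d, Complex.exp (inner ℝ (q.1 + √(s - t) • q.2) ξ * Complex.I)
      = Complex.exp (inner ℝ q.1 ξ * Complex.I) *
        Complex.exp (inner ℝ q.2 (√(s - t) • ξ) * Complex.I) := by
    intro q
    rw [← Complex.exp_add, inner_add_left, real_inner_smul_left, real_inner_smul_right]
    push_cast
    ring_nf
  simp_rw [e]
  rw [integral_prod_mul (fun x : Ed d => Complex.exp (inner ℝ x ξ * Complex.I))
    (fun z : Ed d => Complex.exp (inner ℝ z (√(s - t) • ξ) * Complex.I)),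
    ← charFun_apply, ← charFun_apply, ProbabilityTheory.charFun_stdGaussian]
  congr 1
  rw [norm_smul, Real.norm_of_nonneg (Real.sqrt_nonneg _), Complex.ofReal_exp]
  congr 1
  push_cast
  rw [mul_pow, ← Complex.ofReal_pow (√(s - t)), Real.sq_sqrt (by linarith)]
  push_cast
  ring

lemma integral_trig_heatFlow {d : ℕ} (m : Measure (Ed d)) [IsFiniteMeasure m] {t s : ℝ}
    (h : t ≤ s) (ξ : Ed d) (θ : ℝ) :
    ∫ x, trig ξ θ x ∂(heatFlow d t s m)
      = (∫ x, trig ξ θ x ∂m) * Real.exp (-((s - t) * ‖ξ‖ ^ 2 / 2)) := by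
  rw [integral_trig, integral_trig, charFun_heatFlow m h, mul_right_comm, Complex.re_mul_ofReal]

lemma heatFlow_heatFlow {d : ℕ} (m : Measure (Ed d)) [IsFiniteMeasure m] {t s r : ℝ}
    (h : t ≤ s) (h' : s ≤ r) : heatFlow d s r (heatFlow d t s m) = heatFlow d t r m := by
  refine Measure.ext_of_charFun (funext fun ξ => ?_)
  rw [charFun_heatFlow _ h', charFun_heatFlow _ h, charFun_heatFlow _ (h.trans h'), mul_assoc,
    ← Complex.ofReal_mul, ← Real.exp_add]
  congr 3
  ring

lemma heatFlow_smul {d : ℕ} (c : ℝ≥0∞) (m : Measure (Ed d)) (t s : ℝ) :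
    heatFlow d t s (c • m) = c • heatFlow d t s m := by
  unfold heatFlow
  split_ifs
  · rfl
  · have := isFiniteMeasure_gaussMeasure d (δ := s - t) (by linarith)
    rw [Measure.prod_smul_left, Measure.map_smul]

/-! ### The Hamiltonian -/

section Ham

set_option linter.unusedSectionVars false

variable {d : ℕ} {A B : Type} [MetricSpace A] [CompactSpace A] [Nonempty A]
  [MetricSpace B] [CompactSpace B] [Nonempty B]

/-- The lower value `inf_u sup_v φ(u,v)` of a continuous payoff. -/
def infSup (φ : C(A × B, ℝ)) : ℝ := ⨅ u : A, ⨆ v : B, φ (u, v)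

lemma bddAbove_range_payoff (φ : C(A × B, ℝ)) (u : A) : BddAbove (range fun v : B => φ (u, v)) := by
  refine ⟨‖φ‖, ?_⟩
  rintro _ ⟨v, rfl⟩
  exact (le_abs_self _).trans (φ.norm_coe_le_norm (u, v))

lemma bddBelow_range_payoff (φ : C(A × B, ℝ)) : BddBelow (range fun u : A => ⨆ v : B, φ (u, v)) := by
  refine ⟨-‖φ‖, ?_⟩
  rintro _ ⟨u, rfl⟩
  obtain ⟨v⟩ := ‹Nonempty B›
  exact ((abs_le.1 (φ.norm_coe_le_norm (u, v))).1).trans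
    (le_ciSup (bddAbove_range_payoff φ u) v)

lemma infSup_le_add (φ ψ : C(A × B, ℝ)) : infSup φ ≤ infSup ψ + ‖φ - ψ‖ := by
  rw [← sub_le_iff_le_add]
  refine le_ciInf fun u => ?_
  rw [sub_le_iff_le_add]
  refine (ciInf_le (bddBelow_range_payoff φ) u).trans (ciSup_le fun v => ?_)
  have h1 := (abs_le.1 ((φ - ψ).norm_coe_le_norm (u, v))).2
  have h2 := le_ciSup (bddAbove_range_payoff ψ u) v
  simp only [ContinuousMap.sub_apply] at h1
  linarith

lemma abs_infSup_sub_le (φ ψ : C(A × B, ℝ)) : |infSup φ - infSup ψ| ≤ ‖φ - ψ‖ := by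
  rw [abs_le]
  have h1 := infSup_le_add φ ψ
  have h2 := infSup_le_add ψ φ
  rw [norm_sub_rev] at h2
  constructor <;> linarith

lemma continuous_infSup : Continuous (infSup : C(A × B, ℝ) → ℝ) := by
  refine LipschitzWith.continuous (K := 1) (LipschitzWith.of_dist_le_mul fun φ ψ => ?_)
  rw [Real.dist_eq, dist_eq_norm]
  simpa using abs_infSup_sub_le φ ψ

lemma infSup_smul {c : ℝ} (hc : 0 ≤ c) (φ : C(A × B, ℝ)) : infSup (c • φ) = c * infSup φ := by
  simp only [infSup, ContinuousMap.smul_apply, smul_eq_mul, Real.mul_iInf_of_nonneg hc,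
    Real.mul_iSup_of_nonneg hc]

lemma abs_infSup_le (φ : C(A × B, ℝ)) : |infSup φ| ≤ ‖φ‖ := by
  have h : infSup (0 : C(A × B, ℝ)) = 0 := by simpa using infSup_smul le_rfl φ
  simpa [h] using abs_infSup_sub_le φ 0

/-- The standing assumptions on the running cost. -/
structure CostHyp (f : ℝ → Ed d → A → B → ℝ) (C : ℝ) : Prop where
  bdd : ∀ s x u v, |f s x u v| ≤ C
  cont : Continuous fun q : ℝ × Ed d × A × B => f q.1 q.2.1 q.2.2.1 q.2.2.2
  lip : ∀ (u : A) (v : B), ∀ s s' : ℝ, ∀ x x' : Ed d,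
      |f s x u v - f s' x' u v| ≤ C * (‖x - x'‖ + |s - s'|)

variable {f : ℝ → Ed d → A → B → ℝ} {C : ℝ}

/-- The running cost as a continuous payoff on the controls. -/
def CostHyp.payoff (h : CostHyp f C) (s : ℝ) (x : Ed d) : C(A × B, ℝ) where
  toFun p := f s x p.1 p.2
  continuous_toFun := h.cont.comp (by fun_prop : Continuous fun p : A × B => (s, x, p.1, p.2))

lemma CostHyp.nonneg (h : CostHyp f C) : 0 ≤ C := by
  obtain ⟨u⟩ := ‹Nonempty A›
  obtain ⟨v⟩ := ‹Nonempty B›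
  exact (abs_nonneg _).trans (h.bdd 0 0 u v)

lemma CostHyp.norm_payoff_le (h : CostHyp f C) (s : ℝ) (x : Ed d) : ‖h.payoff s x‖ ≤ C :=
  (ContinuousMap.norm_le _ h.nonneg).2 fun p => h.bdd s x p.1 p.2

lemma CostHyp.norm_payoff_sub_le (h : CostHyp f C) (s s' : ℝ) (x x' : Ed d) :
    ‖h.payoff s x - h.payoff s' x'‖ ≤ C * (‖x - x'‖ + |s - s'|) :=
  (ContinuousMap.norm_le _ (mul_nonneg h.nonneg (by positivity))).2 fun p =>
    h.lip p.1 p.2 s s' x x'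

lemma CostHyp.continuous_payoff (h : CostHyp f C) (s : ℝ) : Continuous (h.payoff s) := by
  refine LipschitzWith.continuous (K := C.toNNReal) (LipschitzWith.of_dist_le_mul fun x y => ?_)
  rw [dist_eq_norm, dist_eq_norm, Real.coe_toNNReal C h.nonneg]
  simpa using h.norm_payoff_sub_le s s x y

lemma CostHyp.integrable_payoff (h : CostHyp f C) (s : ℝ) (m : Measure (Ed d))
    [IsFiniteMeasure m] : Integrable (h.payoff s) m :=
  (integrable_const C).mono' (h.continuous_payoff s).aestronglyMeasurable
    (ae_of_all _ (h.norm_payoff_le s))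

/-- The running cost averaged over a measure, as a payoff on the controls. -/
def CostHyp.avg (h : CostHyp f C) (s : ℝ) (m : Measure (Ed d)) : C(A × B, ℝ) :=
  ∫ x, h.payoff s x ∂m

lemma CostHyp.avg_apply (h : CostHyp f C) (s : ℝ) (m : Measure (Ed d)) [IsFiniteMeasure m]
    (p : A × B) : h.avg s m p = ∫ x, f s x p.1 p.2 ∂m :=
  ((ContinuousMap.evalCLM ℝ p).integral_comp_comm (h.integrable_payoff s m)).symm

lemma CostHyp.hamiltonian_eq (h : CostHyp f C) (s : ℝ) (m : Measure (Ed d)) [IsFiniteMeasure m] :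
    hamiltonian f s m = infSup (h.avg s m) := by
  simp only [hamiltonian, infSup, h.avg_apply]

lemma CostHyp.norm_avg_le (h : CostHyp f C) (s : ℝ) (m : Measure (Ed d)) [IsFiniteMeasure m] :
    ‖h.avg s m‖ ≤ C * m.real univ :=
  norm_integral_le_of_norm_le_const (ae_of_all _ (h.norm_payoff_le s))

lemma CostHyp.norm_avg_sub_le (h : CostHyp f C) (s s' : ℝ) {m m' : Measure (Ed d)}
    (hm : MemP d 1 m) (hm' : MemP d 1 m') :
    ‖h.avg s m - h.avg s' m'‖ ≤ C * (|s - s'| + wdist d 1 m m') := by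
  have := hm.1
  have := hm'.1
  have hC := h.nonneg
  have hw : 0 ≤ wdist d 1 m m' := wdist_nonneg 1
  refine (ContinuousMap.norm_le _ (by positivity)).2 fun p => ?_
  have hi : ∀ (r : ℝ) (μ : Measure (Ed d)) [IsFiniteMeasure μ],
      Integrable (fun x => f r x p.1 p.2) μ := fun r μ _ =>
    (ContinuousMap.evalCLM ℝ p).integrable_comp (h.integrable_payoff r μ)
  rw [ContinuousMap.sub_apply, h.avg_apply, h.avg_apply, Real.norm_eq_abs]
  have h1 : |∫ x, f s x p.1 p.2 ∂m - ∫ x, f s' x p.1 p.2 ∂m| ≤ C * |s - s'| := by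
    rw [← integral_sub (hi _ _) (hi _ _)]
    have := norm_integral_le_of_norm_le_const (μ := m)
      (f := fun x => f s x p.1 p.2 - f s' x p.1 p.2) (C := C * |s - s'|)
      (ae_of_all _ fun x => by simpa using h.lip p.1 p.2 s s' x x)
    simpa using this
  have h2 : |∫ x, f s' x p.1 p.2 ∂m - ∫ x, f s' x p.1 p.2 ∂m'| ≤ C * wdist d 1 m m' :=
    abs_integral_sub_le_wdist hC hm hm' (hi _ _) (hi _ _)
      fun x y => by simpa using h.lip p.1 p.2 s' s' x y
  calc _ ≤ _ := abs_sub_le _ (∫ x, f s' x p.1 p.2 ∂m) _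
    _ ≤ C * |s - s'| + C * wdist d 1 m m' := add_le_add h1 h2
    _ = _ := by ring

lemma CostHyp.abs_ham_le (h : CostHyp f C) (s : ℝ) (m : Measure (Ed d)) [IsFiniteMeasure m] :
    |hamiltonian f s m| ≤ C * m.real univ := by
  rw [h.hamiltonian_eq]
  exact (abs_infSup_le _).trans (h.norm_avg_le s m)

lemma CostHyp.abs_ham_sub_le (h : CostHyp f C) (s s' : ℝ) {m m' : Measure (Ed d)}
    (hm : MemP d 1 m) (hm' : MemP d 1 m') :
    |hamiltonian f s m - hamiltonian f s' m'| ≤ C * (|s - s'| + wdist d 1 m m') := by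
  have := hm.1
  have := hm'.1
  rw [h.hamiltonian_eq, h.hamiltonian_eq]
  exact (abs_infSup_sub_le _ _).trans (h.norm_avg_sub_le s s' hm hm')

lemma CostHyp.ham_smul (h : CostHyp f C) (s : ℝ) (m : Measure (Ed d)) [IsFiniteMeasure m]
    {c : ℝ≥0∞} (hc : c ≠ ∞) : hamiltonian f s (c • m) = c.toReal * hamiltonian f s m := by
  lift c to ℝ≥0 using hc
  have : IsFiniteMeasure ((c : ℝ≥0∞) • m) := m.smul_finite (by simp)
  rw [h.hamiltonian_eq, h.hamiltonian_eq, CostHyp.avg, integral_smul_measure, ← CostHyp.avg,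
    infSup_smul ENNReal.toReal_nonneg]

section Mixture

variable {Ω : Type} {mΩ : MeasurableSpace Ω} {M : Ω → Measure (Ed d)}

lemma CostHyp.stronglyMeasurable_avg (h : CostHyp f C) (s : ℝ) (hM : Measurable M)
    (hp : ∀ ω, IsProbabilityMeasure (M ω)) : StronglyMeasurable fun ω => h.avg s (M ω) := by
  let κ : ProbabilityTheory.Kernel Ω (Ed d) := ⟨M, hM⟩
  have : ProbabilityTheory.IsMarkovKernel κ := ⟨hp⟩
  exact (h.continuous_payoff s).stronglyMeasurable.integral_kernel (κ := κ)

lemma CostHyp.measurable_ham (h : CostHyp f C) (s : ℝ) (hM : Measurable M)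
    (hp : ∀ ω, IsProbabilityMeasure (M ω)) : Measurable fun ω => hamiltonian f s (M ω) := by
  simp_rw [fun ω => h.hamiltonian_eq s (M ω)]
  exact (continuous_infSup.comp_stronglyMeasurable (h.stronglyMeasurable_avg s hM hp)).measurable

lemma isFiniteMeasure_bind (P : Measure Ω) [IsFiniteMeasure P] (hM : Measurable M)
    (hp : ∀ ω, IsProbabilityMeasure (M ω)) : IsFiniteMeasure (P.bind M) := by
  refine ⟨?_⟩
  rw [Measure.bind_apply .univ hM.aemeasurable]
  simp

lemma bind_apply_univ (P : Measure Ω) (hM : Measurable M)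
    (hp : ∀ ω, IsProbabilityMeasure (M ω)) : (P.bind M) univ = P univ := by
  rw [Measure.bind_apply .univ hM.aemeasurable]
  simp

lemma integral_bind {E : Type} [NormedAddCommGroup E] [NormedSpace ℝ E] (P : Measure Ω)
    [IsFiniteMeasure P] (hM : Measurable M) (hp : ∀ ω, IsProbabilityMeasure (M ω)) {g : Ed d → E}
    (hg : Integrable g (P.bind M)) : ∫ x, g x ∂(P.bind M) = ∫ ω, ∫ x, g x ∂(M ω) ∂P := by
  let κ : ProbabilityTheory.Kernel Ω (Ed d) := ⟨M, hM⟩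
  have : ProbabilityTheory.IsMarkovKernel κ := ⟨hp⟩
  have e : (ProbabilityTheory.Kernel.comp κ (ProbabilityTheory.Kernel.const Unit P)) ()
      = P.bind M := by
    rw [ProbabilityTheory.Kernel.comp_apply, ProbabilityTheory.Kernel.const_apply]
    rfl
  have := ProbabilityTheory.Kernel.integral_comp (η := κ)
    (κ := ProbabilityTheory.Kernel.const Unit P) (a := ()) (f := g) (by rw [e]; exact hg)
  rw [e, ProbabilityTheory.Kernel.const_apply] at this
  exact this

lemma CostHyp.avg_bind (h : CostHyp f C) (s : ℝ) (P : Measure Ω) [IsFiniteMeasure P]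
    (hM : Measurable M) (hp : ∀ ω, IsProbabilityMeasure (M ω)) :
    h.avg s (P.bind M) = ∫ ω, h.avg s (M ω) ∂P := by
  have := isFiniteMeasure_bind P hM hp
  exact integral_bind P hM hp (h.integrable_payoff s _)

lemma sum_setIntegral_fiber {E : Type} [NormedAddCommGroup E] [NormedSpace ℝ E] {ι : Type}
    [Fintype ι] {Y : Ω → ι} (hY : ∀ i, MeasurableSet (Y ⁻¹' {i})) {P : Measure Ω} {g : Ω → E}
    (hg : Integrable g P) : ∑ i, ∫ ω in Y ⁻¹' {i}, g ω ∂P = ∫ ω, g ω ∂P := by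
  rw [← integral_iUnion_fintype hY ?_ fun i => hg.integrableOn]
  · rw [show (⋃ i, Y ⁻¹' {i}) = univ by ext; simp, Measure.restrict_univ]
  · intro i j hij
    exact Disjoint.preimage _ (by simpa using hij)

/-- On a sufficiently fine finite partition, the Hamiltonian of the mixtures is almost bounded by
the averaged Hamiltonian. -/
lemma CostHyp.exists_partition (h : CostHyp f C) (s : ℝ) (P : Measure Ω) [IsFiniteMeasure P]
    {𝓖 : MeasurableSpace Ω} (hG : 𝓖 ≤ mΩ) (hM : Measurable[𝓖] M)
    (hp : ∀ ω, IsProbabilityMeasure (M ω)) {ε : ℝ} (hε : 0 < ε) :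
    ∃ (κ : Type) (_ : Fintype κ) (Z : Ω → κ), (∀ k, MeasurableSet[𝓖] (Z ⁻¹' {k})) ∧
      ∀ (ι : Type) [Fintype ι] (Y : Ω → ι), (∀ i, MeasurableSet[mΩ] (Y ⁻¹' {i})) →
        ∑ i : ι × κ, hamiltonian f s ((P.restrict ((fun ω => (Y ω, Z ω)) ⁻¹' {i})).bind M)
          ≤ ∫ ω, hamiltonian f s (M ω) ∂P + ε := by
  have hM' : Measurable[mΩ] M := hM.mono hG le_rfl
  set J : Ω → C(A × B, ℝ) := fun ω => h.avg s (M ω) with hJ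
  have hJm : StronglyMeasurable[𝓖] J := h.stronglyMeasurable_avg (mΩ := 𝓖) s hM hp
  have hJb : ∀ ω, ‖J ω‖ ≤ C := fun ω => by simpa using h.norm_avg_le s (M ω)
  have hJi : Integrable J P := (integrable_const C).mono' (hJm.mono hG).aestronglyMeasurable
    (ae_of_all _ hJb)
  obtain ⟨n, hn⟩ : ∃ n, ∫ ω, ‖J ω - hJm.approxBounded C n ω‖ ∂P < ε / 2 := by
    have : Tendsto (fun n => ∫ ω, ‖J ω - hJm.approxBounded C n ω‖ ∂P) atTop
        (𝓝 (∫ ω, (0 : ℝ) ∂P)) := by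
      refine tendsto_integral_of_dominated_convergence (fun _ => C + C) (fun n => ?_)
        (integrable_const _) (fun n => ae_of_all _ fun ω => ?_) (ae_of_all _ fun ω => ?_)
      · exact ((hJm.mono hG).sub
          ((hJm.approxBounded C n).stronglyMeasurable.mono hG)).norm.aestronglyMeasurable
      · rw [norm_norm]
        exact (norm_sub_le _ _).trans
          (add_le_add (hJb ω) (hJm.norm_approxBounded_le h.nonneg n ω))
      · have := (hJm.tendsto_approxBounded_of_norm_le (hJb ω)).const_sub (J ω)
        simpa using this.norm
    rw [integral_zero] at this
    exact (this.eventually (gt_mem_nhds (half_pos hε))).exists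
  set S := hJm.approxBounded C n with hS
  have hSm : StronglyMeasurable[mΩ] S := S.stronglyMeasurable.mono hG
  have hSi : Integrable S P := (integrable_const C).mono' hSm.aestronglyMeasurable
    (ae_of_all _ fun ω => hJm.norm_approxBounded_le h.nonneg n ω)
  refine ⟨{x // x ∈ S.range}, inferInstance, fun ω => ⟨S ω, S.mem_range_self ω⟩, fun k => ?_,
    fun ι _ Y hY => ?_⟩
  · convert S.measurableSet_fiber k.1 using 1
    ext ω
    simp [Subtype.ext_iff]
  set Z : Ω → {x // x ∈ S.range} := fun ω => ⟨S ω, S.mem_range_self ω⟩ with hZ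
  set W : Ω → ι × {x // x ∈ S.range} := fun ω => (Y ω, Z ω) with hW
  have hWm : ∀ i, MeasurableSet[mΩ] (W ⁻¹' {i}) := fun i => by
    have : W ⁻¹' {i} = Y ⁻¹' {i.1} ∩ S ⁻¹' {i.2.1} := by
      ext ω
      simp [hW, hZ, Prod.ext_iff, Subtype.ext_iff]
    rw [this]
    exact (hY _).inter (hG _ (S.measurableSet_fiber _))
  have hHi : Integrable (fun ω => infSup (J ω)) P := (integrable_const C).mono'
    (continuous_infSup.comp_stronglyMeasurable (hJm.mono hG)).aestronglyMeasurable
    (ae_of_all _ fun ω => (abs_infSup_le _).trans (hJb ω))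
  have hNi : Integrable (fun ω => ‖J ω - S ω‖) P := (hJi.sub hSi).norm
  have key : ∀ i, hamiltonian f s ((P.restrict (W ⁻¹' {i})).bind M)
      ≤ ∫ ω in W ⁻¹' {i}, infSup (J ω) + 2 * ‖J ω - S ω‖ ∂P := fun i => by
    have := isFiniteMeasure_bind (P.restrict (W ⁻¹' {i})) hM' hp
    rw [h.hamiltonian_eq, h.avg_bind s _ hM' hp]
    have e1 : ∫ ω in W ⁻¹' {i}, S ω ∂P = (P.real (W ⁻¹' {i})) • i.2.1 := by
      rw [setIntegral_congr_fun (hWm i) (g := fun _ => i.2.1) ?_, setIntegral_const]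
      rintro ω rfl
      rfl
    have e2 : P.real (W ⁻¹' {i}) * infSup i.2.1
        ≤ ∫ ω in W ⁻¹' {i}, infSup (J ω) + ‖J ω - S ω‖ ∂P := by
      rw [← smul_eq_mul, ← setIntegral_const]
      refine setIntegral_mono_on (integrable_const _).integrableOn
        (hHi.add hNi).integrableOn (hWm i) ?_
      rintro ω rfl
      have := infSup_le_add (S ω) (J ω)
      rwa [norm_sub_rev] at this
    calc infSup (∫ ω in W ⁻¹' {i}, J ω ∂P)
        ≤ infSup (∫ ω in W ⁻¹' {i}, S ω ∂P)
          + ‖∫ ω in W ⁻¹' {i}, J ω ∂P - ∫ ω in W ⁻¹' {i}, S ω ∂P‖ := infSup_le_add _ _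
      _ ≤ ∫ ω in W ⁻¹' {i}, infSup (J ω) + ‖J ω - S ω‖ ∂P
          + ∫ ω in W ⁻¹' {i}, ‖J ω - S ω‖ ∂P := by
        refine add_le_add ?_ ?_
        · rw [e1, infSup_smul measureReal_nonneg]
          exact e2
        · rw [← integral_sub hJi.integrableOn hSi.integrableOn]
          exact norm_integral_le_integral_norm _
      _ = _ := by
        have e3 := integral_add (hHi.add hNi).integrableOn (hNi.integrableOn (s := W ⁻¹' {i}))
        simp only [Pi.add_apply] at e3
        rw [← e3]
        refine integral_congr_ae (ae_of_all _ fun ω => ?_)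
        dsimp only
        ring
  calc _ ≤ ∑ i, ∫ ω in W ⁻¹' {i}, infSup (J ω) + 2 * ‖J ω - S ω‖ ∂P :=
        Finset.sum_le_sum fun i _ => key i
    _ = ∫ ω, infSup (J ω) + 2 * ‖J ω - S ω‖ ∂P :=
        sum_setIntegral_fiber hWm (hHi.add (hNi.const_mul 2))
    _ = ∫ ω, infSup (J ω) ∂P + 2 * ∫ ω, ‖J ω - S ω‖ ∂P := by
        rw [integral_add hHi (hNi.const_mul 2), integral_const_mul]
    _ ≤ _ := by
        simp_rw [fun ω => h.hamiltonian_eq s (M ω)]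
        linarith

end Mixture

end Ham

/-! ### Compactness of sets of bounded second moment -/

section Pieces

variable {d : ℕ}

/-- A coupling built from matching decompositions of two measures into pieces of small diameter
and a remainder. -/
lemma exists_coupling_pieces {ι : Type} [Fintype ι] {m m' : Measure (Ed d)}
    [IsProbabilityMeasure m] [IsProbabilityMeasure m'] {m₀ m₀' : Measure (Ed d)}
    {n n' : ι → Measure (Ed d)} (hm : m = m₀ + ∑ i, n i) (hm' : m' = m₀' + ∑ i, n' i)
    {D R : ℝ≥0∞} (hD : ∀ i, ∀ᵐ x ∂(n i), ∀ᵐ y ∂(n' i), ‖x - y‖ₑ ≤ D)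
    (hR : ∀ i, ∀ᵐ x ∂(n i), ‖x‖ₑ ≤ R) (hR' : ∀ i, ∀ᵐ x ∂(n' i), ‖x‖ₑ ≤ R) :
    ∃ γ : Measure (Ed d × Ed d), IsCoupling d γ m m' ∧
      ∫⁻ q, ‖q.1 - q.2‖ₑ ∂γ ≤ D + (∫⁻ x, ‖x‖ₑ ∂m₀ + R * ∑ i, (n i univ - n' i univ))
        + (∫⁻ x, ‖x‖ₑ ∂m₀' + R * ∑ i, (n' i univ - n i univ)) := by
  have hle : ∀ i, n i ≤ m := fun i => by
    rw [hm]
    exact (Finset.single_le_sum (f := n) (fun _ _ => Measure.zero_le _) (Finset.mem_univ i)).trans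
      (Measure.le_add_left le_rfl)
  have hle' : ∀ i, n' i ≤ m' := fun i => by
    rw [hm']
    exact (Finset.single_le_sum (f := n') (fun _ _ => Measure.zero_le _) (Finset.mem_univ i)).trans
      (Measure.le_add_left le_rfl)
  have hle0 : m₀ ≤ m := by rw [hm]; exact Measure.le_add_right le_rfl
  have hle0' : m₀' ≤ m' := by rw [hm']; exact Measure.le_add_right le_rfl
  have f0 : IsFiniteMeasure m₀ := isFiniteMeasure_of_le m hle0
  have f0' : IsFiniteMeasure m₀' := isFiniteMeasure_of_le m' hle0'
  have fn : ∀ i, IsFiniteMeasure (n i) := fun i => isFiniteMeasure_of_le m (hle i)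
  have fn' : ∀ i, IsFiniteMeasure (n' i) := fun i => isFiniteMeasure_of_le m' (hle' i)
  set a : ι → ℝ≥0∞ := fun i => n i univ with ha
  set b : ι → ℝ≥0∞ := fun i => n' i univ with hb
  have ha_top : ∀ i, a i ≠ ∞ := fun i => measure_ne_top _ _
  have hb_top : ∀ i, b i ≠ ∞ := fun i => measure_ne_top _ _
  set k : ι → ℝ≥0∞ := fun i => (max (a i) (b i))⁻¹ with hk
  have hkmax : ∀ i, k i * max (a i) (b i) ≤ 1 := fun i => ENNReal.inv_mul_le_one _
  have hka : ∀ i, k i * a i ≤ 1 := fun i => (by gcongr; exact le_max_left _ _ :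
    k i * a i ≤ k i * max (a i) (b i)).trans (hkmax i)
  have hkb : ∀ i, k i * b i ≤ 1 := fun i => (by gcongr; exact le_max_right _ _ :
    k i * b i ≤ k i * max (a i) (b i)).trans (hkmax i)
  -- masses left over
  have hmassa : ∀ i, (1 - k i * b i) * a i = a i - b i := fun i => by
    rcases eq_or_ne (a i) 0 with h0 | h0
    · simp [h0]
    have hmax0 : max (a i) (b i) ≠ 0 := fun h => h0 (by
      have := le_max_left (a i) (b i); rw [h] at this; exact le_antisymm this zero_le)
    have hmaxt : max (a i) (b i) ≠ ∞ := by simp [ha_top i, hb_top i]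
    rw [ENNReal.sub_mul fun _ _ => ha_top i, one_mul]
    rcases le_total (a i) (b i) with h | h
    · have : k i * b i = 1 := by
        rw [hk]; dsimp only; rw [max_eq_right h] at hmax0 hmaxt ⊢
        exact ENNReal.inv_mul_cancel hmax0 hmaxt
      rw [this, one_mul, tsub_self, tsub_eq_zero_of_le h]
    · have : k i * b i * a i = b i := by
        rw [hk]; dsimp only; rw [max_eq_left h, mul_right_comm, ENNReal.inv_mul_cancel h0 (ha_top i),
          one_mul]
      rw [this]
  have hmassb : ∀ i, (1 - k i * a i) * b i = b i - a i := fun i => by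
    rcases eq_or_ne (b i) 0 with h0 | h0
    · simp [h0]
    have hmax0 : max (a i) (b i) ≠ 0 := fun h => h0 (by
      have := le_max_right (a i) (b i); rw [h] at this; exact le_antisymm this zero_le)
    have hmaxt : max (a i) (b i) ≠ ∞ := by simp [ha_top i, hb_top i]
    rw [ENNReal.sub_mul fun _ _ => hb_top i, one_mul]
    rcases le_total (b i) (a i) with h | h
    · have : k i * a i = 1 := by
        rw [hk]; dsimp only; rw [max_eq_left h] at hmax0 hmaxt ⊢
        exact ENNReal.inv_mul_cancel hmax0 hmaxt
      rw [this, one_mul, tsub_self, tsub_eq_zero_of_le h]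
    · have : k i * a i * b i = a i := by
        rw [hk]; dsimp only; rw [max_eq_right h, mul_right_comm,
          ENNReal.inv_mul_cancel h0 (hb_top i), one_mul]
      rw [this]
  set β : Measure (Ed d) := m₀ + ∑ i, (1 - k i * b i) • n i with hβ
  set β' : Measure (Ed d) := m₀' + ∑ i, (1 - k i * a i) • n' i with hβ'
  have hsplit : m = β + ∑ i, (k i * b i) • n i := by
    rw [hm, hβ, add_assoc, ← Finset.sum_add_distrib]
    congr 1
    refine Finset.sum_congr rfl fun i _ => ?_
    rw [← add_smul, tsub_add_cancel_of_le (hkb i), one_smul]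
  have hsplit' : m' = β' + ∑ i, (k i * a i) • n' i := by
    rw [hm', hβ', add_assoc, ← Finset.sum_add_distrib]
    congr 1
    refine Finset.sum_congr rfl fun i _ => ?_
    rw [← add_smul, tsub_add_cancel_of_le (hka i), one_smul]
  have fβ : IsFiniteMeasure β := isFiniteMeasure_of_le m (by
    rw [hsplit]; exact Measure.le_add_right le_rfl)
  have fβ' : IsFiniteMeasure β' := isFiniteMeasure_of_le m' (by
    rw [hsplit']; exact Measure.le_add_right le_rfl)
  have hsum1 : β univ + ∑ i, k i * b i * a i = 1 := by
    have := congrArg (fun ν : Measure (Ed d) => ν univ) hsplit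
    simpa [Measure.finsetSum_apply] using this.symm
  have hsum2 : β' univ + ∑ i, k i * b i * a i = 1 := by
    have := congrArg (fun ν : Measure (Ed d) => ν univ) hsplit'
    simp only [measure_univ, Measure.add_apply, Measure.finsetSum_apply, Measure.smul_apply,
      smul_eq_mul] at this
    rw [this]
    congr 1
    exact Finset.sum_congr rfl fun i _ => by rw [mul_right_comm]
  have hr : β' univ = β univ := by
    have hfin : ∑ i, k i * b i * a i ≠ ∞ := fun h => by
      rw [h] at hsum1; simp at hsum1
    exact (ENNReal.add_left_inj hfin).1 (hsum2.trans hsum1.symm)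
  set r := β univ with hr0
  have hrt : r ≠ ∞ := measure_ne_top _ _
  refine ⟨(∑ i, k i • (n i).prod (n' i)) + r⁻¹ • β.prod β', ⟨?_, ?_⟩, ?_⟩
  · rw [Measure.map_add _ _ measurable_fst, Measure.map_smul, ← Measure.mapₗ_apply_of_measurable
      measurable_fst (∑ i, k i • (n i).prod (n' i)), map_sum]
    simp only [Measure.mapₗ_apply_of_measurable measurable_fst, Measure.map_smul,
      Measure.map_fst_prod, smul_smul]
    rw [hr, hsplit, add_comm]
    congr 1
    rcases eq_or_ne r 0 with h | h
    · rw [show β = 0 from Measure.measure_univ_eq_zero.1 h, smul_zero]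
    · rw [ENNReal.inv_mul_cancel h hrt, one_smul]
  · rw [Measure.map_add _ _ measurable_snd, Measure.map_smul, ← Measure.mapₗ_apply_of_measurable
      measurable_snd (∑ i, k i • (n i).prod (n' i)), map_sum]
    simp only [Measure.mapₗ_apply_of_measurable measurable_snd, Measure.map_smul,
      Measure.map_snd_prod, smul_smul]
    rw [← hr0, hsplit', add_comm]
    congr 1
    rcases eq_or_ne r 0 with h | h
    · rw [show β' = 0 from Measure.measure_univ_eq_zero.1 (hr.trans h), smul_zero]
    · rw [ENNReal.inv_mul_cancel h hrt, one_smul]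
  · rw [lintegral_add_measure, lintegral_finsetSum_measure, lintegral_smul_measure, add_assoc]
    refine add_le_add ?_ ?_
    · calc ∑ i, ∫⁻ q, ‖q.1 - q.2‖ₑ ∂(k i • (n i).prod (n' i))
          ≤ ∑ i, k i * b i * a i * D := Finset.sum_le_sum fun i _ => by
            rw [lintegral_smul_measure, lintegral_prod _ (by fun_prop), smul_eq_mul, mul_assoc,
              mul_assoc]
            gcongr
            calc ∫⁻ x, ∫⁻ y, ‖x - y‖ₑ ∂(n' i) ∂(n i) ≤ ∫⁻ x, D * b i ∂(n i) := by
                  refine lintegral_mono_ae ((hD i).mono fun x hx => ?_)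
                  calc ∫⁻ y, ‖x - y‖ₑ ∂(n' i) ≤ ∫⁻ y, D ∂(n' i) := lintegral_mono_ae hx
                    _ = _ := by rw [lintegral_const]
              _ = b i * (a i * D) := by rw [lintegral_const]; ring
        _ ≤ 1 * D := by
            rw [← Finset.sum_mul]
            gcongr
            rw [← hsum1]
            exact le_add_self
        _ = D := one_mul _
    · have e1 : ∫⁻ x, ‖x‖ₑ ∂β ≤ ∫⁻ x, ‖x‖ₑ ∂m₀ + R * ∑ i, (a i - b i) := by
        rw [hβ, lintegral_add_measure, lintegral_finsetSum_measure, Finset.mul_sum]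
        gcongr with i
        rw [lintegral_smul_measure, smul_eq_mul, ← hmassa, mul_left_comm]
        gcongr
        calc _ ≤ ∫⁻ x, R ∂(n i) := lintegral_mono_ae (hR i)
          _ = _ := lintegral_const _
      have e2 : ∫⁻ x, ‖x‖ₑ ∂β' ≤ ∫⁻ x, ‖x‖ₑ ∂m₀' + R * ∑ i, (b i - a i) := by
        rw [hβ', lintegral_add_measure, lintegral_finsetSum_measure, Finset.mul_sum]
        gcongr with i
        rw [lintegral_smul_measure, smul_eq_mul, ← hmassb, mul_left_comm]
        gcongr
        calc _ ≤ ∫⁻ x, R ∂(n' i) := lintegral_mono_ae (hR' i)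
          _ = _ := lintegral_const _
      refine le_trans ?_ (add_le_add e1 e2)
      calc r⁻¹ • ∫⁻ q, ‖q.1 - q.2‖ₑ ∂(β.prod β')
          ≤ r⁻¹ * ∫⁻ q, (‖q.1‖ₑ + ‖q.2‖ₑ) ∂(β.prod β') := by
            rw [smul_eq_mul]
            gcongr with q
            exact enorm_sub_le
        _ = r⁻¹ * (r * (∫⁻ x, ‖x‖ₑ ∂β + ∫⁻ x, ‖x‖ₑ ∂β')) := by
            congr 1
            rw [lintegral_add_left (by fun_prop), lintegral_prod _ (by fun_prop),
              lintegral_prod _ (by fun_prop)]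
            simp only [lintegral_const]
            rw [lintegral_mul_const _ (by fun_prop), hr, ← hr0]
            ring
        _ ≤ 1 * (∫⁻ x, ‖x‖ₑ ∂β + ∫⁻ x, ‖x‖ₑ ∂β') := by
            rw [← mul_assoc]
            gcongr
            exact ENNReal.inv_mul_le_one _
        _ = _ := one_mul _

lemma wdist_one_le_of_lintegral {m m' : Measure (Ed d)} [IsProbabilityMeasure m]
    {γ : Measure (Ed d × Ed d)} (h : IsCoupling d γ m m') {c : ℝ} (hc : 0 ≤ c)
    (hγ : ∫⁻ q, ‖q.1 - q.2‖ₑ ∂γ ≤ ENNReal.ofReal c) : wdist d 1 m m' ≤ c := by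
  have : IsProbabilityMeasure γ := ⟨by
    rw [← preimage_univ (f := Prod.fst), ← Measure.map_apply measurable_fst .univ, h.1]
    exact measure_univ⟩
  refine (wdist_one_le h).trans ?_
  rw [integral_norm_eq_lintegral_enorm (by fun_prop)]
  exact ENNReal.toReal_le_of_le_ofReal hc hγ

end Pieces

section Compactness

variable {d : ℕ}

lemma lintegral_norm_tail_le {m : Measure (Ed d)} (hm : MemP d 2 m) {R R₀ : ℝ} (hR₀ : 0 < R₀)
    (hR : mom2 m ≤ R) {g : Ed d → ℝ≥0∞} (hg : Measurable g) (hg1 : ∀ x, g x ≤ 1)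
    (hg0 : ∀ x, g x ≠ 0 → R₀ < ‖x‖) :
    ∫⁻ x, ‖x‖ₑ ∂(m.withDensity g) ≤ ENNReal.ofReal (R / R₀) := by
  have hi := (memP_two_iff.1 hm).2
  rw [lintegral_withDensity_eq_lintegral_mul _ hg (by fun_prop)]
  simp only [Pi.mul_apply]
  calc ∫⁻ x, g x * ‖x‖ₑ ∂m ≤ ∫⁻ x, ENNReal.ofReal (‖x‖ ^ 2 / R₀) ∂m := by
        refine lintegral_mono fun x => ?_
        by_cases hx : g x = 0
        · simp [hx]
        have h1 := hg0 x hx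
        calc g x * ‖x‖ₑ ≤ 1 * ‖x‖ₑ := by gcongr; exact hg1 x
          _ = ENNReal.ofReal ‖x‖ := by rw [one_mul, ofReal_norm]
          _ ≤ _ := by
            refine ENNReal.ofReal_le_ofReal ?_
            rw [le_div_iff₀ hR₀]
            nlinarith [norm_nonneg x]
    _ = ENNReal.ofReal (∫ x, ‖x‖ ^ 2 / R₀ ∂m) :=
        (ofReal_integral_eq_lintegral_ofReal (hi.div_const _)
          (ae_of_all _ fun x => by positivity)).symm
    _ ≤ _ := by
        rw [integral_div]
        exact ENNReal.ofReal_le_ofReal (div_le_div_of_nonneg_right hR hR₀.le)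

lemma eq_add_sum_withDensity {ι : Type} [Fintype ι] (m : Measure (Ed d))
    {g : Option ι → Ed d → ℝ≥0∞} (hg : ∀ i, Measurable (g i)) (h1 : ∀ x, ∑ i, g i x = 1) :
    m = m.withDensity (g none) + ∑ i, m.withDensity (g (some i)) := by
  ext s hs
  rw [Measure.add_apply, Measure.finsetSum_apply, withDensity_apply _ hs]
  simp_rw [withDensity_apply _ hs]
  rw [← lintegral_finsetSum _ fun i _ => hg _, ← lintegral_add_left (hg _)]
  calc m s = ∫⁻ x in s, 1 ∂m := by simp
    _ = _ := lintegral_congr fun x => by rw [← h1 x, Fintype.sum_option]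

lemma tendsto_wdist_of_tendsto {μ : ℕ → ProbabilityMeasure (Ed d)} {μ' : ProbabilityMeasure (Ed d)}
    (h : Tendsto μ atTop (𝓝 μ')) {R : ℝ} (hμ : ∀ k, MemP d 2 (μ k : Measure (Ed d)))
    (hμ' : MemP d 2 (μ' : Measure (Ed d))) (hR : ∀ k, mom2 (μ k : Measure (Ed d)) ≤ R)
    (hR' : mom2 (μ' : Measure (Ed d)) ≤ R) :
    Tendsto (fun k => wdist d 1 (μ' : Measure (Ed d)) (μ k)) atTop (𝓝 0) := by
  have hR00 : 0 ≤ R := (mom2_nonneg _).trans hR'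
  suffices H : ∀ ε > (0 : ℝ), ∀ᶠ k in atTop, wdist d 1 (μ' : Measure (Ed d)) (μ k) ≤ ε by
    refine tendsto_order.2 ⟨fun a ha => Eventually.of_forall fun k => ha.trans_le (wdist_nonneg 1),
      fun a ha => (H (a / 2) (half_pos ha)).mono fun k hk => by linarith⟩
  intro ε hε
  set δ := ε / 8 with hδ
  have hδ0 : 0 < δ := by positivity
  set R₀ := R / δ + 1 with hR₀
  have hR₀0 : 0 < R₀ := by positivity
  have hRR : R / R₀ ≤ δ := by
    rw [div_le_iff₀ hR₀0, hR₀, mul_add, mul_div_cancel₀ _ hδ0.ne']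
    linarith
  obtain ⟨t, hts, htf, hcov⟩ := (isCompact_closedBall (0 : Ed d) R₀).finite_cover_balls hδ0
  have : Fintype t := htf.fintype
  set U : Option t → Set (Ed d) := fun i => i.elim {x | R₀ < ‖x‖} fun y => Metric.ball y.1 δ with hU
  have hUo : ∀ i, IsOpen (U i) := by
    rintro (_ | y)
    · exact isOpen_lt continuous_const continuous_norm
    · exact Metric.isOpen_ball
  have hUc : univ ⊆ ⋃ i, U i := fun x _ => by
    by_cases hx : ‖x‖ ≤ R₀
    · obtain ⟨y, hy, hxy⟩ := mem_iUnion₂.1 (hcov (by simpa using hx : x ∈ Metric.closedBall 0 R₀))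
      exact mem_iUnion.2 ⟨some ⟨y, hy⟩, hxy⟩
    · exact mem_iUnion.2 ⟨none, not_le.1 hx⟩
  obtain ⟨χ, hχ⟩ := PartitionOfUnity.exists_isSubordinate isClosed_univ U hUo hUc
  set g : Option t → Ed d → ℝ≥0∞ := fun i x => ENNReal.ofReal (χ i x) with hg
  have hgm : ∀ i, Measurable (g i) := fun i => ((χ i).continuous.measurable).ennreal_ofReal
  have hgU : ∀ i x, g i x ≠ 0 → x ∈ U i := fun i x hx =>
    hχ i (subset_tsupport _ fun h0 => hx (by simp [hg, h0]))
  have hg1 : ∀ i x, g i x ≤ 1 := fun i x => by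
    rw [hg, ← ENNReal.ofReal_one]
    exact ENNReal.ofReal_le_ofReal (χ.le_one i x)
  have hsum : ∀ x, ∑ i, g i x = 1 := fun x => by
    rw [← ENNReal.ofReal_sum_of_nonneg fun i _ => χ.nonneg i x, ← finsum_eq_sum_of_fintype,
      χ.sum_eq_one (mem_univ x), ENNReal.ofReal_one]
  have hmass : ∀ i, Tendsto (fun k => ((μ k : Measure (Ed d)).withDensity (g i)) univ) atTop
      (𝓝 (((μ' : Measure (Ed d)).withDensity (g i)) univ)) := fun i => by
    have e : ∀ ν : ProbabilityMeasure (Ed d), ((ν : Measure (Ed d)).withDensity (g i)) univ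
        = ENNReal.ofReal (∫ x, χ i x ∂(ν : Measure (Ed d))) := fun ν => by
      rw [withDensity_apply _ .univ, Measure.restrict_univ, ofReal_integral_eq_lintegral_ofReal]
      · exact (integrable_const (1 : ℝ)).mono' (χ i).continuous.aestronglyMeasurable
          (ae_of_all _ fun x => by rw [Real.norm_of_nonneg (χ.nonneg i x)]; exact χ.le_one i x)
      · exact ae_of_all _ fun x => χ.nonneg i x
    simp_rw [e]
    refine (ENNReal.continuous_ofReal.tendsto _).comp ?_
    exact ProbabilityMeasure.tendsto_iff_forall_integral_tendsto.1 h
      (BoundedContinuousFunction.ofNormedAddCommGroup (χ i) (χ i).continuous 1 fun x => by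
        rw [Real.norm_of_nonneg (χ.nonneg i x)]; exact χ.le_one i x)
  have hfin : ∀ i (ν : ProbabilityMeasure (Ed d)),
      ((ν : Measure (Ed d)).withDensity (g i)) univ ≠ ∞ := fun i ν => by
    rw [withDensity_apply _ .univ, Measure.restrict_univ]
    refine ne_top_of_le_ne_top ENNReal.one_ne_top ((lintegral_mono (hg1 i)).trans ?_)
    simp
  set n' : ℕ → t → ℝ≥0∞ := fun k i => ((μ k : Measure (Ed d)).withDensity (g (some i))) univ
  set n : t → ℝ≥0∞ := fun i => ((μ' : Measure (Ed d)).withDensity (g (some i))) univ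
  have hbound : ∀ k, ∃ γ : Measure (Ed d × Ed d), IsCoupling d γ μ' (μ k) ∧
      ∫⁻ q, ‖q.1 - q.2‖ₑ ∂γ ≤ ENNReal.ofReal (2 * δ)
        + (ENNReal.ofReal δ + ENNReal.ofReal (R₀ + δ) * ∑ i, (n i - n' k i))
        + (ENNReal.ofReal δ + ENNReal.ofReal (R₀ + δ) * ∑ i, (n' k i - n i)) := fun k => by
    have hball : ∀ (i : t) (x : Ed d), g (some i) x ≠ 0 → ‖x - i.1‖ < δ := fun i x hx => by
      simpa [hU, dist_eq_norm] using hgU (some i) x hx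
    have hball' : ∀ (i : t) (x : Ed d), g (some i) x ≠ 0 → ‖x‖ₑ ≤ ENNReal.ofReal (R₀ + δ) :=
      fun i x hx => by
        rw [← ofReal_norm]
        refine ENNReal.ofReal_le_ofReal ?_
        have h1 := hball i x hx
        have h2 : ‖i.1‖ ≤ R₀ := by simpa using hts i.2
        have h3 := norm_add_le (x - i.1) i.1
        rw [sub_add_cancel] at h3
        linarith
    obtain ⟨γ, h1, h2⟩ := exists_coupling_pieces (D := ENNReal.ofReal (2 * δ))
      (R := ENNReal.ofReal (R₀ + δ))
      (eq_add_sum_withDensity (μ' : Measure (Ed d)) hgm hsum)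
      (eq_add_sum_withDensity (μ k : Measure (Ed d)) hgm hsum)
      (fun i => by
        rw [ae_withDensity_iff (hgm _)]
        refine ae_of_all _ fun x hx => ?_
        rw [ae_withDensity_iff (hgm _)]
        refine ae_of_all _ fun y hy => ?_
        rw [← ofReal_norm]
        refine ENNReal.ofReal_le_ofReal ?_
        have h3 := norm_sub_le (x - i.1) (y - i.1)
        rw [sub_sub_sub_cancel_right] at h3
        linarith [hball i x hx, hball i y hy])
      (fun i => by
        rw [ae_withDensity_iff (hgm _)]
        exact ae_of_all _ fun x hx => hball' i x hx)
      (fun i => by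
        rw [ae_withDensity_iff (hgm _)]
        exact ae_of_all _ fun x hx => hball' i x hx)
    refine ⟨γ, h1, h2.trans ?_⟩
    have t1 := (lintegral_norm_tail_le hμ' hR₀0 hR' (hgm none) (hg1 none)
      (fun x hx => hgU none x hx)).trans (ENNReal.ofReal_le_ofReal hRR)
    have t2 := (lintegral_norm_tail_le (hμ k) hR₀0 (hR k) (hgm none) (hg1 none)
      (fun x hx => hgU none x hx)).trans (ENNReal.ofReal_le_ofReal hRR)
    gcongr
  have hlim : Tendsto (fun k => ENNReal.ofReal (2 * δ)
        + (ENNReal.ofReal δ + ENNReal.ofReal (R₀ + δ) * ∑ i, (n i - n' k i))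
        + (ENNReal.ofReal δ + ENNReal.ofReal (R₀ + δ) * ∑ i, (n' k i - n i))) atTop
      (𝓝 (ENNReal.ofReal (2 * δ) + (ENNReal.ofReal δ + ENNReal.ofReal (R₀ + δ) * ∑ _i : t, 0)
        + (ENNReal.ofReal δ + ENNReal.ofReal (R₀ + δ) * ∑ _i : t, 0))) := by
    have s1 : Tendsto (fun k => ∑ i, (n i - n' k i)) atTop (𝓝 (∑ _i : t, 0)) := by
      refine tendsto_finsetSum _ fun i _ => ?_
      rw [← tsub_self (n i)]
      exact ENNReal.Tendsto.sub tendsto_const_nhds (hmass (some i)) (Or.inl (hfin (some i) μ'))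
    have s2 : Tendsto (fun k => ∑ i, (n' k i - n i)) atTop (𝓝 (∑ _i : t, 0)) := by
      refine tendsto_finsetSum _ fun i _ => ?_
      rw [← tsub_self (n i)]
      exact ENNReal.Tendsto.sub (hmass (some i)) tendsto_const_nhds (Or.inl (hfin (some i) μ'))
    exact (tendsto_const_nhds.add (tendsto_const_nhds.add
      (ENNReal.Tendsto.const_mul s1 (Or.inr ENNReal.ofReal_ne_top)))).add
      (tendsto_const_nhds.add (ENNReal.Tendsto.const_mul s2 (Or.inr ENNReal.ofReal_ne_top)))
  have hlt : ENNReal.ofReal (2 * δ) + (ENNReal.ofReal δ + ENNReal.ofReal (R₀ + δ) * ∑ _i : t, 0)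
        + (ENNReal.ofReal δ + ENNReal.ofReal (R₀ + δ) * ∑ _i : t, 0) < ENNReal.ofReal ε := by
    simp only [Finset.sum_const_zero, mul_zero, add_zero]
    rw [← ENNReal.ofReal_add (by positivity) hδ0.le, ← ENNReal.ofReal_add (by positivity) hδ0.le,
      ENNReal.ofReal_lt_ofReal_iff hε]
    linarith
  filter_upwards [hlim.eventually (gt_mem_nhds hlt)] with k hk
  obtain ⟨γ, h1, h2⟩ := hbound k
  exact wdist_one_le_of_lintegral h1 hε.le (h2.trans hk.le)

lemma isTightMeasureSet_of_mom2_le {S : Set (Measure (Ed d))} {R : ℝ}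
    (hS : ∀ ρ ∈ S, MemP d 2 ρ ∧ mom2 ρ ≤ R) : IsTightMeasureSet S := by
  refine isTightMeasureSet_of_tendsto_measure_norm_gt ?_
  have hz : Tendsto (fun r : ℝ => ENNReal.ofReal (R / r ^ 2)) atTop (𝓝 0) := by
    rw [← ENNReal.ofReal_zero]
    refine (ENNReal.continuous_ofReal.tendsto _).comp ?_
    exact tendsto_const_nhds.div_atTop (tendsto_pow_atTop two_ne_zero)
  refine tendsto_of_tendsto_of_tendsto_of_le_of_le' tendsto_const_nhds hz
    (Eventually.of_forall fun _ => zero_le) ?_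
  filter_upwards [eventually_gt_atTop 0] with r hr
  refine iSup₂_le fun ρ hρ => ?_
  have hi := (memP_two_iff.1 (hS ρ hρ).1).2
  have h1 := mul_meas_ge_le_integral_of_nonneg (μ := ρ) (f := fun x : Ed d => ‖x‖ ^ 2)
    (ae_of_all _ fun x : Ed d => sq_nonneg ‖x‖) hi (r ^ 2)
  have := (hS ρ hρ).1.1
  calc ρ {x | r < ‖x‖} ≤ ρ {x | r ^ 2 ≤ ‖x‖ ^ 2} := by
        refine measure_mono fun x hx => ?_
        have hx' : r < ‖x‖ := hx
        show r ^ 2 ≤ ‖x‖ ^ 2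
        gcongr
    _ = ENNReal.ofReal (ρ.real {x | r ^ 2 ≤ ‖x‖ ^ 2}) := by simp
    _ ≤ _ := by
        refine ENNReal.ofReal_le_ofReal ?_
        rw [le_div_iff₀ (by positivity), mul_comm]
        exact h1.trans (hS ρ hρ).2

lemma memP_two_of_integral_truncSq_le {m : Measure (Ed d)} [IsProbabilityMeasure m] {R : ℝ}
    (h : ∀ n : ℕ, ∫ x, truncSq d n x ∂m ≤ R) : MemP d 2 m := by
  refine memP_two_iff.2 ⟨inferInstance, (by fun_prop : Continuous fun x : Ed d =>
    ‖x‖ ^ 2).aestronglyMeasurable, ?_⟩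
  rw [hasFiniteIntegral_iff_ofReal (ae_of_all _ fun x => sq_nonneg ‖x‖)]
  have hlim : ∀ x : Ed d, liminf (fun n : ℕ => ENNReal.ofReal (truncSq d n x)) atTop
      = ENNReal.ofReal (‖x‖ ^ 2) := fun x => by
    refine Tendsto.liminf_eq (tendsto_const_nhds.congr' ?_)
    filter_upwards [eventually_ge_atTop ⌈‖x‖⌉₊] with n hn
    rw [truncSq, min_eq_left ((Nat.le_ceil _).trans (by exact_mod_cast hn))]
  calc ∫⁻ x, ENNReal.ofReal (‖x‖ ^ 2) ∂m
      = ∫⁻ x, liminf (fun n : ℕ => ENNReal.ofReal (truncSq d n x)) atTop ∂m := by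
        simp_rw [hlim]
    _ ≤ liminf (fun n : ℕ => ∫⁻ x, ENNReal.ofReal (truncSq d n x) ∂m) atTop :=
        lintegral_liminf_le fun n => (continuous_truncSq _).measurable.ennreal_ofReal
    _ ≤ ENNReal.ofReal R := by
        refine liminf_le_of_frequently_le' (Frequently.of_forall fun n => ?_)
        rw [← ofReal_integral_eq_lintegral_ofReal (integrable_truncSq n.cast_nonneg)
          (ae_of_all _ fun x => truncSq_nonneg _ _)]
        exact ENNReal.ofReal_le_ofReal (h n)
    _ < ∞ := ENNReal.ofReal_lt_top

lemma exists_subseq_tendsto {ν : ℕ → ProbabilityMeasure (Ed d)}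
    (h : IsTightMeasureSet {((ρ : ProbabilityMeasure (Ed d)) : Measure (Ed d)) | ρ ∈ range ν}) :
    ∃ (ν' : ProbabilityMeasure (Ed d)) (σ : ℕ → ℕ), StrictMono σ ∧
      Tendsto (ν ∘ σ) atTop (𝓝 ν') := by
  obtain ⟨ν', -, σ, hσ, hlim⟩ := (isCompact_closure_of_isTightMeasureSet h).isSeqCompact
    (x := ν) fun k => subset_closure (mem_range_self k)
  exact ⟨ν', σ, hσ, hlim⟩

lemma exists_subseq_tendsto_wdist {μ : ℕ → Measure (Ed d)} (hμ : ∀ k, MemP d 2 (μ k)) {R : ℝ}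
    (hR : ∀ k, mom2 (μ k) ≤ R) :
    ∃ μ' : Measure (Ed d), MemP d 2 μ' ∧ ∃ σ : ℕ → ℕ, StrictMono σ ∧
      Tendsto (fun k => wdist d 1 μ' (μ (σ k))) atTop (𝓝 0) := by
  obtain ⟨ν, rfl⟩ : ∃ ν : ℕ → ProbabilityMeasure (Ed d), μ = fun k => (ν k : Measure (Ed d)) :=
    ⟨fun k => ⟨μ k, (hμ k).1⟩, rfl⟩
  obtain ⟨ν', σ, hσ, hlim⟩ := exists_subseq_tendsto (ν := ν)
    (isTightMeasureSet_of_mom2_le (R := R) (by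
      rintro _ ⟨_, ⟨k, rfl⟩, rfl⟩
      exact ⟨hμ k, hR k⟩))
  have htr : ∀ n : ℕ, ∫ x, truncSq d n x ∂(ν' : Measure (Ed d)) ≤ R := fun n => by
    have h1 := ProbabilityMeasure.tendsto_iff_forall_integral_tendsto.1 hlim
      (BoundedContinuousFunction.ofNormedAddCommGroup (truncSq d n) (continuous_truncSq _)
        ((n : ℝ) ^ 2) fun x => by
          rw [Real.norm_of_nonneg (truncSq_nonneg _ _)]
          exact truncSq_le' n.cast_nonneg x)
    refine le_of_tendsto h1 (Eventually.of_forall fun k => ?_)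
    have := (hμ (σ k)).1
    refine le_trans ?_ (hR (σ k))
    exact integral_mono (integrable_truncSq (m := (ν (σ k) : Measure (Ed d))) n.cast_nonneg)
      (memP_two_iff.1 (hμ (σ k))).2 fun x => truncSq_le n.cast_nonneg x
  have hν' : MemP d 2 (ν' : Measure (Ed d)) := memP_two_of_integral_truncSq_le htr
  have hm' : mom2 (ν' : Measure (Ed d)) ≤ R :=
    le_of_tendsto' (tendsto_integral_truncSq hν') htr
  exact ⟨ν', hν', σ, hσ, tendsto_wdist_of_tendsto hlim (fun k => hμ (σ k)) hν'
    (fun k => hR (σ k)) hm'⟩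

end Compactness

/-! ### Neighbourhoods in time and measure -/

section Nhds

variable {d : ℕ} {p : ℝ} {I : Set ℝ} {t : ℝ} {m : Measure (Ed d)}

/-- Neighbourhoods of `(t, m)` in `I × 𝒫₂` for the distance `|·| + d_p`. -/
def nhdsTM (d : ℕ) (p : ℝ) (I : Set ℝ) (t : ℝ) (m : Measure (Ed d)) :
    Filter (ℝ × Measure (Ed d)) :=
  comap (fun q => max |q.1 - t| (wdist d p m q.2)) (𝓝 0) ⊓ 𝓟 {q | q.1 ∈ I ∧ MemP d 2 q.2}

lemma eventually_nhdsTM {Q : ℝ → Measure (Ed d) → Prop} :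
    (∀ᶠ q in nhdsTM d p I t m, Q q.1 q.2) ↔ ∃ η > (0 : ℝ), ∀ t' ∈ I, ∀ m' : Measure (Ed d),
      MemP d 2 m' → |t' - t| < η → wdist d p m m' < η → Q t' m' := by
  rw [nhdsTM, ((Metric.nhds_basis_ball.comap _).inf_principal _).eventually_iff]
  have h0 : ∀ q : ℝ × Measure (Ed d), 0 ≤ max |q.1 - t| (wdist d p m q.2) := fun q =>
    (abs_nonneg _).trans (le_max_left _ _)
  simp only [Metric.mem_ball, Real.dist_eq, sub_zero, mem_inter_iff, mem_preimage, mem_ofPred_eq,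
    abs_of_nonneg (h0 _), max_lt_iff, Prod.forall]
  exact ⟨fun ⟨η, h, H⟩ => ⟨η, h, fun t' ht m' hm h1 h2 => H _ _ ⟨⟨h1, h2⟩, ht, hm⟩⟩,
    fun ⟨η, h, H⟩ => ⟨η, h, fun t' m' hq => H _ hq.2.1 _ hq.2.2 hq.1.1 hq.1.2⟩⟩

lemma tendsto_nhdsTM_iff {g : ℝ → Measure (Ed d) → ℝ} {y : ℝ} :
    Tendsto (fun q : ℝ × Measure (Ed d) => g q.1 q.2) (nhdsTM d p I t m) (𝓝 y) ↔
      ∀ ε > (0 : ℝ), ∃ η > (0 : ℝ), ∀ t' ∈ I, ∀ m' : Measure (Ed d),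
        MemP d 2 m' → |t' - t| < η → wdist d p m m' < η → |g t' m' - y| < ε := by
  rw [Metric.tendsto_nhds]
  refine forall₂_congr fun ε _ => ?_
  rw [← eventually_nhdsTM]
  rfl

lemma nhdsTM_two_le_one (hm : MemP d 2 m) : nhdsTM d 2 I t m ≤ nhdsTM d 1 I t m := by
  intro S hS
  have h1 : ∀ᶠ q in nhdsTM d 1 I t m, (q.1, q.2) ∈ S := hS
  obtain ⟨η, h, H⟩ := (eventually_nhdsTM (Q := fun a b => (a, b) ∈ S)).1 h1
  exact (eventually_nhdsTM (Q := fun a b => (a, b) ∈ S)).2 ⟨η, h, fun t' ht m' hm' h1 h2 =>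
    H t' ht m' hm' h1 ((wdist_one_le_wdist_two hm hm').trans_lt h2)⟩

lemma nhdsTM_mono {J : Set ℝ} (h : I ⊆ J) : nhdsTM d p I t m ≤ nhdsTM d p J t m :=
  inf_le_inf_left _ (principal_mono.2 fun _ hq => ⟨h hq.1, hq.2⟩)

lemma eventually_mem_nhdsTM : ∀ᶠ q in nhdsTM d p I t m, q.1 ∈ I ∧ MemP d 2 q.2 :=
  mem_inf_of_right (mem_principal_self _)

lemma tendsto_fst_nhdsTM : Tendsto (fun q : ℝ × Measure (Ed d) => q.1) (nhdsTM d p I t m)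
    (𝓝 t) :=
  (tendsto_nhdsTM_iff (g := fun s _ => s)).2 fun ε hε => ⟨ε, hε, fun _ _ _ _ h _ => h⟩

lemma tendsto_integral_nhdsTM (hm : MemP d 2 m) {g : Ed d → ℝ} {L : ℝ} (hL : 0 ≤ L)
    (hgi : ∀ m' : Measure (Ed d), MemP d 2 m' → Integrable g m')
    (hg : ∀ x y, |g x - g y| ≤ L * ‖x - y‖) :
    Tendsto (fun q : ℝ × Measure (Ed d) => ∫ x, g x ∂q.2) (nhdsTM d 1 I t m)
      (𝓝 (∫ x, g x ∂m)) := by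
  refine (tendsto_nhdsTM_iff (g := fun _ m' => ∫ x, g x ∂m')).2 fun ε hε => ?_
  refine ⟨ε / (L + 1), by positivity, fun t' _ m' hm' _ h => ?_⟩
  rw [abs_sub_comm]
  refine (abs_integral_sub_le_wdist hL hm.one_of_two hm'.one_of_two (hgi m hm) (hgi m' hm')
    hg).trans_lt ?_
  rw [lt_div_iff₀ (by positivity)] at h
  nlinarith [wdist_nonneg (m := m) (m' := m') 1]

lemma tendsto_mom2_nhdsTM (hm : MemP d 2 m) :
    Tendsto (fun q : ℝ × Measure (Ed d) => mom2 q.2) (nhdsTM d 2 I t m) (𝓝 (mom2 m)) := by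
  refine (tendsto_nhdsTM_iff (g := fun _ m' => mom2 m')).2 fun ε hε => ?_
  obtain ⟨η, h, H⟩ := mom2_continuous_wdist_two hm hε
  exact ⟨η, h, fun t' _ m' hm' _ h' => H m' hm' h'⟩

lemma eventually_lt_log_mom2 (hm : MemP d 2 m) {y : ℝ} (hy : y < Real.log (1 + mom2 m)) :
    ∀ᶠ q in nhdsTM d 1 I t m, y < Real.log (1 + mom2 q.2) := by
  have h0 := mom2_nonneg m
  have hy' : Real.exp y < 1 + mom2 m := (Real.lt_log_iff_exp_lt (by linarith)).1 hy
  obtain ⟨η, h, H⟩ := mom2_lsc hm (sub_pos.2 hy')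
  refine (eventually_nhdsTM (Q := fun _ m' => y < Real.log (1 + mom2 m'))).2
    ⟨η, h, fun t' _ m' hm' _ h' => ?_⟩
  rw [Real.lt_log_iff_exp_lt (by linarith [mom2_nonneg m'])]
  linarith [H m' hm' h']

end Nhds

/-! ### Functions with quadratic growth up to second order -/

section Quad

variable {d : ℕ}

/-- `e` is `C²` and has quadratic growth together with its first two derivatives. -/
structure QuadFn (e : Ed d → ℝ) : Prop where
  smooth : ContDiff ℝ 2 e
  growth : ∃ c : ℝ, ∀ x : Ed d, |e x| ≤ c * (1 + ‖x‖ ^ 2) ∧ ‖fderiv ℝ e x‖ ≤ c * (1 + ‖x‖ ^ 2) ∧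
      ‖iteratedFDeriv ℝ 2 e x‖ ≤ c * (1 + ‖x‖ ^ 2)

lemma quadFn_of_bounds {e : Ed d → ℝ} (h : ContDiff ℝ 2 e) {c : ℝ}
    (h0 : ∀ x, |e x| ≤ c * (1 + ‖x‖ ^ 2)) (h1 : ∀ x, ‖fderiv ℝ e x‖ ≤ c * (1 + ‖x‖ ^ 2))
    (h2 : ∀ x v w, |fderiv ℝ (fderiv ℝ e) x v w| ≤ c * ‖v‖ * ‖w‖) : QuadFn e := by
  by_cases hc : 0 ≤ c
  · refine ⟨h, c, fun x => ⟨h0 x, h1 x, ?_⟩⟩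
    refine (ContinuousMultilinearMap.opNorm_le_bound hc fun v => ?_).trans
      (le_mul_of_one_le_right hc (by nlinarith [sq_nonneg ‖x‖]))
    rw [iteratedFDeriv_two_apply, Fin.prod_univ_two, ← mul_assoc]
    exact h2 _ _ _
  · have := (abs_nonneg _).trans (h0 0)
    simp at this
    exact absurd this hc

lemma contDiff_trig (ξ : Ed d) (θ : ℝ) : ContDiff ℝ 2 (trig ξ θ) := by
  exact Real.contDiff_cos.comp ((innerSL ℝ ξ).contDiff.add contDiff_const)

lemma fderiv_trig (ξ : Ed d) (θ : ℝ) :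
    fderiv ℝ (trig ξ θ) = fun x => (-Real.sin (inner ℝ ξ x + θ)) • innerSL ℝ ξ := by
  ext1 x
  have h : HasFDerivAt (fun x : Ed d => inner ℝ ξ x + θ) (innerSL ℝ ξ) x :=
    (innerSL ℝ ξ).hasFDerivAt.add_const θ
  exact h.cos.fderiv

lemma fderiv_fderiv_trig (ξ : Ed d) (θ : ℝ) (x v w : Ed d) :
    fderiv ℝ (fderiv ℝ (trig ξ θ)) x v w = -trig ξ θ x * inner ℝ ξ v * inner ℝ ξ w := by
  have h : HasFDerivAt (fun x : Ed d => inner ℝ ξ x + θ) (innerSL ℝ ξ) x :=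
    (innerSL ℝ ξ).hasFDerivAt.add_const θ
  have h' : HasFDerivAt (fun x => (-Real.sin (inner ℝ ξ x + θ)) • innerSL ℝ ξ) _ x :=
    h.sin.neg.smul_const (innerSL ℝ ξ)
  rw [fderiv_trig, h'.fderiv]
  simp [trig]

lemma quadFn_trig (ξ : Ed d) (θ : ℝ) : QuadFn (trig ξ θ) := by
  have hsq := fun x : Ed d => sq_nonneg ‖x‖
  refine quadFn_of_bounds (c := 1 + ‖ξ‖ + ‖ξ‖ ^ 2) (contDiff_trig ξ θ) (fun x => ?_) (fun x => ?_)
    fun x v w => ?_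
  · nlinarith [abs_trig_le ξ θ x, norm_nonneg ξ, hsq x, mul_nonneg (norm_nonneg ξ) (hsq x),
      mul_nonneg (hsq ξ) (hsq x), hsq ξ]
  · rw [fderiv_trig, norm_smul, innerSL_apply_norm, norm_neg, Real.norm_eq_abs]
    nlinarith [Real.abs_sin_le_one (inner ℝ ξ x + θ), norm_nonneg ξ, hsq x,
      mul_nonneg (norm_nonneg ξ) (hsq x), mul_nonneg (hsq ξ) (hsq x), hsq ξ,
      mul_le_mul_of_nonneg_right (Real.abs_sin_le_one (inner ℝ ξ x + θ)) (norm_nonneg ξ)]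
  · rw [fderiv_fderiv_trig, abs_mul, abs_mul, abs_neg]
    calc |trig ξ θ x| * |inner ℝ ξ v| * |inner ℝ ξ w| ≤ 1 * (‖ξ‖ * ‖v‖) * (‖ξ‖ * ‖w‖) := by
          gcongr
          · exact abs_trig_le ξ θ x
          · exact abs_real_inner_le_norm _ _
          · exact abs_real_inner_le_norm _ _
      _ = ‖ξ‖ ^ 2 * (‖v‖ * ‖w‖) := by ring
      _ ≤ (1 + ‖ξ‖ + ‖ξ‖ ^ 2) * (‖v‖ * ‖w‖) := by
          gcongr
          linarith [norm_nonneg ξ]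
      _ = _ := by ring

lemma fderiv_normSq : fderiv ℝ (fun x : Ed d => ‖x‖ ^ 2) = fun x => (2 • innerSL ℝ (E := Ed d)) x := by
  ext1 x
  rw [(hasStrictFDerivAt_norm_sq x).hasFDerivAt.fderiv]
  rfl

lemma fderiv_fderiv_normSq (x v w : Ed d) :
    fderiv ℝ (fderiv ℝ (fun x : Ed d => ‖x‖ ^ 2)) x v w = 2 * inner ℝ v w := by
  rw [fderiv_normSq]
  have h : HasFDerivAt (fun x : Ed d => (2 • innerSL ℝ (E := Ed d)) x)
      (2 • innerSL ℝ (E := Ed d)) x := ContinuousLinearMap.hasFDerivAt _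
  rw [h.fderiv]
  simp
  rfl

lemma quadFn_normSq : QuadFn (fun x : Ed d => ‖x‖ ^ 2) := by
  refine quadFn_of_bounds (c := 2) (contDiff_norm_sq ℝ) (fun x => ?_) (fun x => ?_)
    fun x v w => ?_
  · rw [abs_of_nonneg (by positivity)]
    linarith [sq_nonneg ‖x‖]
  · have : fderiv ℝ (fun x : Ed d => ‖x‖ ^ 2) x = (2 : ℝ) • innerSL ℝ x := by
      rw [fderiv_normSq]; ext v; simp
    rw [this, norm_smul, innerSL_apply_norm]
    simp only [Real.norm_ofNat]
    nlinarith [sq_nonneg (‖x‖ - 1), sq_nonneg ‖x‖]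
  · rw [fderiv_fderiv_normSq, abs_mul, abs_two, mul_assoc]
    gcongr
    exact abs_real_inner_le_norm _ _

lemma quadFn_one : QuadFn (fun _ : Ed d => (1 : ℝ)) := by
  refine quadFn_of_bounds (c := 1) contDiff_const (fun x => ?_) (fun x => ?_) fun x v w => ?_
  · simp
  · simp only [fderiv_fun_const, Pi.zero_apply, norm_zero]
    positivity
  · simp only [fderiv_fun_const]
    simp
    positivity

lemma lapl_trig (ξ : Ed d) (θ : ℝ) (x : Ed d) : lapl d (trig ξ θ) x = -‖ξ‖ ^ 2 * trig ξ θ x := by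
  have h : ∀ i : Fin d, iteratedFDeriv ℝ 2 (trig ξ θ) x
      (fun _ => EuclideanSpace.single i (1 : ℝ)) = -trig ξ θ x * ξ i ^ 2 := fun i => by
    rw [iteratedFDeriv_two_apply, fderiv_fderiv_trig, EuclideanSpace.inner_single_right]
    simp
    ring
  simp only [lapl, h, ← Finset.mul_sum, EuclideanSpace.norm_sq_eq, Real.norm_eq_abs, sq_abs]
  ring

lemma lapl_normSq (x : Ed d) : lapl d (fun x : Ed d => ‖x‖ ^ 2) x = 2 * d := by
  have h : ∀ i : Fin d, iteratedFDeriv ℝ 2 (fun x : Ed d => ‖x‖ ^ 2) x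
      (fun _ => EuclideanSpace.single i (1 : ℝ)) = 2 := fun i => by
    rw [iteratedFDeriv_two_apply, fderiv_fderiv_normSq, EuclideanSpace.inner_single_right]
    simp
  simp only [lapl, h, Finset.sum_const, Finset.card_univ, Fintype.card_fin, nsmul_eq_mul]
  ring

lemma lapl_one (x : Ed d) : lapl d (fun _ : Ed d => (1 : ℝ)) x = 0 := by
  simp [lapl, iteratedFDeriv_two_apply]

lemma lapl_add {e e' : Ed d → ℝ} (he : ContDiff ℝ 2 e) (he' : ContDiff ℝ 2 e') (x : Ed d) :
    lapl d (fun x => e x + e' x) x = lapl d e x + lapl d e' x := by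
  simp only [lapl, ← Finset.sum_add_distrib]
  refine Finset.sum_congr rfl fun i _ => ?_
  change iteratedFDeriv ℝ 2 (e + e') x _ = _
  rw [iteratedFDeriv_add_apply he.contDiffAt he'.contDiffAt]
  rfl

lemma lapl_const_mul {e : Ed d → ℝ} (he : ContDiff ℝ 2 e) (c : ℝ) (x : Ed d) :
    lapl d (fun x => c * e x) x = c * lapl d e x := by
  simp only [lapl, Finset.mul_sum]
  refine Finset.sum_congr rfl fun i _ => ?_
  change iteratedFDeriv ℝ 2 (c • e) x _ = _
  rw [iteratedFDeriv_const_smul_apply he.contDiffAt]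
  rfl

lemma lapl_sum {ι : Type} (s : Finset ι) {e : ι → Ed d → ℝ} (he : ∀ i, ContDiff ℝ 2 (e i))
    (x : Ed d) : lapl d (fun x => ∑ i ∈ s, e i x) x = ∑ i ∈ s, lapl d (e i) x := by
  classical
  induction s using Finset.induction_on with
  | empty => simp [lapl, iteratedFDeriv_two_apply]
  | insert i s hi ih =>
    simp only [Finset.sum_insert hi]
    rw [lapl_add (he i) (ContDiff.sum fun i _ => he i), ih]

end Quad

/-! ### A family of test functions -/

section Coef

variable {d : ℕ} {T : ℝ}

/-- A bounded coefficient, continuous in `(t, m)` for `d₂`. -/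
structure IsCoef (d : ℕ) (T : ℝ) (α : ℝ → Measure (Ed d) → ℝ) : Prop where
  bdd : ∃ c : ℝ, ∀ t ∈ Set.Ico 0 T, ∀ m : Measure (Ed d), MemP d 2 m → |α t m| ≤ c
  cont : ∀ t ∈ Set.Ico 0 T, ∀ m : Measure (Ed d), MemP d 2 m →
    Tendsto (fun q : ℝ × Measure (Ed d) => α q.1 q.2) (nhdsTM d 2 (Set.Ico 0 T) t m) (𝓝 (α t m))

lemma IsCoef.mul {α β : ℝ → Measure (Ed d) → ℝ} (hα : IsCoef d T α) (hβ : IsCoef d T β) :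
    IsCoef d T fun t m => α t m * β t m := by
  obtain ⟨⟨a, ha⟩, ha'⟩ := hα
  obtain ⟨⟨b, hb⟩, hb'⟩ := hβ
  refine ⟨⟨a * b, fun t ht m hm => ?_⟩, fun t ht m hm => (ha' t ht m hm).mul (hb' t ht m hm)⟩
  rw [abs_mul]
  exact mul_le_mul (ha t ht m hm) (hb t ht m hm) (abs_nonneg _) ((abs_nonneg _).trans (ha t ht m hm))

lemma isCoef_const (c : ℝ) : IsCoef d T fun _ _ => c :=
  ⟨⟨|c|, fun _ _ _ _ => le_rfl⟩, fun _ _ _ _ => tendsto_const_nhds⟩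

lemma IsCoef.sub {α β : ℝ → Measure (Ed d) → ℝ} (hα : IsCoef d T α) (hβ : IsCoef d T β) :
    IsCoef d T fun t m => α t m - β t m := by
  obtain ⟨⟨a, ha⟩, ha'⟩ := hα
  obtain ⟨⟨b, hb⟩, hb'⟩ := hβ
  exact ⟨⟨a + b, fun t ht m hm => (abs_sub _ _).trans (add_le_add (ha t ht m hm) (hb t ht m hm))⟩,
    fun t ht m hm => (ha' t ht m hm).sub (hb' t ht m hm)⟩

/-- Regularity in `x`, and joint regularity, of a candidate `δφ/δm`. -/
structure IsSpatial (d : ℕ) (T : ℝ) (F : ℝ → Measure (Ed d) → Ed d → ℝ) : Prop where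
  smooth : ∀ t ∈ Set.Ico 0 T, ∀ m : Measure (Ed d), MemP d 2 m → ContDiff ℝ 2 (F t m)
  growth : ∃ c : ℝ, ∀ t ∈ Set.Ico 0 T, ∀ m : Measure (Ed d), MemP d 2 m → ∀ x : Ed d,
    |F t m x| ≤ c * (1 + ‖x‖ ^ 2) ∧ ‖fderiv ℝ (F t m) x‖ ≤ c * (1 + ‖x‖ ^ 2) ∧
      ‖iteratedFDeriv ℝ 2 (F t m) x‖ ≤ c * (1 + ‖x‖ ^ 2)
  cont : ∀ t ∈ Set.Ico 0 T, ∀ m : Measure (Ed d), MemP d 2 m → ∀ x : Ed d,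
    Tendsto (fun q : (ℝ × Measure (Ed d)) × Ed d => F q.1.1 q.1.2 q.2)
      (nhdsTM d 2 (Set.Ico 0 T) t m ×ˢ 𝓝 x) (𝓝 (F t m x)) ∧
    Tendsto (fun q : (ℝ × Measure (Ed d)) × Ed d => fderiv ℝ (F q.1.1 q.1.2) q.2)
      (nhdsTM d 2 (Set.Ico 0 T) t m ×ˢ 𝓝 x) (𝓝 (fderiv ℝ (F t m) x)) ∧
    Tendsto (fun q : (ℝ × Measure (Ed d)) × Ed d => iteratedFDeriv ℝ 2 (F q.1.1 q.1.2) q.2)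
      (nhdsTM d 2 (Set.Ico 0 T) t m ×ˢ 𝓝 x) (𝓝 (iteratedFDeriv ℝ 2 (F t m) x))

lemma IsCoef.isSpatial {α : ℝ → Measure (Ed d) → ℝ} (hα : IsCoef d T α) {e : Ed d → ℝ}
    (he : QuadFn e) : IsSpatial d T fun t m x => α t m * e x := by
  obtain ⟨⟨a, ha⟩, ha'⟩ := hα
  obtain ⟨hs, c, hc⟩ := he
  have e0 : ∀ (b : ℝ), (fun x => b * e x) = b • e := fun b => rfl
  have e1 : ∀ (b : ℝ) x, fderiv ℝ (fun x => b * e x) x = b • fderiv ℝ e x := fun b x =>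
    fderiv_const_mul (hs.contDiffAt.differentiableAt two_ne_zero) b
  have e2 : ∀ (b : ℝ) x, iteratedFDeriv ℝ 2 (fun x => b * e x) x = b • iteratedFDeriv ℝ 2 e x :=
    fun b x => by rw [e0, iteratedFDeriv_const_smul_apply hs.contDiffAt]
  refine ⟨fun t ht m hm => contDiff_const.mul hs, ⟨a * c, fun t ht m hm x => ?_⟩,
    fun t ht m hm x => ?_⟩
  · obtain ⟨c0, c1, c2⟩ := hc x
    have hA := ha t ht m hm
    have hA0 := (abs_nonneg _).trans hA
    rw [e1, e2, norm_smul, norm_smul, abs_mul, Real.norm_eq_abs, mul_assoc]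
    exact ⟨by gcongr, by gcongr, by gcongr⟩
  · have hT := (ha' t ht m hm).comp (tendsto_fst (g := 𝓝 x))
    simp_rw [e1, e2]
    exact ⟨hT.mul ((hs.continuous.tendsto x).comp tendsto_snd),
      hT.smul (((hs.continuous_fderiv two_ne_zero).tendsto x).comp tendsto_snd),
      hT.smul (((hs.continuous_iteratedFDeriv le_rfl).tendsto x).comp tendsto_snd)⟩

lemma IsSpatial.add {F G : ℝ → Measure (Ed d) → Ed d → ℝ} (hF : IsSpatial d T F)
    (hG : IsSpatial d T G) : IsSpatial d T fun t m x => F t m x + G t m x := by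
  obtain ⟨fs, ⟨a, ha⟩, fc⟩ := hF
  obtain ⟨gs, ⟨b, hb⟩, gc⟩ := hG
  have e1 : ∀ t ∈ Set.Ico 0 T, ∀ m : Measure (Ed d), MemP d 2 m → ∀ x,
      fderiv ℝ (fun x => F t m x + G t m x) x = fderiv ℝ (F t m) x + fderiv ℝ (G t m) x :=
    fun t ht m hm x => fderiv_fun_add ((fs t ht m hm).contDiffAt.differentiableAt two_ne_zero)
      ((gs t ht m hm).contDiffAt.differentiableAt two_ne_zero)
  have e2 : ∀ t ∈ Set.Ico 0 T, ∀ m : Measure (Ed d), MemP d 2 m → ∀ x,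
      iteratedFDeriv ℝ 2 (fun x => F t m x + G t m x) x
        = iteratedFDeriv ℝ 2 (F t m) x + iteratedFDeriv ℝ 2 (G t m) x :=
    fun t ht m hm x => iteratedFDeriv_add_apply (fs t ht m hm).contDiffAt (gs t ht m hm).contDiffAt
  refine ⟨fun t ht m hm => (fs t ht m hm).add (gs t ht m hm), ⟨a + b, fun t ht m hm x => ?_⟩,
    fun t ht m hm x => ?_⟩
  · obtain ⟨a0, a1, a2⟩ := ha t ht m hm x
    obtain ⟨b0, b1, b2⟩ := hb t ht m hm x
    rw [e1 t ht m hm, e2 t ht m hm, add_mul]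
    exact ⟨(abs_add_le _ _).trans (add_le_add a0 b0), (norm_add_le _ _).trans (add_le_add a1 b1),
      (norm_add_le _ _).trans (add_le_add a2 b2)⟩
  · obtain ⟨a0, a1, a2⟩ := fc t ht m hm x
    obtain ⟨b0, b1, b2⟩ := gc t ht m hm x
    have hev : ∀ᶠ q : (ℝ × Measure (Ed d)) × Ed d in nhdsTM d 2 (Set.Ico 0 T) t m ×ˢ 𝓝 x,
      q.1.1 ∈ Set.Ico 0 T ∧ MemP d 2 q.1.2 := tendsto_fst.eventually eventually_mem_nhdsTM
    rw [e1 t ht m hm, e2 t ht m hm]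
    refine ⟨a0.add b0, (a1.add b1).congr' ?_, (a2.add b2).congr' ?_⟩
    · filter_upwards [hev] with q hq
      rw [e1 _ hq.1 _ hq.2]
    · filter_upwards [hev] with q hq
      rw [e2 _ hq.1 _ hq.2]

lemma isSpatial_sum {ι : Type} (s : Finset ι) {F : ι → ℝ → Measure (Ed d) → Ed d → ℝ}
    (hF : ∀ i, IsSpatial d T (F i)) : IsSpatial d T fun t m x => ∑ i ∈ s, F i t m x := by
  classical
  induction s using Finset.induction_on with
  | empty => simpa using (isCoef_const (d := d) (T := T) 0).isSpatial quadFn_one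
  | insert i s hi ih =>
    simp only [Finset.sum_insert hi]
    exact (hF i).add ih

end Coef

section Test

set_option linter.unusedSectionVars false

variable {d : ℕ} {T : ℝ} {ι : Type} [Fintype ι]

/-- The parameters of a test function penalizing the distance of `m` to the heat flow started
from `m₀` at time `t₀`, through finitely many trigonometric moments. -/
structure Penal (d : ℕ) (ι : Type) where
  a : ℝ → ℝ
  a' : ℝ → ℝ
  hasDeriv : ∀ s, HasDerivAt a (a' s) s
  cont : Continuous a'
  t₀ : ℝ
  m₀ : Measure (Ed d)
  w : ℝ
  ε : ℝ
  ε_pos : 0 < ε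
  ξ : ι → Ed d
  θ : ι → ℝ

namespace Penal

variable (D : Penal d ι)

/-- Trigonometric moments of `m`. -/
def G (i : ι) (m : Measure (Ed d)) : ℝ := ∫ x, trig (D.ξ i) (D.θ i) x ∂m

/-- Trigonometric moments of the heat flow. -/
def b (i : ι) (s : ℝ) : ℝ := D.G i D.m₀ * Real.exp (-((s - D.t₀) * ‖D.ξ i‖ ^ 2 / 2))

/-- The defect between the moments of `m` and of the heat flow. -/
def res (i : ι) (s : ℝ) (m : Measure (Ed d)) : ℝ := D.G i m - D.b i s

/-- The test function. -/
def φ (s : ℝ) (m : Measure (Ed d)) : ℝ :=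
  D.a s + D.w * ∑ i, D.res i s m ^ 2 + D.ε * Real.log (1 + mom2 m)

/-- Its time derivative. -/
def φt (s : ℝ) (m : Measure (Ed d)) : ℝ :=
  D.a' s + D.w * ∑ i, ‖D.ξ i‖ ^ 2 * D.b i s * D.res i s m

/-- Its derivative in the measure. -/
def δφ (s : ℝ) (m : Measure (Ed d)) (x : Ed d) : ℝ :=
  ∑ i, (2 * D.w * D.res i s m * trig (D.ξ i) (D.θ i) x
      + -(2 * D.w) * (D.res i s m * D.G i m) * 1)
    + (D.ε * (1 + mom2 m)⁻¹ * ‖x‖ ^ 2 + -(D.ε * (1 + mom2 m)⁻¹ * mom2 m) * 1)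

lemma hasDerivAt_b (i : ι) (s : ℝ) : HasDerivAt (D.b i) (-(‖D.ξ i‖ ^ 2 / 2) * D.b i s) s := by
  have h1 : HasDerivAt (fun s : ℝ => -((s - D.t₀) * ‖D.ξ i‖ ^ 2 / 2)) (-(1 * ‖D.ξ i‖ ^ 2 / 2)) s :=
    ((((hasDerivAt_id s).sub_const D.t₀).mul_const _).div_const _).neg
  refine (h1.exp.const_mul (D.G i D.m₀)).congr_deriv ?_
  simp only [b]
  ring

lemma continuous_b (i : ι) : Continuous (D.b i) := by
  unfold b; fun_prop

lemma continuous_a : Continuous D.a :=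
  continuous_iff_continuousAt.2 fun s => (D.hasDeriv s).continuousAt

lemma hasDerivAt_φ (m : Measure (Ed d)) (s : ℝ) : HasDerivAt (fun s => D.φ s m) (D.φt s m) s := by
  have h : ∀ i ∈ Finset.univ, HasDerivAt (fun s => D.res i s m ^ 2)
      (‖D.ξ i‖ ^ 2 * D.b i s * D.res i s m) s := fun i _ => by
    refine (((D.hasDerivAt_b i s).const_sub (D.G i m)).pow 2).congr_deriv ?_
    simp only [res]
    push_cast
    ring
  exact ((D.hasDeriv s).add ((HasDerivAt.fun_sum h).const_mul D.w)).add_const _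

variable {I : Set ℝ} {t : ℝ} {m : Measure (Ed d)}

lemma tendsto_G (hm : MemP d 2 m) (i : ι) :
    Tendsto (fun q : ℝ × Measure (Ed d) => D.G i q.2) (nhdsTM d 1 I t m) (𝓝 (D.G i m)) :=
  tendsto_integral_nhdsTM hm (norm_nonneg _) (fun m' hm' => by
    have := hm'.1
    exact integrable_trig _ _) (trig_lip _ _)

lemma tendsto_b (i : ι) :
    Tendsto (fun q : ℝ × Measure (Ed d) => D.b i q.1) (nhdsTM d 1 I t m) (𝓝 (D.b i t)) :=
  ((D.continuous_b i).tendsto t).comp tendsto_fst_nhdsTM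

lemma tendsto_res (hm : MemP d 2 m) (i : ι) :
    Tendsto (fun q : ℝ × Measure (Ed d) => D.res i q.1 q.2) (nhdsTM d 1 I t m)
      (𝓝 (D.res i t m)) := (D.tendsto_G hm i).sub (D.tendsto_b i)

lemma tendsto_main (hm : MemP d 2 m) :
    Tendsto (fun q : ℝ × Measure (Ed d) => D.a q.1 + D.w * ∑ i, D.res i q.1 q.2 ^ 2)
      (nhdsTM d 1 I t m) (𝓝 (D.a t + D.w * ∑ i, D.res i t m ^ 2)) :=
  ((D.continuous_a.tendsto t).comp tendsto_fst_nhdsTM).add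
    ((tendsto_finsetSum _ fun i _ => (D.tendsto_res hm i).pow 2).const_mul D.w)

lemma eventually_lt_φ (hm : MemP d 2 m) {y : ℝ} (hy : y < D.φ t m) :
    ∀ᶠ q in nhdsTM d 1 I t m, y < D.φ q.1 q.2 := by
  set δ := (D.φ t m - y) / (2 * (1 + D.ε)) with hδ
  have hε := D.ε_pos
  have hδ0 : 0 < δ := div_pos (sub_pos.2 hy) (by positivity)
  have hδy : D.φ t m - y = 2 * δ * (1 + D.ε) := by rw [hδ]; field_simp
  filter_upwards [(D.tendsto_main hm).eventually (lt_mem_nhds (sub_lt_self _ hδ0)),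
    eventually_lt_log_mom2 hm (sub_lt_self _ hδ0)] with q h1 h2
  have h3 := mul_lt_mul_of_pos_left h2 hε
  simp only [φ] at hδy ⊢
  nlinarith

lemma tendsto_φ (hm : MemP d 2 m) :
    Tendsto (fun q : ℝ × Measure (Ed d) => D.φ q.1 q.2) (nhdsTM d 2 I t m) (𝓝 (D.φ t m)) := by
  refine ((D.tendsto_main hm).mono_left (nhdsTM_two_le_one hm)).add (Tendsto.const_mul D.ε ?_)
  exact ((tendsto_mom2_nhdsTM hm).const_add 1).log (by linarith [mom2_nonneg m])

lemma isCoef_G (i : ι) : IsCoef d T fun _ m => D.G i m :=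
  ⟨⟨1, fun t _ m hm => by
    have := hm.1
    exact abs_integral_trig_le _ _⟩,
    fun t _ m hm => (D.tendsto_G hm i).mono_left (nhdsTM_two_le_one hm)⟩

lemma isCoef_b (i : ι) : IsCoef d T fun t _ => D.b i t := by
  obtain ⟨c, hc⟩ := (isCompact_Icc (a := (0 : ℝ)) (b := T)).exists_bound_of_continuousOn
    (D.continuous_b i).continuousOn
  exact ⟨⟨c, fun t ht m _ => hc t ⟨ht.1, ht.2.le⟩⟩,
    fun t _ m hm => (D.tendsto_b i).mono_left (nhdsTM_two_le_one hm)⟩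

lemma isCoef_res (i : ι) : IsCoef d T fun t m => D.res i t m := (D.isCoef_G i).sub (D.isCoef_b i)

lemma isCoef_inv : IsCoef d T fun _ m => (1 + mom2 m)⁻¹ :=
  ⟨⟨1, fun t _ m _ => by
    have := mom2_nonneg m
    rw [abs_of_nonneg (by positivity)]
    exact inv_le_one_of_one_le₀ (by linarith)⟩,
    fun t _ m hm => ((tendsto_mom2_nhdsTM hm).const_add 1).inv₀ (by linarith [mom2_nonneg m])⟩

lemma isCoef_frac : IsCoef d T fun _ m => (1 + mom2 m)⁻¹ * mom2 m :=
  ⟨⟨1, fun t _ m _ => by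
    have := mom2_nonneg m
    rw [abs_of_nonneg (by positivity), inv_mul_le_iff₀ (by positivity)]
    linarith⟩,
    fun t ht m hm => (isCoef_inv.cont t ht m hm).mul (tendsto_mom2_nhdsTM hm)⟩

lemma isSpatial_δφ : IsSpatial d T D.δφ := by
  refine IsSpatial.add (isSpatial_sum _ fun i => IsSpatial.add ?_ ?_) (IsSpatial.add ?_ ?_)
  · exact ((isCoef_const (2 * D.w)).mul (D.isCoef_res i)).isSpatial (quadFn_trig _ _)
  · exact ((isCoef_const (-(2 * D.w))).mul ((D.isCoef_res i).mul (D.isCoef_G i))).isSpatial quadFn_one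
  · exact ((isCoef_const D.ε).mul isCoef_inv).isSpatial quadFn_normSq
  · simp only [mul_assoc, ← neg_mul]
    simpa only [mul_assoc] using ((isCoef_const (-D.ε)).mul isCoef_frac).isSpatial quadFn_one

lemma tendsto_φt {t : ℝ} (ht : t ∈ Set.Ico 0 T) (hm : MemP d 2 m) :
    Tendsto (fun q : ℝ × Measure (Ed d) => D.φt q.1 q.2) (nhdsTM d 2 (Set.Ico 0 T) t m)
      (𝓝 (D.φt t m)) :=
  ((D.cont.tendsto t).comp tendsto_fst_nhdsTM).add
    ((tendsto_finsetSum _ fun i _ => (((isCoef_const _).mul (D.isCoef_b i)).mul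
      (D.isCoef_res i)).cont t ht m hm).const_mul D.w)

lemma integral_δφ (s : ℝ) {m' : Measure (Ed d)} (hm' : MemP d 2 m') :
    ∫ x, D.δφ s m x ∂m' = ∑ i, 2 * D.w * D.res i s m * (D.G i m' - D.G i m)
      + D.ε * (1 + mom2 m)⁻¹ * (mom2 m' - mom2 m) := by
  have := hm'.1
  have h1 : ∀ i, Integrable (fun x => 2 * D.w * D.res i s m * trig (D.ξ i) (D.θ i) x
      + -(2 * D.w) * (D.res i s m * D.G i m) * 1) m' := fun i =>
    ((integrable_trig _ _).const_mul _).add (integrable_const _)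
  have h2 : Integrable (fun x : Ed d => D.ε * (1 + mom2 m)⁻¹ * ‖x‖ ^ 2) m' :=
    (memP_two_iff.1 hm').2.const_mul _
  have h3 : Integrable (fun x : Ed d => D.ε * (1 + mom2 m)⁻¹ * ‖x‖ ^ 2
      + -(D.ε * (1 + mom2 m)⁻¹ * mom2 m) * 1) m' := h2.add (integrable_const _)
  unfold δφ
  rw [integral_add (integrable_finsetSum _ fun i _ => h1 i) h3,
    integral_finsetSum _ fun i _ => h1 i, integral_add h2 (integrable_const _),
    integral_const_mul]
  congr 1
  · refine Finset.sum_congr rfl fun i _ => ?_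
    rw [integral_add ((integrable_trig _ _).const_mul _) (integrable_const _), integral_const_mul]
    simp only [integral_const, probReal_univ, smul_eq_mul, G]
    ring
  · simp only [integral_const, probReal_univ, smul_eq_mul, mom2]
    ring

lemma integral_mix {r : ℝ} (hr0 : 0 ≤ r) (hr1 : r ≤ 1) {m' : Measure (Ed d)} {g : Ed d → ℝ}
    (hg : Integrable g m) (hg' : Integrable g m') :
    ∫ x, g x ∂((1 - ENNReal.ofReal r) • m + ENNReal.ofReal r • m')
      = ∫ x, g x ∂m + r * (∫ x, g x ∂m' - ∫ x, g x ∂m) := by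
  have h1 : (1 - ENNReal.ofReal r) ≠ ∞ := by finiteness
  rw [integral_add_measure (hg.smul_measure h1) (hg'.smul_measure ENNReal.ofReal_ne_top),
    integral_smul_measure, integral_smul_measure, ENNReal.toReal_sub_of_le
      (by simpa using hr1) ENNReal.one_ne_top, ENNReal.toReal_ofReal hr0]
  simp only [ENNReal.toReal_one, smul_eq_mul]
  ring

lemma tendsto_measDeriv (s : ℝ) (hm : MemP d 2 m) {m' : Measure (Ed d)} (hm' : MemP d 2 m') :
    Tendsto (fun r : ℝ =>
        (D.φ s ((1 - ENNReal.ofReal r) • m + ENNReal.ofReal r • m') - D.φ s m) / r)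
      (𝓝[>] 0) (𝓝 (∫ x, D.δφ s m x ∂m')) := by
  have := hm.1
  have := hm'.1
  have hd : HasDerivAt (fun r : ℝ => D.a s
      + D.w * ∑ i, (D.res i s m + r * (D.G i m' - D.G i m)) ^ 2
      + D.ε * Real.log (1 + (mom2 m + r * (mom2 m' - mom2 m)))) (∫ x, D.δφ s m x ∂m') 0 := by
    have h1 : ∀ i ∈ Finset.univ, HasDerivAt
        (fun r : ℝ => (D.res i s m + r * (D.G i m' - D.G i m)) ^ 2)
        (2 * D.res i s m * (D.G i m' - D.G i m)) 0 := fun i _ => by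
      refine ((((hasDerivAt_id (0 : ℝ)).mul_const (D.G i m' - D.G i m)).const_add
        (D.res i s m)).pow 2).congr_deriv ?_
      simp
    have h2 : HasDerivAt (fun r : ℝ => Real.log (1 + (mom2 m + r * (mom2 m' - mom2 m))))
        (1 * (mom2 m' - mom2 m) / (1 + (mom2 m + 0 * (mom2 m' - mom2 m)))) 0 :=
      ((((hasDerivAt_id (0 : ℝ)).mul_const (mom2 m' - mom2 m)).const_add (mom2 m)).const_add 1).log
        (by simpa using (by linarith [mom2_nonneg m] : (1 + mom2 m) ≠ 0))
    refine ((((HasDerivAt.fun_sum h1).const_mul D.w).const_add (D.a s)).add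
      (h2.const_mul D.ε)).congr_deriv ?_
    rw [D.integral_δφ s hm', Finset.mul_sum]
    congr 1
    · exact Finset.sum_congr rfl fun i _ => by ring
    · simp [div_eq_mul_inv]
      ring
  refine ((hasDerivAt_iff_tendsto_slope.1 hd).mono_left
    (nhdsWithin_mono _ fun r (hr : 0 < r) => hr.ne')).congr' ?_
  filter_upwards [Ioo_mem_nhdsGT (zero_lt_one' ℝ)] with r hr
  rw [slope_def_field, sub_zero]
  congr 2
  · have e1 : ∀ i, D.G i ((1 - ENNReal.ofReal r) • m + ENNReal.ofReal r • m')
        = D.G i m + r * (D.G i m' - D.G i m) := fun i =>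
      integral_mix hr.1.le hr.2.le (integrable_trig _ _) (integrable_trig _ _)
    have e2 : mom2 ((1 - ENNReal.ofReal r) • m + ENNReal.ofReal r • m')
        = mom2 m + r * (mom2 m' - mom2 m) :=
      integral_mix hr.1.le hr.2.le (memP_two_iff.1 hm).2 (memP_two_iff.1 hm').2
    simp only [φ, res, e1, e2]
    congr 3
    exact Finset.sum_congr rfl fun i _ => by ring
  · simp [φ]

/-- The bundled test function. -/
def testFn (T : ℝ) : TestFn d T where
  φ := D.φ
  φt := D.φt
  δφ := D.δφ
  lsc t _ m hm ε hε := eventually_nhdsTM.1 (D.eventually_lt_φ hm (sub_lt_self _ hε))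
  d2cont t _ m hm := tendsto_nhdsTM_iff.1 (D.tendsto_φ hm)
  timeDeriv m _ t _ := (D.hasDerivAt_φ m t).hasDerivWithinAt
  measDeriv t _ m hm m' hm' := D.tendsto_measDeriv t hm hm'
  normalized t _ m hm := by
    rw [D.integral_δφ t hm]
    simp
  smoothX := D.isSpatial_δφ.smooth
  quadGrowth := D.isSpatial_δφ.growth
  d2contDeriv t ht m hm x ε hε := by
    obtain ⟨h1, h2, h3⟩ := D.isSpatial_δφ.cont t ht m hm x
    have h0 := (D.tendsto_φt ht hm).comp (tendsto_fst (g := 𝓝 x))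
    have hev := (Metric.tendsto_nhds.1 h0 ε hε).and ((Metric.tendsto_nhds.1 h1 ε hε).and
      ((Metric.tendsto_nhds.1 h2 ε hε).and (Metric.tendsto_nhds.1 h3 ε hε)))
    obtain ⟨Q, hQ, R, hR, H⟩ := eventually_prod_iff.1 hev
    obtain ⟨η, hη, H1⟩ := (eventually_nhdsTM (Q := fun a b => Q (a, b))).1 hQ
    obtain ⟨η', hη', H2⟩ := Metric.eventually_nhds_iff.1 hR
    refine ⟨min η η', lt_min hη hη', fun t' ht' m' hm' x' a1 a2 a3 => ?_⟩
    have := H (H1 t' ht' m' hm' (a1.trans_le (min_le_left _ _)) (a2.trans_le (min_le_left _ _)))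
      (H2 (by rw [dist_eq_norm]; exact a3.trans_le (min_le_right _ _)))
    simpa only [dist_eq_norm, Real.norm_eq_abs, Function.comp_apply] using this

lemma generator_le (s : ℝ) (hw : 0 ≤ D.w) (hm : MemP d 2 m) :
    D.φt s m + (1 / 2) * (∫ x, lapl d (D.δφ s m) x ∂m) ≤ D.a' s + D.ε * d := by
  have := hm.1
  have hl : ∀ x, lapl d (D.δφ s m) x = ∑ i, (2 * D.w * D.res i s m * (-‖D.ξ i‖ ^ 2))
      * trig (D.ξ i) (D.θ i) x + D.ε * (1 + mom2 m)⁻¹ * (2 * d) := fun x => by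
    have c1 : ContDiff ℝ 2 (fun _ : Ed d => (1 : ℝ)) := contDiff_const
    have c2 : ∀ i, ContDiff ℝ 2 (trig (D.ξ i) (D.θ i)) := fun i => contDiff_trig _ _
    have c3 : ContDiff ℝ 2 (fun x : Ed d => ‖x‖ ^ 2) := contDiff_norm_sq ℝ
    unfold δφ
    rw [lapl_add (ContDiff.sum fun i _ => (contDiff_const.mul (c2 i)).add (contDiff_const.mul c1))
      ((contDiff_const.mul c3).add (contDiff_const.mul c1)),
      lapl_sum _ fun i => (contDiff_const.mul (c2 i)).add (contDiff_const.mul c1),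
      lapl_add (contDiff_const.mul c3) (contDiff_const.mul c1), lapl_const_mul c3,
      lapl_const_mul c1, lapl_normSq, lapl_one, mul_zero, add_zero]
    congr 1
    refine Finset.sum_congr rfl fun i _ => ?_
    rw [lapl_add (contDiff_const.mul (c2 i)) (contDiff_const.mul c1), lapl_const_mul (c2 i),
      lapl_const_mul c1, lapl_trig, lapl_one]
    ring
  have hi : ∫ x, lapl d (D.δφ s m) x ∂m = ∑ i, (2 * D.w * D.res i s m * (-‖D.ξ i‖ ^ 2)) * D.G i m
      + D.ε * (1 + mom2 m)⁻¹ * (2 * d) := by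
    simp_rw [hl]
    rw [integral_add (integrable_finsetSum _ fun i _ => (integrable_trig _ _).const_mul _)
      (integrable_const _), integral_finsetSum _ fun i _ => (integrable_trig _ _).const_mul _]
    simp only [integral_const_mul, integral_const, probReal_univ, one_smul, G]
  have hs : D.w * ∑ i, ‖D.ξ i‖ ^ 2 * D.b i s * D.res i s m
      + (1 / 2) * ∑ i, (2 * D.w * D.res i s m * (-‖D.ξ i‖ ^ 2)) * D.G i m
      = -(∑ i, D.w * (‖D.ξ i‖ ^ 2 * D.res i s m ^ 2)) := by
    rw [Finset.mul_sum, Finset.mul_sum, ← Finset.sum_add_distrib, ← Finset.sum_neg_distrib]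
    refine Finset.sum_congr rfl fun i _ => ?_
    simp only [res]
    ring
  have h0 : 0 ≤ ∑ i, D.w * (‖D.ξ i‖ ^ 2 * D.res i s m ^ 2) :=
    Finset.sum_nonneg fun i _ => by positivity
  have h1 : D.ε * (1 + mom2 m)⁻¹ * d ≤ D.ε * d := by
    have := mom2_nonneg m
    have := D.ε_pos
    gcongr
    exact mul_le_of_le_one_right D.ε_pos.le (inv_le_one_of_one_le₀ (by linarith))
  rw [hi, φt, mul_add]
  linarith

end Penal

end Test

/-! ### Comparison along the heat flow -/

section Comparison

variable {d : ℕ} {T : ℝ}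

lemma tendsto_nhdsTM {α : Type} {l : Filter α} {p : ℝ} {I : Set ℝ} {t : ℝ} {m : Measure (Ed d)}
    {s : α → ℝ} {μ : α → Measure (Ed d)} (hs : Tendsto s l (𝓝 t))
    (hμ : Tendsto (fun k => wdist d p m (μ k)) l (𝓝 0)) (hI : ∀ k, s k ∈ I)
    (hP : ∀ k, MemP d 2 (μ k)) : Tendsto (fun k => (s k, μ k)) l (nhdsTM d p I t m) := by
  refine tendsto_inf.2 ⟨tendsto_comap_iff.2 ?_, tendsto_principal.2 (Eventually.of_forall fun k =>
    ⟨hI k, hP k⟩)⟩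
  have h1 : Tendsto (fun k => |s k - t|) l (𝓝 0) := by
    simpa using (hs.sub_const t).abs
  simpa [Function.comp_def] using h1.max hμ

lemma exists_subseq_nhdsTM {t₀ t₁ : ℝ} {s : ℕ → ℝ} {μ : ℕ → Measure (Ed d)}
    (hs : ∀ k, s k ∈ Icc t₀ t₁) (hμ : ∀ k, MemP d 2 (μ k)) {R : ℝ} (hR : ∀ k, mom2 (μ k) ≤ R) :
    ∃ s' ∈ Icc t₀ t₁, ∃ μ' : Measure (Ed d), MemP d 2 μ' ∧ ∃ σ : ℕ → ℕ, StrictMono σ ∧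
      Tendsto (fun k => (s (σ k), μ (σ k))) atTop (nhdsTM d 1 (Icc t₀ t₁) s' μ') := by
  obtain ⟨μ', hμ', σ, hσ, hlim⟩ := exists_subseq_tendsto_wdist hμ hR
  obtain ⟨s', hs', τ, hτ, hlim'⟩ := isCompact_Icc.tendsto_subseq (x := s ∘ σ) fun k => hs (σ k)
  exact ⟨s', hs', μ', hμ', σ ∘ τ, hσ.comp hτ, tendsto_nhdsTM hlim' (hlim.comp hτ.tendsto_atTop)
    (fun k => hs _) fun k => hμ _⟩

lemma tendsto_of_contD1 {u : ℝ → Measure (Ed d) → ℝ} (hcont : ContD1 d T u) {I : Set ℝ}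
    (hI : I ⊆ Icc 0 T) {t : ℝ} (ht : t ∈ Icc 0 T) {m : Measure (Ed d)} (hm : MemP d 2 m) :
    Tendsto (fun q : ℝ × Measure (Ed d) => u q.1 q.2) (nhdsTM d 1 I t m) (𝓝 (u t m)) :=
  (tendsto_nhdsTM_iff.2 (hcont t ht m hm)).mono_left (nhdsTM_mono hI)

section Minimizer

variable {ι : Type} [Fintype ι] {D : Penal d ι} {u : ℝ → Measure (Ed d) → ℝ} {c α E t₀ t₁ : ℝ}

lemma Penal.log_le {s : ℝ} {μ : Measure (Ed d)} (hα : α ≤ D.a s)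
    (hc : |u s μ| ≤ c) (hE : D.φ s μ - u s μ ≤ E) :
    D.w * ∑ i, D.res i s μ ^ 2 + D.ε * Real.log (1 + mom2 μ) ≤ E + c - α := by
  have := (abs_le.1 hc).2
  simp only [Penal.φ] at hE
  linarith

lemma Penal.mom2_le (hw : 0 ≤ D.w) {s : ℝ} {μ : Measure (Ed d)} (hα : α ≤ D.a s)
    (hc : |u s μ| ≤ c) (hE : D.φ s μ - u s μ ≤ E) :
    mom2 μ ≤ Real.exp ((E + c - α) / D.ε) := by
  have h1 := Penal.log_le hα hc hE
  have h2 : 0 ≤ D.w * ∑ i, D.res i s μ ^ 2 :=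
    mul_nonneg hw (Finset.sum_nonneg fun i _ => sq_nonneg _)
  have h3 : Real.log (1 + mom2 μ) ≤ (E + c - α) / D.ε := by
    rw [le_div_iff₀ D.ε_pos]
    linarith
  have h4 := (Real.log_le_iff_le_exp (by linarith [mom2_nonneg μ])).1 h3
  linarith

lemma Penal.exists_min (hw : 0 ≤ D.w) (h01 : t₀ ≤ t₁) (hI : Icc t₀ t₁ ⊆ Icc 0 T)
    (hc : ∀ t ∈ Icc 0 T, ∀ m : Measure (Ed d), MemP d 2 m → |u t m| ≤ c) (hcont : ContD1 d T u)
    (hα : ∀ s ∈ Icc t₀ t₁, α ≤ D.a s) {m₀ : Measure (Ed d)} (hm₀ : MemP d 2 m₀) :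
    ∃ s ∈ Icc t₀ t₁, ∃ μ : Measure (Ed d), MemP d 2 μ ∧ ∀ s' ∈ Icc t₀ t₁, ∀ μ' : Measure (Ed d),
      MemP d 2 μ' → D.φ s μ - u s μ ≤ D.φ s' μ' - u s' μ' := by
  set S : Set ℝ := {y | ∃ s ∈ Icc t₀ t₁, ∃ μ : Measure (Ed d), MemP d 2 μ ∧
    y = D.φ s μ - u s μ} with hS
  have hne : S.Nonempty := ⟨_, t₀, ⟨le_rfl, h01⟩, m₀, hm₀, rfl⟩
  have hbb : BddBelow S := by
    refine ⟨α - c, ?_⟩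
    rintro _ ⟨s, hs, μ, hμ, rfl⟩
    have h1 := (abs_le.1 (hc s (hI hs) μ hμ)).2
    have h2 := hα s hs
    have h3 : 0 ≤ D.w * ∑ i, D.res i s μ ^ 2 :=
      mul_nonneg hw (Finset.sum_nonneg fun i _ => sq_nonneg _)
    have h4 : 0 ≤ D.ε * Real.log (1 + mom2 μ) :=
      mul_nonneg D.ε_pos.le (Real.log_nonneg (by linarith [mom2_nonneg μ]))
    simp only [Penal.φ]
    linarith
  have hk : ∀ k : ℕ, ∃ s ∈ Icc t₀ t₁, ∃ μ : Measure (Ed d), MemP d 2 μ ∧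
      D.φ s μ - u s μ < sInf S + 1 / ((k : ℝ) + 1) := fun k => by
    obtain ⟨_, ⟨s, hs, μ, hμ, rfl⟩, hlt⟩ := Real.lt_sInf_add_pos hne
      (by positivity : 0 < 1 / ((k : ℝ) + 1))
    exact ⟨s, hs, μ, hμ, hlt⟩
  choose s hs μ hμ hlt using hk
  have hle : ∀ k, D.φ (s k) (μ k) - u (s k) (μ k) ≤ sInf S + 1 := fun k => by
    refine (hlt k).le.trans (add_le_add_right ?_ _)
    rw [div_le_one (by positivity)]
    linarith [(Nat.cast_nonneg k : (0 : ℝ) ≤ k)]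
  obtain ⟨s', hs', μ', hμ', σ, hσ, hlim⟩ := exists_subseq_nhdsTM hs hμ (fun k =>
    Penal.mom2_le hw (hα _ (hs k)) (hc _ (hI (hs k)) _ (hμ k)) (hle k))
  refine ⟨s', hs', μ', hμ', fun r hr ν hν => ?_⟩
  have hmin : sInf S ≤ D.φ r ν - u r ν := csInf_le hbb ⟨r, hr, ν, hν, rfl⟩
  refine le_trans ?_ hmin
  by_contra! hcon
  set δ := (D.φ s' μ' - u s' μ' - sInf S) / 3 with hδ
  have hδ0 : 0 < δ := by rw [hδ]; linarith
  have e1 := hlim.eventually (D.eventually_lt_φ hμ' (sub_lt_self _ hδ0))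
  have e2 := hlim.eventually ((tendsto_of_contD1 hcont hI (hI hs') hμ').eventually
    (gt_mem_nhds (lt_add_of_pos_right _ hδ0)))
  have e3 : ∀ᶠ k in atTop, 1 / ((σ k : ℝ) + 1) < δ :=
    (tendsto_one_div_add_atTop_nhds_zero_nat.comp hσ.tendsto_atTop).eventually (gt_mem_nhds hδ0)
  obtain ⟨k, k1, k2, k3⟩ := (e1.and (e2.and e3)).exists
  have := hlt (σ k)
  simp only at k1 k2
  linarith

lemma Penal.generator_nonneg {F : ℝ → Measure (Ed d) → ℝ} (hw : 0 ≤ D.w)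
    (hI : Icc t₀ t₁ ⊆ Icc 0 T) (hsub : IsSubsolution d T F u) {s : ℝ} (hs : s ∈ Ioo t₀ t₁)
    {μ : Measure (Ed d)} (hμ : MemP d 2 μ) (hmin : ∀ s' ∈ Icc t₀ t₁, ∀ μ' : Measure (Ed d),
      MemP d 2 μ' → D.φ s μ - u s μ ≤ D.φ s' μ' - u s' μ') :
    0 ≤ D.a' s + D.ε * d + F s μ := by
  have h0 := (hI ⟨hs.1.le, hs.2.le⟩).1
  have hT := (hI ⟨(hs.1.trans hs.2).le, le_rfl⟩).2
  have h1 := hsub s ⟨h0, hs.2.trans_le hT⟩ μ hμ (D.testFn T)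
    ⟨min (s - t₀) (t₁ - s), lt_min (sub_pos.2 hs.1) (sub_pos.2 hs.2), fun t' _ m' hm' h _ => by
      obtain ⟨ha, hb⟩ := le_min_iff.1 h
      exact hmin t' ⟨by linarith [(abs_le.1 ha).1], by linarith [(abs_le.1 hb).2]⟩ m' hm'⟩
  have h2 := D.generator_le s hw hμ
  simp only [Penal.testFn] at h1
  linarith

end Minimizer

lemma eq_of_integral_trig {m m' : Measure (Ed d)} [IsFiniteMeasure m] [IsFiniteMeasure m']
    (h : ∀ (n : ℕ) (b : Bool), ∫ x, trig (TopologicalSpace.denseSeq (Ed d) n)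
        (if b then 0 else -(Real.pi / 2)) x ∂m
      = ∫ x, trig (TopologicalSpace.denseSeq (Ed d) n) (if b then 0 else -(Real.pi / 2)) x ∂m') :
    m = m' := by
  refine Measure.ext_of_charFun (Continuous.ext_on (TopologicalSpace.denseRange_denseSeq (Ed d))
    continuous_charFun continuous_charFun ?_)
  rintro _ ⟨n, rfl⟩
  have h1 := h n true
  have h2 := h n false
  simp only [if_true, Bool.false_eq_true, if_false] at h1 h2
  rw [charFun_re_im, charFun_re_im, h1, h2]

variable {A B : Type} [MetricSpace A] [CompactSpace A] [Nonempty A]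
    [MetricSpace B] [CompactSpace B] [Nonempty B] {f : ℝ → Ed d → A → B → ℝ} {C : ℝ}

lemma tendsto_heatFlow {m : Measure (Ed d)} (hm : MemP d 2 m) (t s : ℝ) :
    Tendsto (fun r => wdist d 1 (heatFlow d t s m) (heatFlow d t r m)) (𝓝 s) (𝓝 0) := by
  have := hm.1
  have h : Tendsto (fun r => |√(s - t) - √(r - t)| * gNorm d) (𝓝 s) (𝓝 0) := by
    have : Continuous fun r => |√(s - t) - √(r - t)| * gNorm d := by fun_prop
    simpa using this.tendsto s
  exact squeeze_zero (fun r => wdist_nonneg 1) (fun r => heatFlow_coupling hm.one_of_two t s r) h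

lemma CostHyp.tendsto_ham (h : CostHyp f C) {I : Set ℝ} {t : ℝ} {m : Measure (Ed d)}
    (hm : MemP d 2 m) :
    Tendsto (fun q : ℝ × Measure (Ed d) => hamiltonian f q.1 q.2) (nhdsTM d 1 I t m)
      (𝓝 (hamiltonian f t m)) := by
  refine tendsto_nhdsTM_iff.2 fun ε hε => ?_
  have hC := h.nonneg
  refine ⟨ε / (2 * (C + 1)), by positivity, fun t' _ m' hm' h1 h2 => ?_⟩
  rw [abs_sub_comm]
  refine (h.abs_ham_sub_le t t' hm.one_of_two hm'.one_of_two).trans_lt ?_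
  rw [abs_sub_comm] at h1
  have h3 : |t - t'| + wdist d 1 m m' < ε / (C + 1) := by
    calc _ < ε / (2 * (C + 1)) + ε / (2 * (C + 1)) := add_lt_add h1 h2
      _ = _ := by field_simp; ring
  rw [lt_div_iff₀ (by positivity)] at h3
  nlinarith [abs_nonneg (t - t'), wdist_nonneg (m := m) (m' := m') 1]

end Comparison

section Path

variable {d : ℕ} {T : ℝ}

/-- Moments of a path of measures that solves the heat equation starting from `m₀` at `t₀`. -/
def HeatMoments (p : ℝ → Measure (Ed d)) (m₀ : Measure (Ed d)) (t₀ : ℝ) : Prop :=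
  ∀ s, t₀ ≤ s → ∀ (ξ : Ed d) (θ : ℝ),
    ∫ x, trig ξ θ x ∂(p s) = (∫ x, trig ξ θ x ∂m₀) * Real.exp (-((s - t₀) * ‖ξ‖ ^ 2 / 2))

/-- The penalized test functions enforcing more and more moments of the heat flow. -/
def penalSeq {a a' : ℝ → ℝ} (ha : ∀ s, HasDerivAt a (a' s) s) (ha' : Continuous a') (t₀ : ℝ)
    (m₀ : Measure (Ed d)) {ε : ℝ} (hε : 0 < ε) (n : ℕ) : Penal d (Fin n × Bool) where
  a := a
  a' := a'
  hasDeriv := ha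
  cont := ha'
  t₀ := t₀
  m₀ := m₀
  w := n
  ε := ε
  ε_pos := hε
  ξ i := TopologicalSpace.denseSeq (Ed d) i.1
  θ i := if i.2 then 0 else -(Real.pi / 2)

lemma exists_penal_limit {F u : ℝ → Measure (Ed d) → ℝ} {c : ℝ}
    (hc : ∀ t ∈ Icc 0 T, ∀ m : Measure (Ed d), MemP d 2 m → |u t m| ≤ c) (hcont : ContD1 d T u)
    (hsub : IsSubsolution d T F u) {t₀ t₁ τ : ℝ} (hI : Icc t₀ t₁ ⊆ Icc 0 T) (hτ : τ ∈ Icc t₀ t₁)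
    {p : ℝ → Measure (Ed d)} {m₀ : Measure (Ed d)} (hm₀ : MemP d 2 m₀) (hp : ∀ s, MemP d 2 (p s))
    (hmom : HeatMoments p m₀ t₀)
    (hF : ∀ s, Tendsto (fun q : ℝ × Measure (Ed d) => F q.1 q.2) (nhdsTM d 1 (Icc t₀ t₁) s (p s))
      (𝓝 (F s (p s))))
    {a a' : ℝ → ℝ} (ha : ∀ s, HasDerivAt a (a' s) s) (ha' : Continuous a')
    {ε : ℝ} (hε : 0 < ε) :
    ∃ s ∈ Icc t₀ t₁, a s - u s (p s) ≤ a τ + ε * Real.log (1 + mom2 (p τ)) - u τ (p τ) ∧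
      (s ∈ Ioo t₀ t₁ → 0 ≤ a' s + ε * d + F s (p s)) := by
  set E := a τ + ε * Real.log (1 + mom2 (p τ)) - u τ (p τ) with hE
  have hac : Continuous a := continuous_iff_continuousAt.2 fun s => (ha s).continuousAt
  obtain ⟨α, hα⟩ : ∃ α, ∀ s ∈ Icc t₀ t₁, α ≤ a s := by
    obtain ⟨α, hα⟩ := (isCompact_Icc.image hac).bddBelow
    exact ⟨α, fun s hs => hα ⟨s, hs, rfl⟩⟩
  obtain ⟨D, hDa, hDa', hDw, hDε, hDξ, hDθ, hDt, hDm⟩ : ∃ D : (n : ℕ) → Penal d (Fin n × Bool),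
      (∀ n, (D n).a = a) ∧ (∀ n, (D n).a' = a') ∧ (∀ n, (D n).w = n) ∧ (∀ n, (D n).ε = ε) ∧
      (∀ n i, (D n).ξ i = TopologicalSpace.denseSeq (Ed d) i.1) ∧
      (∀ n i, (D n).θ i = if i.2 then 0 else -(Real.pi / 2)) ∧ (∀ n, (D n).t₀ = t₀) ∧
      ∀ n, (D n).m₀ = m₀ :=
    ⟨penalSeq ha ha' t₀ m₀ hε, fun _ => rfl, fun _ => rfl, fun _ => rfl, fun _ => rfl,
      fun _ _ => rfl, fun _ _ => rfl, fun _ => rfl, fun _ => rfl⟩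
  have hw : ∀ n, 0 ≤ (D n).w := fun n => by rw [hDw]; exact Nat.cast_nonneg n
  have hmin : ∀ n, ∃ s ∈ Icc t₀ t₁, ∃ μ : Measure (Ed d), MemP d 2 μ ∧
      ∀ s' ∈ Icc t₀ t₁, ∀ μ' : Measure (Ed d), MemP d 2 μ' →
        (D n).φ s μ - u s μ ≤ (D n).φ s' μ' - u s' μ' := fun n =>
    Penal.exists_min (hw n) (hτ.1.trans hτ.2) hI hc hcont (fun s hs => by rw [hDa]; exact hα s hs)
      hm₀
  choose s hs μ hμ hmin using hmin
  have hres : ∀ n i s m, (D n).res i s m = (∫ x, trig (TopologicalSpace.denseSeq (Ed d) i.1)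
      (if i.2 then 0 else -(Real.pi / 2)) x ∂m) -
      (∫ x, trig (TopologicalSpace.denseSeq (Ed d) i.1)
      (if i.2 then 0 else -(Real.pi / 2)) x ∂m₀)
      * Real.exp (-((s - t₀) * ‖TopologicalSpace.denseSeq (Ed d) i.1‖ ^ 2 / 2)) :=
    fun n i s m => by simp only [Penal.res, Penal.b, Penal.G, hDξ, hDθ, hDt, hDm]
  have hφ : ∀ n s m, (D n).φ s m = a s + n * ∑ i, (D n).res i s m ^ 2
      + ε * Real.log (1 + mom2 m) := fun n s m => by simp only [Penal.φ, hDa, hDw, hDε]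
  have hsum : ∀ (n : ℕ) s m, 0 ≤ (n : ℝ) * ∑ i, (D n).res i s m ^ 2 := fun n s m =>
    mul_nonneg n.cast_nonneg (Finset.sum_nonneg fun i _ => sq_nonneg _)
  have hlog0 : ∀ m : Measure (Ed d), 0 ≤ ε * Real.log (1 + mom2 m) := fun m =>
    mul_nonneg hε.le (Real.log_nonneg (by linarith [mom2_nonneg m]))
  have hEn : ∀ n, (D n).φ (s n) (μ n) - u (s n) (μ n) ≤ E := fun n => by
    refine (hmin n τ hτ (p τ) (hp τ)).trans (le_of_eq ?_)
    have hres0 : ∀ i, (D n).res i τ (p τ) = 0 := fun i => by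
      rw [hres, sub_eq_zero]
      exact hmom τ hτ.1 _ _
    rw [hφ]
    simp [hres0, hE]
  have hlog : ∀ n : ℕ, (n : ℝ) * ∑ i, (D n).res i (s n) (μ n) ^ 2
      + ε * Real.log (1 + mom2 (μ n)) ≤ E + c - α := fun n => by
    have h1 := hEn n
    have h2 := (abs_le.1 (hc _ (hI (hs n)) _ (hμ n))).2
    have h3 := hα _ (hs n)
    rw [hφ] at h1
    linarith
  obtain ⟨s', hs', μ', hμ', σ, hσ, hlim⟩ := exists_subseq_nhdsTM hs hμ
    (R := Real.exp ((E + c - α) / ε)) (fun n => by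
      rw [← hDε n]
      exact Penal.mom2_le (D := D n) (hw n) (by rw [hDa]; exact hα _ (hs n))
        (hc _ (hI (hs n)) _ (hμ n)) (hEn n))
  have hls : Tendsto (fun k => s (σ k)) atTop (𝓝 s') := tendsto_fst_nhdsTM.comp hlim
  have heq : μ' = p s' := by
    have := hμ'.1
    have := (hp s').1
    refine eq_of_integral_trig fun n b => ?_
    rw [hmom s' hs'.1]
    set G : ℝ → Measure (Ed d) → ℝ := (D (n + 1)).res (⟨n, Nat.lt_succ_self n⟩, b) with hG
    have h1 : Tendsto (fun k => (G (s (σ k)) (μ (σ k))) ^ 2) atTop (𝓝 (G s' μ' ^ 2)) := by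
      have h0 := ((D (n + 1)).tendsto_res hμ' (⟨n, Nat.lt_succ_self n⟩, b)
        (I := Icc t₀ t₁) (t := s')).comp hlim
      exact h0.pow 2
    have h2 : Tendsto (fun k : ℕ => (E + c - α) / (σ k : ℝ)) atTop (𝓝 0) :=
      (tendsto_const_div_atTop_nhds_zero_nat _).comp hσ.tendsto_atTop
    have h3 : G s' μ' ^ 2 ≤ 0 := by
      refine le_of_tendsto_of_tendsto h1 h2 ?_
      filter_upwards [eventually_ge_atTop (n + 1)] with k hk
      have hk' : n + 1 ≤ σ k := hk.trans hσ.le_apply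
      have hk0 : (0 : ℝ) < σ k := by exact_mod_cast (by omega : 0 < σ k)
      rw [le_div_iff₀ hk0, mul_comm]
      have h4 : G (s (σ k)) (μ (σ k)) ^ 2 ≤ ∑ j, (D (σ k)).res j (s (σ k)) (μ (σ k)) ^ 2 := by
        have h5 := Finset.single_le_sum
          (f := fun j : Fin (σ k) × Bool => (D (σ k)).res j (s (σ k)) (μ (σ k)) ^ 2)
          (fun j _ => sq_nonneg _) (Finset.mem_univ (⟨n, hk'⟩, b))
        refine le_trans (le_of_eq ?_) h5
        simp only [hG, hres]
      have h6 := mul_le_mul_of_nonneg_left h4 hk0.le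
      linarith [hlog (σ k), hlog0 (μ (σ k))]
    have h7 : G s' μ' = 0 := by
      have := le_antisymm h3 (sq_nonneg _)
      simpa using this
    rw [hG, hres, sub_eq_zero] at h7
    exact h7
  subst heq
  refine ⟨s', hs', ?_, fun hs'' => ?_⟩
  · refine le_of_tendsto (((hac.tendsto s').comp hls).sub
      ((tendsto_of_contD1 hcont hI (hI hs') hμ').comp hlim)) (Eventually.of_forall fun k => ?_)
    have h7 := hEn (σ k)
    rw [hφ] at h7
    have h8 := hsum (σ k) (s (σ k)) (μ (σ k))
    have h9 := hlog0 (μ (σ k))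
    simp only [Function.comp_def]
    linarith
  · have hev : ∀ᶠ k in atTop, s (σ k) ∈ Ioo t₀ t₁ := hls.eventually (isOpen_Ioo.mem_nhds hs'')
    refine ge_of_tendsto ((((ha'.tendsto s').comp hls).add_const (ε * d)).add
      ((hF s').comp hlim)) ?_
    filter_upwards [hev] with k hk
    have h1 := Penal.generator_nonneg (D := D (σ k)) (hw _) hI hsub hk (hμ _) (hmin _)
    rw [hDa', hDε] at h1
    exact h1

lemma le_add_integral_of_path {F u : ℝ → Measure (Ed d) → ℝ} {c : ℝ}
    (hc : ∀ t ∈ Icc 0 T, ∀ m : Measure (Ed d), MemP d 2 m → |u t m| ≤ c) (hcont : ContD1 d T u)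
    (hsub : IsSubsolution d T F u) {t₀ t₁ τ : ℝ} (hI : Icc t₀ t₁ ⊆ Icc 0 T) (hτ : τ ∈ Ioo t₀ t₁)
    {p : ℝ → Measure (Ed d)} {m₀ : Measure (Ed d)} (hm₀ : MemP d 2 m₀) (hp : ∀ s, MemP d 2 (p s))
    (hmom : HeatMoments p m₀ t₀)
    (hF : ∀ s, Tendsto (fun q : ℝ × Measure (Ed d) => F q.1 q.2) (nhdsTM d 1 (Icc t₀ t₁) s (p s))
      (𝓝 (F s (p s)))) (hh : Continuous fun r => F r (p r)) :
    u τ (p τ) ≤ u t₁ (p t₁) + ∫ r in τ..t₁, F r (p r) := by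
  by_contra! hcon
  set g : ℝ → ℝ := fun r => F r (p r) with hg
  set δ := u τ (p τ) - (u t₁ (p t₁) + ∫ r in τ..t₁, g r) with hδ
  have hδ0 : 0 < δ := sub_pos.2 hcon
  have hτ0 := hτ.1
  have hτ1 := hτ.2
  have hL : 0 ≤ Real.log (1 + mom2 (p τ)) := Real.log_nonneg (by linarith [mom2_nonneg (p τ)])
  set L := Real.log (1 + mom2 (p τ)) with hLdef
  set κ := δ / (4 * (t₁ - τ)) with hκ
  have hκ0 : 0 < κ := div_pos hδ0 (by linarith)
  have hκ1 : κ * (t₁ - τ) = δ / 4 := by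
    rw [hκ]
    have : t₁ - τ ≠ 0 := by linarith
    field_simp
  obtain ⟨ε, hε, hεL, hεd⟩ : ∃ ε > 0, ε * L ≤ δ / 4 ∧ ε * d < κ := by
    refine ⟨min (δ / (4 * (L + 1))) (κ / (d + 1)), by positivity, ?_, ?_⟩
    · calc _ ≤ δ / (4 * (L + 1)) * (L + 1) :=
            mul_le_mul (min_le_left _ _) (by linarith) hL (by positivity)
        _ = δ / 4 := by field_simp
    · calc _ ≤ κ / (d + 1) * d := mul_le_mul_of_nonneg_right (min_le_right _ _) (by positivity)
        _ < κ / (d + 1) * (d + 1) := mul_lt_mul_of_pos_left (by linarith) (by positivity)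
        _ = κ := by field_simp
  set k : ℝ → ℝ := fun r => max (τ - r) 0 with hk
  have hkc : Continuous k := by fun_prop
  have hJ : 0 < ∫ r in t₀..τ, k r := by
    refine intervalIntegral.intervalIntegral_pos_of_pos_on (hkc.intervalIntegrable _ _)
      (fun x hx => lt_max_of_lt_left (sub_pos.2 hx.2)) hτ0
  have hJ1 : ∫ r in τ..t₁, k r = 0 := by
    rw [intervalIntegral.integral_congr (g := fun _ => 0)]
    · simp
    · intro x hx
      rw [uIcc_of_le hτ1.le] at hx
      exact max_eq_right (by linarith [hx.1])
  set J := ∫ r in t₀..τ, k r with hJdef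
  set K := (ε * L + 2 * c + |∫ r in t₀..τ, g r| + 1) / J with hK
  have hc0 : 0 ≤ c := (abs_nonneg _).trans (hc t₁ (hI ⟨(hτ0.trans hτ1).le, le_rfl⟩) (p t₁) (hp t₁))
  have hK0 : 0 ≤ K := by positivity
  have hKJ : K * J = ε * L + 2 * c + |∫ r in t₀..τ, g r| + 1 := by
    rw [hK]; field_simp
  have hder : ∀ s, HasDerivAt (fun s => -(∫ r in τ..s, g r) - κ * (s - τ) - K * ∫ r in τ..s, k r)
      (-g s - κ - K * k s) s := fun s => by
    have h1 := intervalIntegral.integral_hasDerivAt_right (hh.intervalIntegrable τ s)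
      hh.aestronglyMeasurable.stronglyMeasurableAtFilter hh.continuousAt
    have h2 := intervalIntegral.integral_hasDerivAt_right (hkc.intervalIntegrable τ s)
      hkc.aestronglyMeasurable.stronglyMeasurableAtFilter hkc.continuousAt
    have h3 := ((hasDerivAt_id s).sub_const τ).const_mul κ
    rw [mul_one] at h3
    exact (h1.neg.sub h3).sub (h2.const_mul K)
  obtain ⟨s, hs, hle, hgen⟩ := exists_penal_limit hc hcont hsub hI ⟨hτ0.le, hτ1.le⟩ hm₀ hp hmom hF
    hder (by fun_prop) hε
  simp only [intervalIntegral.integral_same, sub_self, mul_zero, neg_zero] at hle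
  have hb := hc s (hI hs) (p s) (hp s)
  have hb' := hc τ (hI ⟨hτ0.le, hτ1.le⟩) (p τ) (hp τ)
  rcases eq_or_lt_of_le hs.1 with h | h
  · subst h
    rw [intervalIntegral.integral_symm, intervalIntegral.integral_symm t₀ τ] at hle
    have h1 := neg_abs_le (∫ r in t₀..τ, g r)
    have h2 : 0 < κ * (τ - t₀) := mul_pos hκ0 (by linarith)
    have h3 := (abs_le.1 hb).2
    have h4 := (abs_le.1 hb').1
    linarith
  rcases eq_or_lt_of_le hs.2 with h' | h'
  · subst h'
    rw [hJ1] at hle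
    linarith
  · have h1 := hgen ⟨h, h'⟩
    have h2 : 0 ≤ K * k s := mul_nonneg hK0 (le_max_right _ _)
    have h3 : g s = F s (p s) := rfl
    linarith

lemma le_add_integral_of_path' {F u : ℝ → Measure (Ed d) → ℝ} {c : ℝ}
    (hc : ∀ t ∈ Icc 0 T, ∀ m : Measure (Ed d), MemP d 2 m → |u t m| ≤ c) (hcont : ContD1 d T u)
    (hsub : IsSubsolution d T F u) {t₀ t₁ : ℝ} (h01 : t₀ ≤ t₁) (hI : Icc t₀ t₁ ⊆ Icc 0 T)
    {p : ℝ → Measure (Ed d)} (hp : ∀ s, MemP d 2 (p s))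
    (hmom : HeatMoments p (p t₀) t₀)
    (hpc : Tendsto (fun r => wdist d 1 (p t₀) (p r)) (𝓝 t₀) (𝓝 0))
    (hF : ∀ s, Tendsto (fun q : ℝ × Measure (Ed d) => F q.1 q.2) (nhdsTM d 1 (Icc t₀ t₁) s (p s))
      (𝓝 (F s (p s)))) (hh : Continuous fun r => F r (p r)) :
    u t₀ (p t₀) ≤ u t₁ (p t₁) + ∫ r in t₀..t₁, F r (p r) := by
  rcases h01.eq_or_lt with rfl | h01
  · simp
  have hlim : Tendsto (fun τ => u τ (p τ)) (𝓝[>] t₀) (𝓝 (u t₀ (p t₀))) := by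
    have hev : ∀ᶠ τ in 𝓝[>] t₀, τ ∈ Icc 0 T := by
      filter_upwards [Ioo_mem_nhdsGT h01] with τ hτ using hI ⟨hτ.1.le, hτ.2.le⟩
    refine Metric.tendsto_nhds.2 fun ε hε => ?_
    obtain ⟨η, hη, hu⟩ := hcont t₀ (hI ⟨le_rfl, h01.le⟩) (p t₀) (hp t₀) ε hε
    filter_upwards [hev, nhdsWithin_le_nhds (Metric.ball_mem_nhds t₀ hη),
      nhdsWithin_le_nhds (hpc.eventually (gt_mem_nhds hη))] with τ h1 h2 h3
    exact hu τ h1 (p τ) (hp τ) h2 h3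
  have hlim' : Tendsto (fun τ => u t₁ (p t₁) + ∫ r in τ..t₁, F r (p r)) (𝓝[>] t₀)
      (𝓝 (u t₁ (p t₁) + ∫ r in t₀..t₁, F r (p r))) := by
    refine tendsto_const_nhds.add ?_
    have : Continuous fun τ => ∫ r in τ..t₁, F r (p r) := by
      have := intervalIntegral.continuous_primitive (μ := volume)
        (fun a b => hh.intervalIntegrable a b) t₁
      simp_rw [fun τ => intervalIntegral.integral_symm (f := fun r => F r (p r)) (μ := volume) t₁ τ]
      exact this.neg
    exact this.continuousAt.tendsto.mono_left nhdsWithin_le_nhds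
  refine le_of_tendsto_of_tendsto hlim hlim' ?_
  filter_upwards [Ioo_mem_nhdsGT h01] with τ hτ
  exact le_add_integral_of_path hc hcont hsub hI hτ (hp t₀) hp hmom hF hh

variable {A B : Type} [MetricSpace A] [CompactSpace A] [Nonempty A]
    [MetricSpace B] [CompactSpace B] [Nonempty B] {f : ℝ → Ed d → A → B → ℝ} {C : ℝ}

lemma CostHyp.continuous_ham_path (h : CostHyp f C) {p : ℝ → Measure (Ed d)}
    (hp : ∀ r, MemP d 1 (p r))
    (hc : ∀ s, Tendsto (fun r => wdist d 1 (p s) (p r)) (𝓝 s) (𝓝 0)) :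
    Continuous fun r => hamiltonian f r (p r) := by
  refine continuous_iff_continuousAt.2 fun s => tendsto_iff_dist_tendsto_zero.2 ?_
  have h1 : Tendsto (fun r => C * (|s - r| + wdist d 1 (p s) (p r))) (𝓝 s) (𝓝 0) := by
    have h2 : Tendsto (fun r => |s - r|) (𝓝 s) (𝓝 0) := by
      have : Continuous fun r => |s - r| := by fun_prop
      simpa using this.tendsto s
    simpa using (h2.add (hc s)).const_mul C
  refine squeeze_zero (fun r => dist_nonneg) (fun r => ?_) h1
  rw [Real.dist_eq, abs_sub_comm]
  exact h.abs_ham_sub_le s r (hp s) (hp r)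

lemma CostHyp.continuous_ham_heatFlow (h : CostHyp f C) {m : Measure (Ed d)} (hm : MemP d 2 m)
    (t : ℝ) : Continuous fun r => hamiltonian f r (heatFlow d t r m) :=
  h.continuous_ham_path (p := fun r => heatFlow d t r m)
    (fun r => (memP_two_heatFlow hm t r).one_of_two) (tendsto_heatFlow hm t)

/-- A subsolution grows at most like the running cost along the heat flow. -/
lemma CostHyp.le_add_integral_heatFlow (h : CostHyp f C) {u : ℝ → Measure (Ed d) → ℝ}
    (hbdd : BddD1 d T u) (hcont : ContD1 d T u) (hsub : IsSubsolution d T (hamiltonian f) u)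
    {t₀ t₁ : ℝ} (h01 : t₀ ≤ t₁) (hI : Icc t₀ t₁ ⊆ Icc 0 T) {m : Measure (Ed d)}
    (hm : MemP d 2 m) :
    u t₀ m ≤ u t₁ (heatFlow d t₀ t₁ m) + ∫ r in t₀..t₁, hamiltonian f r (heatFlow d t₀ r m) := by
  obtain ⟨c, hc⟩ := hbdd
  have := hm.1
  have h0 : heatFlow d t₀ t₀ m = m := heatFlow_of_le le_rfl m
  have hp := fun s => memP_two_heatFlow hm t₀ s
  have key := le_add_integral_of_path' (p := fun r => heatFlow d t₀ r m) hc hcont hsub h01 hI hp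
    (fun s hs ξ θ => by rw [h0]; exact integral_trig_heatFlow m hs ξ θ)
    (tendsto_heatFlow hm t₀ t₀) (fun s => h.tendsto_ham (hp s)) (h.continuous_ham_heatFlow hm t₀)
  simp only [h0] at key
  exact key

end Path

/-! ### Multiples of elements of `𝒫₂` and the perspective of a convex function -/

section Persp

variable {d : ℕ} {T : ℝ}

/-- `ν` is a finite multiple of an element of `𝒫₂`. -/
def IsMul2 (ν : Measure (Ed d)) : Prop :=
  ∃ c : ℝ≥0∞, c ≠ ∞ ∧ ∃ μ : Measure (Ed d), MemP d 2 μ ∧ ν = c • μ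

/-- The perspective of `u s`, the positively homogeneous extension of `u s` to finite measures. -/
def persp (u : ℝ → Measure (Ed d) → ℝ) (s : ℝ) (ν : Measure (Ed d)) : ℝ :=
  (ν univ).toReal * u s ((ν univ)⁻¹ • ν)

lemma persp_smul (u : ℝ → Measure (Ed d) → ℝ) (s : ℝ) {c : ℝ≥0∞} (hc : c ≠ ∞)
    (μ : Measure (Ed d)) [IsProbabilityMeasure μ] : persp u s (c • μ) = c.toReal * u s μ := by
  have h1 : (c • μ) univ = c := by simp
  rw [persp, h1]
  rcases eq_or_ne c 0 with rfl | h0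
  · simp
  · rw [smul_smul, ENNReal.inv_mul_cancel h0 hc, one_smul]

lemma persp_prob (u : ℝ → Measure (Ed d) → ℝ) (s : ℝ) (μ : Measure (Ed d))
    [IsProbabilityMeasure μ] : persp u s μ = u s μ := by
  simpa using persp_smul u s ENNReal.one_ne_top μ

lemma memP_two_dirac : MemP d 2 (Measure.dirac (0 : Ed d)) :=
  memP_two_iff.2 ⟨inferInstance, integrable_dirac (by simp)⟩

lemma IsMul2.zero : IsMul2 (0 : Measure (Ed d)) :=
  ⟨0, by simp, _, memP_two_dirac, by simp⟩

lemma isMul2_of_le {ν μ : Measure (Ed d)} (hμ : MemP d 2 μ) (h : ν ≤ μ) : IsMul2 ν := by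
  have := hμ.1
  have : IsFiniteMeasure ν := isFiniteMeasure_of_le μ h
  rcases eq_or_ne ν 0 with rfl | h0
  · exact IsMul2.zero
  have h1 : ν univ ≠ 0 := by simpa using h0
  have h2 : ν univ ≠ ∞ := measure_ne_top _ _
  refine ⟨ν univ, h2, (ν univ)⁻¹ • ν, memP_two_iff.2 ⟨⟨?_⟩, ?_⟩, ?_⟩
  · simp [ENNReal.inv_mul_cancel h1 h2]
  · exact ((memP_two_iff.1 hμ).2.mono_measure h).smul_measure (ENNReal.inv_ne_top.2 h1)
  · rw [smul_smul, ENNReal.mul_inv_cancel h1 h2, one_smul]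

lemma MemP.mix {m₁ m₂ : Measure (Ed d)} (h₁ : MemP d 2 m₁) (h₂ : MemP d 2 m₂) {l : ℝ} (h0 : 0 ≤ l)
    (h1 : l ≤ 1) : MemP d 2 (ENNReal.ofReal l • m₁ + ENNReal.ofReal (1 - l) • m₂) := by
  have := h₁.1
  have := h₂.1
  refine memP_two_iff.2 ⟨⟨?_⟩, ?_⟩
  · simp only [Measure.coe_add, Measure.coe_smul, Pi.add_apply, Pi.smul_apply, measure_univ,
      smul_eq_mul, mul_one]
    rw [← ENNReal.ofReal_add h0 (by linarith)]
    simp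
  · exact ((memP_two_iff.1 h₁).2.smul_measure ENNReal.ofReal_ne_top).add_measure
      ((memP_two_iff.1 h₂).2.smul_measure ENNReal.ofReal_ne_top)

variable {u : ℝ → Measure (Ed d) → ℝ} {s : ℝ}

lemma isMul2_add_and_persp_add_le
    (hconv : ∀ m₁ m₂ : Measure (Ed d), MemP d 2 m₁ → MemP d 2 m₂ → ∀ l : ℝ, 0 < l → l < 1 →
        u s (ENNReal.ofReal l • m₁ + ENNReal.ofReal (1 - l) • m₂) ≤ l * u s m₁ + (1 - l) * u s m₂)
    {ν₁ ν₂ : Measure (Ed d)} (h₁ : IsMul2 ν₁) (h₂ : IsMul2 ν₂) :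
    IsMul2 (ν₁ + ν₂) ∧ persp u s (ν₁ + ν₂) ≤ persp u s ν₁ + persp u s ν₂ := by
  obtain ⟨c₁, hc₁, μ₁, hμ₁, rfl⟩ := h₁
  obtain ⟨c₂, hc₂, μ₂, hμ₂, rfl⟩ := h₂
  have := hμ₁.1
  have := hμ₂.1
  rcases eq_or_ne c₁ 0 with rfl | h₁
  · rw [zero_smul, zero_add]
    refine ⟨⟨c₂, hc₂, μ₂, hμ₂, rfl⟩, ?_⟩
    simp [persp]
  rcases eq_or_ne c₂ 0 with rfl | h₂
  · rw [zero_smul, add_zero]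
    refine ⟨⟨c₁, hc₁, μ₁, hμ₁, rfl⟩, ?_⟩
    simp [persp]
  have a₁ : 0 < c₁.toReal := ENNReal.toReal_pos h₁ hc₁
  have a₂ : 0 < c₂.toReal := ENNReal.toReal_pos h₂ hc₂
  set l : ℝ := c₁.toReal / (c₁.toReal + c₂.toReal) with hl
  have l0 : 0 < l := by positivity
  have l1' : 1 - l = c₂.toReal / (c₁.toReal + c₂.toReal) := by rw [hl]; field_simp; ring
  have l1 : l < 1 := by
    have : 0 < 1 - l := by rw [l1']; positivity
    linarith
  have hmix := hμ₁.mix hμ₂ l0.le l1.le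
  have e : c₁ • μ₁ + c₂ • μ₂ = ENNReal.ofReal (c₁.toReal + c₂.toReal) •
      (ENNReal.ofReal l • μ₁ + ENNReal.ofReal (1 - l) • μ₂) := by
    rw [smul_add, smul_smul, smul_smul, ← ENNReal.ofReal_mul (by positivity),
      ← ENNReal.ofReal_mul (by positivity), l1', hl]
    congr 2
    · rw [mul_div_cancel₀ _ (by positivity), ENNReal.ofReal_toReal hc₁]
    · rw [mul_div_cancel₀ _ (by positivity), ENNReal.ofReal_toReal hc₂]
  have := hmix.1
  refine ⟨⟨_, ENNReal.ofReal_ne_top, _, hmix, e⟩, ?_⟩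
  rw [e, persp_smul u s ENNReal.ofReal_ne_top, persp_smul u s hc₁, persp_smul u s hc₂,
    ENNReal.toReal_ofReal (by positivity)]
  calc _ ≤ (c₁.toReal + c₂.toReal) * (l * u s μ₁ + (1 - l) * u s μ₂) :=
        mul_le_mul_of_nonneg_left (hconv μ₁ μ₂ hμ₁ hμ₂ l l0 l1) (by positivity)
    _ = _ := by rw [l1', hl]; field_simp

lemma persp_sum_le
    (hconv : ∀ m₁ m₂ : Measure (Ed d), MemP d 2 m₁ → MemP d 2 m₂ → ∀ l : ℝ, 0 < l → l < 1 →
        u s (ENNReal.ofReal l • m₁ + ENNReal.ofReal (1 - l) • m₂) ≤ l * u s m₁ + (1 - l) * u s m₂)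
    {κ : Type} (S : Finset κ) {ν : κ → Measure (Ed d)} (h : ∀ k, IsMul2 (ν k)) :
    IsMul2 (∑ k ∈ S, ν k) ∧ persp u s (∑ k ∈ S, ν k) ≤ ∑ k ∈ S, persp u s (ν k) := by
  classical
  induction S using Finset.induction_on with
  | empty => exact ⟨by simpa using IsMul2.zero, by simp [persp]⟩
  | insert k S hk ih =>
    rw [Finset.sum_insert hk, Finset.sum_insert hk]
    obtain ⟨h1, h2⟩ := isMul2_add_and_persp_add_le hconv (h k) ih.1
    exact ⟨h1, by linarith [ih.2]⟩

lemma abs_persp_le {c : ℝ} (hc : ∀ m : Measure (Ed d), MemP d 2 m → |u s m| ≤ c)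
    {ν : Measure (Ed d)} (h : IsMul2 ν) : |persp u s ν| ≤ c * ν.real univ := by
  obtain ⟨k, hk, μ, hμ, rfl⟩ := h
  have := hμ.1
  rw [persp_smul u s hk, abs_mul, abs_of_nonneg ENNReal.toReal_nonneg]
  have : (k • μ).real univ = k.toReal := by simp [Measure.real]
  rw [this, mul_comm]
  exact mul_le_mul_of_nonneg_right (hc μ hμ) ENNReal.toReal_nonneg

variable {A B : Type} [MetricSpace A] [CompactSpace A] [Nonempty A]
    [MetricSpace B] [CompactSpace B] [Nonempty B] {f : ℝ → Ed d → A → B → ℝ} {C : ℝ}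

lemma CostHyp.persp_le_heatFlow (h : CostHyp f C)
    (hbdd : BddD1 d T u) (hcont : ContD1 d T u) (hsub : IsSubsolution d T (hamiltonian f) u)
    {s r : ℝ} (hsr : s ≤ r) (hs : 0 ≤ s) (hr : r ≤ T) {ν : Measure (Ed d)} (hν : IsMul2 ν) :
    persp u s ν ≤ persp u r (heatFlow d s r ν) + (r - s) * hamiltonian f s ν
      + ν.real univ * ((r - s) * (C * (r - s + √(r - s) * gNorm d))) := by
  obtain ⟨c, hc, μ, hμ, rfl⟩ := hν
  have := hμ.1
  have hμ' := memP_two_heatFlow hμ s r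
  rw [heatFlow_smul, persp_smul u s hc, persp_smul u r hc, h.ham_smul s μ hc]
  have e : (c • μ).real univ = c.toReal := by simp [Measure.real]
  rw [e]
  have key := h.le_add_integral_heatFlow hbdd hcont hsub hsr
    (fun x hx => ⟨hs.trans hx.1, hx.2.trans hr⟩) hμ
  have hintg : ∫ q in s..r, hamiltonian f q (heatFlow d s q μ)
      ≤ ∫ q in s..r, (hamiltonian f s μ + C * (r - s + √(r - s) * gNorm d)) := by
    refine intervalIntegral.integral_mono_on hsr
      ((h.continuous_ham_heatFlow hμ s).intervalIntegrable _ _)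
      (continuous_const.intervalIntegrable _ _) fun q hq => ?_
    have h1 := h.abs_ham_sub_le q s (memP_two_heatFlow hμ s q).one_of_two hμ.one_of_two
    have h2 := heatFlow_coupling hμ.one_of_two s q s
    rw [heatFlow_of_le le_rfl μ, sub_self, Real.sqrt_zero, sub_zero,
      abs_of_nonneg (Real.sqrt_nonneg _)] at h2
    rw [abs_of_nonneg (sub_nonneg.2 hq.1)] at h1
    have h3 : √(q - s) * gNorm d ≤ √(r - s) * gNorm d :=
      mul_le_mul_of_nonneg_right (Real.sqrt_le_sqrt (by linarith [hq.2])) (gNorm_nonneg d)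
    have h4 : C * (q - s + wdist d 1 (heatFlow d s q μ) μ) ≤ C * (r - s + √(r - s) * gNorm d) :=
      mul_le_mul_of_nonneg_left (by linarith [hq.2]) h.nonneg
    linarith [(abs_le.1 h1).2]
  rw [intervalIntegral.integral_const, smul_eq_mul] at hintg
  have := mul_le_mul_of_nonneg_left (key.trans (add_le_add_right hintg _))
    (ENNReal.toReal_nonneg (a := c))
  refine this.trans (le_of_eq ?_)
  ring

end Persp

/-! ### Pieces of a measure-valued process -/

section MeasureValued

set_option linter.unusedSectionVars false

variable {d : ℕ} {Ω : Type} {mΩ : MeasurableSpace Ω} {P : Measure Ω} [IsProbabilityMeasure P]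
  {M : ℝ → Ω → Measure (Ed d)} {t T : ℝ}

lemma genFiltration_le (hM : ∀ s, Measurable (M s)) (s : ℝ) : genFiltration d M t s ≤ mΩ :=
  (iInf₂_le (s + 1) (by simp)).trans (iSup₂_le fun r _ => (hM r).comap_le)

lemma genFiltration_mono {s r : ℝ} (h : s ≤ r) :
    genFiltration d M t s ≤ genFiltration d M t r :=
  le_iInf₂ fun u hu => iInf₂_le u (lt_of_le_of_lt h hu)

lemma measurable_genFiltration {s : ℝ} (h : t ≤ s) :
    Measurable[genFiltration d M t s] (M s) := by
  refine measurable_iff_comap_le.2 (le_iInf₂ fun u hu => ?_)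
  exact le_iSup₂_of_le (f := fun r (_ : r ∈ Icc t u) => MeasurableSpace.comap (M r) inferInstance)
    s ⟨h, le_of_lt hu⟩ le_rfl

/-- The part of the law of `X` carried by the event `D`. -/
def piece (P : Measure Ω) (X : Ω → Measure (Ed d)) (D : Set Ω) : Measure (Ed d) :=
  (P.restrict D).bind X

section Single

variable {X X' : Ω → Measure (Ed d)}

lemma isFiniteMeasure_piece (hX : Measurable X) (hp : ∀ ω, IsProbabilityMeasure (X ω)) (D : Set Ω) :
    IsFiniteMeasure (piece P X D) := isFiniteMeasure_bind _ hX hp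

lemma piece_real_univ (hX : Measurable X) (hp : ∀ ω, IsProbabilityMeasure (X ω)) (D : Set Ω) :
    (piece P X D).real univ = P.real D := by
  rw [Measure.real, piece, bind_apply_univ _ hX hp, Measure.restrict_apply_univ, Measure.real]

lemma integral_piece (hX : Measurable X) (hp : ∀ ω, IsProbabilityMeasure (X ω)) (D : Set Ω)
    {g : Ed d → ℝ} (hg : Continuous g) {c : ℝ} (hc : ∀ x, |g x| ≤ c) :
    ∫ x, g x ∂(piece P X D) = ∫ ω in D, ∫ x, g x ∂(X ω) ∂P := by
  have := isFiniteMeasure_bind (P.restrict D) hX hp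
  exact integral_bind _ hX hp (Integrable.of_bound (C := c) hg.aestronglyMeasurable
    (Eventually.of_forall hc))

lemma piece_le (hX : Measurable X) (D : Set Ω) : piece P X D ≤ P.bind X := by
  refine Measure.le_iff.2 fun S hS => ?_
  rw [piece, Measure.bind_apply hS hX.aemeasurable, Measure.bind_apply hS hX.aemeasurable]
  exact lintegral_mono' Measure.restrict_le_self le_rfl

lemma piece_eq_sum (hX : Measurable X) {κ : Type} [Fintype κ] {Z : Ω → κ}
    (hZ : ∀ k, MeasurableSet (Z ⁻¹' {k})) {D : Set Ω} (hD : MeasurableSet D) :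
    piece P X D = ∑ k, piece P X (D ∩ Z ⁻¹' {k}) := by
  refine Measure.ext fun S hS => ?_
  rw [Measure.finsetSum_apply]
  simp only [piece]
  rw [Measure.bind_apply hS hX.aemeasurable]
  simp_rw [Measure.bind_apply hS hX.aemeasurable]
  have hU : D = ⋃ k, D ∩ Z ⁻¹' {k} := by
    ext ω; simp
  conv_lhs => rw [hU]
  rw [lintegral_iUnion (fun k => hD.inter (hZ k)), tsum_fintype]
  intro i j hij
  refine Set.disjoint_left.2 fun ω h1 h2 => hij ?_
  exact h1.2.symm.trans h2.2

lemma sum_measureReal_fiber {κ : Type} [Fintype κ] {Z : Ω → κ}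
    (hZ : ∀ k, MeasurableSet (Z ⁻¹' {k})) : ∑ k, P.real (Z ⁻¹' {k}) = 1 := by
  have := sum_setIntegral_fiber hZ (P := P) (g := fun _ => (1 : ℝ)) (integrable_const _)
  simpa using this

end Single

/-- The part of `P` on `𝓕_s`-events propagates along the heat flow. -/
lemma piece_heatFlow (hM : ∀ s, Measurable (M s)) (hp : ∀ s ∈ Icc t T, ∀ ω, MemP d 1 (M s ω))
    (hcond : ∀ t₁ t₂ : ℝ, t ≤ t₁ → t₁ ≤ t₂ → t₂ ≤ T → ∀ φ : Ed d →ᵇ ℝ,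
      P[(fun ω => ∫ x, φ x ∂(M t₂ ω)) | genFiltration d M t t₁]
        =ᵐ[P] fun ω => ∫ x, φ x ∂(heatFlow d t₁ t₂ (M t₁ ω)))
    {s r : ℝ} (hs : t ≤ s) (hsr : s ≤ r) (hr : r ≤ T) {D : Set Ω}
    (hD : MeasurableSet[genFiltration d M t s] D) :
    piece P (M r) D = heatFlow d s r (piece P (M s) D) := by
  have hps : ∀ ω, IsProbabilityMeasure (M s ω) := fun ω => (hp s ⟨hs, hsr.trans hr⟩ ω).1
  have hpr : ∀ ω, IsProbabilityMeasure (M r ω) := fun ω => (hp r ⟨hs.trans hsr, hr⟩ ω).1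
  have := isFiniteMeasure_piece (P := P) (hM s) hps D
  have := isFiniteMeasure_piece (P := P) (hM r) hpr D
  refine ext_of_forall_integral_eq_of_IsFiniteMeasure fun φ => ?_
  have hφ : ∀ x, |φ x| ≤ ‖φ‖ := fun x => φ.norm_coe_le_norm x
  rw [integral_piece (hM r) hpr D φ.continuous hφ, integral_heatFlow s r φ.continuous hφ]
  have hψc : Continuous fun x => ∫ z, φ (x + √(r - s) • z) ∂(stdG d) := by
    refine continuous_of_dominated (bound := fun _ => ‖φ‖) (fun x => ?_)
      (fun x => Eventually.of_forall fun z => φ.norm_coe_le_norm _) (integrable_const _)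
      (Eventually.of_forall fun z => by fun_prop)
    exact Continuous.aestronglyMeasurable (by fun_prop)
  have hψb : ∀ x, |∫ z, φ (x + √(r - s) • z) ∂(stdG d)| ≤ ‖φ‖ := fun x => by
    have := norm_integral_le_of_norm_le_const (μ := stdG d) (f := fun z => φ (x + √(r - s) • z))
      (Eventually.of_forall fun z => φ.norm_coe_le_norm _)
    simpa using this
  rw [integral_piece (hM s) hps D hψc hψb]
  have hle := genFiltration_le (t := t) hM s
  have hmeas : StronglyMeasurable fun ω => ∫ x, φ x ∂(M r ω) :=
    φ.continuous.stronglyMeasurable.integral_kernel (κ := ⟨M r, hM r⟩)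
  have hintg : Integrable (fun ω => ∫ x, φ x ∂(M r ω)) P := by
    refine Integrable.of_bound (C := ‖φ‖) hmeas.aestronglyMeasurable
      (Eventually.of_forall fun ω => ?_)
    have := hpr ω
    simpa using norm_integral_le_of_norm_le_const (μ := M r ω) (f := fun x => φ x)
      (Eventually.of_forall φ.norm_coe_le_norm)
  rw [← setIntegral_condExp hle hintg hD]
  refine setIntegral_congr_ae (hle _ hD) ?_
  filter_upwards [hcond s r hs hsr hr φ] with ω hω _
  rw [hω]
  have := hps ω
  exact integral_heatFlow s r φ.continuous hφ

lemma bind_eq_of_init (hM : Measurable (M t)) (hp : ∀ ω, IsProbabilityMeasure (M t ω))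
    {m : Measure (Ed d)} [IsFiniteMeasure m]
    (hinit : ∀ φ : Ed d →ᵇ ℝ, ∫ ω, (∫ x, φ x ∂(M t ω)) ∂P = ∫ x, φ x ∂m) :
    P.bind (M t) = m := by
  have := isFiniteMeasure_bind P hM hp
  refine ext_of_forall_integral_eq_of_IsFiniteMeasure fun φ => ?_
  rw [integral_bind P hM hp (φ.integrable _), hinit]

end MeasureValued

/-! ### Supremum over finite partitions -/

section Partition

set_option linter.unusedSectionVars false

variable {d : ℕ} {Ω : Type} {mΩ : MeasurableSpace Ω} {P : Measure Ω} [IsProbabilityMeasure P]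
  {M : ℝ → Ω → Measure (Ed d)} {t T : ℝ} {m : Measure (Ed d)}

/-- The properties of the elements of `𝓜(t,m)` that do not involve the regularity of the paths. -/
structure IsHeatProc (P : Measure Ω) (M : ℝ → Ω → Measure (Ed d)) (t T : ℝ) (m : Measure (Ed d)) :
    Prop where
  meas : ∀ s, Measurable (M s)
  inP1 : ∀ s ∈ Icc t T, ∀ ω, MemP d 1 (M s ω)
  bind_init : P.bind (M t) = m
  cond : ∀ t₁ t₂ : ℝ, t ≤ t₁ → t₁ ≤ t₂ → t₂ ≤ T → ∀ φ : Ed d →ᵇ ℝ,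
    P[(fun ω => ∫ x, φ x ∂(M t₂ ω)) | genFiltration d M t t₁]
      =ᵐ[P] fun ω => ∫ x, φ x ∂(heatFlow d t₁ t₂ (M t₁ ω))

lemma IsHeatProc.prob (hX : IsHeatProc P M t T m) {s : ℝ} (hs : s ∈ Icc t T) (ω : Ω) :
    IsProbabilityMeasure (M s ω) := (hX.inP1 s hs ω).1

lemma IsHeatProc.isMul2_piece (hX : IsHeatProc P M t T m) (hm : MemP d 2 m) {s : ℝ}
    (hs : s ∈ Icc t T) (D : Set Ω) : IsMul2 (piece P (M s) D) := by
  refine isMul2_of_le (memP_two_heatFlow hm t s) ((piece_le (hX.meas s) D).trans (le_of_eq ?_))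
  have h := piece_heatFlow hX.meas hX.inP1 hX.cond le_rfl hs.1 hs.2 (D := univ) MeasurableSet.univ
  simp only [piece, Measure.restrict_univ, hX.bind_init] at h
  exact h

/-- The values of `∑ᵢ persp u s (piece P (M s) Dᵢ)` over finite `𝓕_s`-measurable partitions. -/
def partSet (P : Measure Ω) (M : ℝ → Ω → Measure (Ed d)) (t : ℝ) (u : ℝ → Measure (Ed d) → ℝ)
    (s : ℝ) : Set ℝ :=
  {x | ∃ (ι : Type) (_ : Fintype ι) (Y : Ω → ι),
    (∀ i, MeasurableSet[genFiltration d M t s] (Y ⁻¹' {i})) ∧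
      x = ∑ i, persp u s (piece P (M s) (Y ⁻¹' {i}))}

variable {u : ℝ → Measure (Ed d) → ℝ}

lemma persp_piece_mem_partSet (s : ℝ) : persp u s (P.bind (M s)) ∈ partSet P M t u s := by
  refine ⟨Unit, inferInstance, fun _ => (), fun i => ?_, ?_⟩
  · exact MeasurableSet.const _
  · simp [piece]

lemma IsHeatProc.abs_le_of_mem_partSet (hX : IsHeatProc P M t T m) (hm : MemP d 2 m) {c : ℝ}
    {s : ℝ} (hs : s ∈ Icc t T) (hc : ∀ m : Measure (Ed d), MemP d 2 m → |u s m| ≤ c) {x : ℝ}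
    (hx : x ∈ partSet P M t u s) : |x| ≤ c := by
  obtain ⟨ι, _, Y, hY, rfl⟩ := hx
  refine (Finset.abs_sum_le_sum_abs _ _).trans ?_
  calc _ ≤ ∑ i, c * P.real (Y ⁻¹' {i}) := Finset.sum_le_sum fun i _ => by
        rw [← piece_real_univ (hX.meas s) (hX.prob hs)]
        exact abs_persp_le hc (hX.isMul2_piece hm hs _)
    _ = c := by
        rw [← Finset.mul_sum, sum_measureReal_fiber fun i => genFiltration_le hX.meas s _ (hY i),
          mul_one]

variable {A B : Type} [MetricSpace A] [CompactSpace A] [Nonempty A]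
    [MetricSpace B] [CompactSpace B] [Nonempty B] {f : ℝ → Ed d → A → B → ℝ} {C : ℝ}

lemma IsHeatProc.sSup_partSet_le (hX : IsHeatProc P M t T m) (hm : MemP d 2 m) (ht : 0 ≤ t)
    (h : CostHyp f C) (hbdd : BddD1 d T u) (hcont : ContD1 d T u)
    (hsub : IsSubsolution d T (hamiltonian f) u)
    (hconv : ∀ t ∈ Set.Icc 0 T, ∀ m₁ m₂ : Measure (Ed d), MemP d 2 m₁ → MemP d 2 m₂ →
      ∀ l : ℝ, 0 < l → l < 1 →
        u t (ENNReal.ofReal l • m₁ + ENNReal.ofReal (1 - l) • m₂)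
          ≤ l * u t m₁ + (1 - l) * u t m₂) {s r : ℝ} (hts : t ≤ s) (hsr : s ≤ r) (hr : r ≤ T) :
    sSup (partSet P M t u s) ≤ sSup (partSet P M t u r)
      + (r - s) * (∫ ω, hamiltonian f s (M s ω) ∂P)
      + (r - s) * (C * (r - s + √(r - s) * gNorm d)) := by
  have hs : s ∈ Icc t T := ⟨hts, hsr.trans hr⟩
  have hr' : r ∈ Icc t T := ⟨hts.trans hsr, hr⟩
  refine csSup_le ⟨_, persp_piece_mem_partSet s⟩ ?_
  rintro _ ⟨ι, _, Y, hY, rfl⟩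
  refine le_of_forall_pos_le_add fun ε hε => ?_
  have hle := genFiltration_le (t := t) hX.meas s
  obtain ⟨κ, _, Z, hZ, hpart⟩ := h.exists_partition s P hle
    (measurable_genFiltration hts) (hX.prob hs) (ε := ε / (r - s + 1))
    (div_pos hε (by linarith))
  have hpart := hpart ι Y fun i => hle _ (hY i)
  set W : Ω → ι × κ := fun ω => (Y ω, Z ω) with hW
  have hWe : ∀ i k, W ⁻¹' {(i, k)} = Y ⁻¹' {i} ∩ Z ⁻¹' {k} := fun i k => by
    ext ω; simp [hW]
  have hWm : ∀ i, MeasurableSet[genFiltration d M t s] (W ⁻¹' {i}) := by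
    rintro ⟨i, k⟩
    rw [hWe]
    exact MeasurableSet.inter (hY i) (hZ k)
  have hrefine : ∑ i, persp u s (piece P (M s) (Y ⁻¹' {i}))
      ≤ ∑ i, persp u s (piece P (M s) (W ⁻¹' {i})) := by
    rw [Fintype.sum_prod_type]
    refine Finset.sum_le_sum fun i _ => ?_
    rw [piece_eq_sum (hX.meas s) (fun k => hle _ (hZ k)) (hle _ (hY i))]
    simp_rw [hWe]
    exact (persp_sum_le (hconv s ⟨ht.trans hts, hs.2⟩) Finset.univ
      fun k => hX.isMul2_piece hm hs _).2
  refine hrefine.trans ?_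
  have hstep : ∀ i, persp u s (piece P (M s) (W ⁻¹' {i})) ≤ persp u r (piece P (M r) (W ⁻¹' {i}))
      + (r - s) * hamiltonian f s ((P.restrict (W ⁻¹' {i})).bind (M s))
      + P.real (W ⁻¹' {i}) * ((r - s) * (C * (r - s + √(r - s) * gNorm d))) := fun i => by
    rw [piece_heatFlow hX.meas hX.inP1 hX.cond hts hsr hr (hWm i),
      ← piece_real_univ (hX.meas s) (hX.prob hs)]
    exact h.persp_le_heatFlow hbdd hcont hsub hsr (ht.trans hts) hr (hX.isMul2_piece hm hs _)
  refine (Finset.sum_le_sum fun i _ => hstep i).trans ?_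
  rw [Finset.sum_add_distrib, Finset.sum_add_distrib, ← Finset.mul_sum, ← Finset.sum_mul,
    sum_measureReal_fiber fun i => hle _ (hWm i), one_mul]
  obtain ⟨c, hc⟩ := hbdd
  have hG : ∑ i, persp u r (piece P (M r) (W ⁻¹' {i})) ≤ sSup (partSet P M t u r) := by
    refine le_csSup ⟨c, fun x hx => ?_⟩ ⟨_, inferInstance, W,
      fun i => genFiltration_mono hsr _ (hWm i), rfl⟩
    exact (abs_le.1 (hX.abs_le_of_mem_partSet hm hr' (hc r ⟨ht.trans hr'.1, hr⟩) hx)).2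
  have hK := mul_le_mul_of_nonneg_left hpart (sub_nonneg.2 hsr)
  have hε' : (r - s) * (ε / (r - s + 1)) ≤ ε := by
    have : 0 < r - s + 1 := by linarith
    rw [mul_div_assoc', div_le_iff₀ this]
    nlinarith
  rw [mul_add] at hK
  linarith

end Partition

/-! ### Integration of the one-step inequality -/

section Dini

lemma le_add_integral_of_step {G K e : ℝ → ℝ} {t T C : ℝ} (htT : t ≤ T)
    (hK : IntervalIntegrable K volume t T) (hKC : ∀ s ∈ Icc t T, |K s| ≤ C)
    (he : Continuous e) (he0 : e 0 = 0)
    (hstep : ∀ s r, t ≤ s → s ≤ r → r ≤ T → G s ≤ G r + (r - s) * K s + (r - s) * e (r - s)) :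
    G t ≤ G T + ∫ s in t..T, K s := by
  rcases htT.eq_or_lt with rfl | hlt
  · simp
  obtain ⟨c, hc⟩ : ∃ c, ∀ h ∈ Icc 0 (T - t), e h ≤ c := by
    obtain ⟨c, hc⟩ := ((isCompact_Icc (a := (0 : ℝ)) (b := T - t)).image he).bddAbove
    exact ⟨c, fun h hh => hc ⟨h, hh, rfl⟩⟩
  have hmono : ∀ s r, t ≤ s → s ≤ r → r ≤ T → G s ≤ G r + (C + c) * (r - s) :=
    fun s r h1 h2 h3 => by
      have a1 := (abs_le.1 (hKC s ⟨h1, h2.trans h3⟩)).2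
      have a2 := hc (r - s) ⟨by linarith, by linarith⟩
      nlinarith [hstep s r h1 h2 h3, sub_nonneg.2 h2]
  have hGi : IntervalIntegrable G volume t T := by
    have h1 : MonotoneOn (fun s => G s + (C + c) * s) (uIcc t T) := fun s hs r hr hsr => by
      rw [uIcc_of_le htT] at hs hr
      simp only
      linarith [hmono s r hs.1 hsr hr.2]
    have h2 := h1.intervalIntegrable (μ := volume)
    have h3 : IntervalIntegrable (fun s => (C + c) * s) volume t T :=
      Continuous.intervalIntegrable (by fun_prop) _ _
    simpa using h2.sub h3
  have hsubint : ∀ a b, t ≤ a → a ≤ b → b ≤ T → uIcc a b ⊆ uIcc t T := fun a b h1 h2 h3 => by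
    rw [uIcc_of_le h2, uIcc_of_le htT]
    exact Icc_subset_Icc h1 h3
  have key : ∀ h, 0 < h → h < T - t →
      G t ≤ G T + ((∫ s in t..T, K s) + C * h + e h * (T - h - t) + 2 * (C + c) * h) := by
    intro h h0 h1
    have iG : ∀ a b, t ≤ a → a ≤ b → b ≤ T → IntervalIntegrable G volume a b :=
      fun a b x y z => hGi.mono_set (hsubint a b x y z)
    have iK : ∀ a b, t ≤ a → a ≤ b → b ≤ T → IntervalIntegrable K volume a b :=
      fun a b x y z => hK.mono_set (hsubint a b x y z)
    have i1 := iG t (T - h) le_rfl (by linarith) (by linarith)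
    have i2 := iG (t + h) T (by linarith) (by linarith) le_rfl
    have i2' : IntervalIntegrable (fun s => G (s + h)) volume t (T - h) := by
      have := i2.comp_add_right h
      simpa using this
    have i3 := iK t (T - h) le_rfl (by linarith) (by linarith)
    have e1 : ∫ s in t..(T - h), G (s + h) = ∫ s in (t + h)..T, G s := by
      rw [intervalIntegral.integral_comp_add_right]
      simp
    have e2 : ∫ s in t..(T - h), (G s - G (s + h))
        ≤ ∫ s in t..(T - h), (h * K s + h * e h) := by
      refine intervalIntegral.integral_mono_on (by linarith) (i1.sub i2')
        ((i3.const_mul h).add intervalIntegrable_const) fun s hs => ?_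
      have := hstep s (s + h) hs.1 (by linarith) (by linarith [hs.2])
      rw [add_sub_cancel_left] at this
      linarith
    rw [intervalIntegral.integral_sub i1 i2', e1,
      intervalIntegral.integral_add (i3.const_mul h) intervalIntegrable_const,
      intervalIntegral.integral_const_mul, intervalIntegral.integral_const, smul_eq_mul] at e2
    have e3 := intervalIntegral.integral_add_adjacent_intervals i1
      (iG (T - h) T (by linarith) (by linarith) le_rfl)
    have e4 := intervalIntegral.integral_add_adjacent_intervals
      (iG t (t + h) le_rfl (by linarith) (by linarith)) i2
    have e5 := intervalIntegral.integral_add_adjacent_intervals i3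
      (iK (T - h) T (by linarith) (by linarith) le_rfl)
    have e6 : ∫ s in t..(t + h), (G t - (C + c) * h) ≤ ∫ s in t..(t + h), G s := by
      refine intervalIntegral.integral_mono_on (by linarith) intervalIntegrable_const
        (iG t (t + h) le_rfl (by linarith) (by linarith)) fun s hs => ?_
      have a0 : 0 ≤ C + c := by
        have b1 := hmono t T le_rfl htT le_rfl
        have b2 := (abs_nonneg _).trans (hKC t ⟨le_rfl, htT⟩)
        have b3 := hc 0 ⟨le_rfl, by linarith⟩
        rw [he0] at b3
        linarith
      have a1 := hmono t s le_rfl hs.1 (by linarith [hs.2])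
      nlinarith [hs.2]
    have e7 : ∫ s in (T - h)..T, G s ≤ ∫ s in (T - h)..T, (G T + (C + c) * h) := by
      refine intervalIntegral.integral_mono_on (by linarith)
        (iG (T - h) T (by linarith) (by linarith) le_rfl) intervalIntegrable_const fun s hs => ?_
      have a0 : 0 ≤ C + c := by
        have b2 := (abs_nonneg _).trans (hKC t ⟨le_rfl, htT⟩)
        have b3 := hc 0 ⟨le_rfl, by linarith⟩
        rw [he0] at b3
        linarith
      have a1 := hmono s T (by linarith [hs.1]) hs.2 le_rfl
      nlinarith [hs.1]
    have e8 : ‖∫ s in (T - h)..T, K s‖ ≤ C * |T - (T - h)| := by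
      refine intervalIntegral.norm_integral_le_of_norm_le_const fun s hs => ?_
      rw [uIoc_of_le (by linarith)] at hs
      exact hKC s ⟨by linarith [hs.1], hs.2⟩
    rw [sub_sub_cancel, abs_of_pos h0, Real.norm_eq_abs] at e8
    rw [intervalIntegral.integral_const, smul_eq_mul] at e6 e7
    have e9 := (abs_le.1 e8).1
    have e10 : h * (G t - G T - 2 * ((C + c) * h))
        ≤ h * ((∫ s in t..T, K s) + C * h + e h * (T - h - t)) := by
      have a1 : h * (∫ s in t..(T - h), K s) ≤ h * ((∫ s in t..T, K s) + C * h) :=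
        mul_le_mul_of_nonneg_left (by linarith) h0.le
      nlinarith
    have := le_of_mul_le_mul_left e10 h0
    linarith
  have hlim : Tendsto (fun h => G T + ((∫ s in t..T, K s) + C * h + e h * (T - h - t)
      + 2 * (C + c) * h)) (𝓝[>] 0) (𝓝 (G T + ∫ s in t..T, K s)) := by
    have : Continuous fun h => G T + ((∫ s in t..T, K s) + C * h + e h * (T - h - t)
      + 2 * (C + c) * h) := by fun_prop
    have := (this.tendsto 0).mono_left (nhdsWithin_le_nhds (s := Ioi (0 : ℝ)))
    simpa [he0] using this
  refine ge_of_tendsto hlim ?_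
  filter_upwards [Ioo_mem_nhdsGT (sub_pos.2 hlt)] with h hh
  exact key h hh.1 hh.2

end Dini

/-! ### Joint measurability and Fubini -/

section Fubini

set_option linter.unusedSectionVars false

variable {d : ℕ} {Ω : Type} {mΩ : MeasurableSpace Ω} {P : Measure Ω} [IsProbabilityMeasure P]
  {M : ℝ → Ω → Measure (Ed d)} {t T : ℝ} {m : Measure (Ed d)}

variable {A B : Type} [MetricSpace A] [CompactSpace A] [Nonempty A]
    [MetricSpace B] [CompactSpace B] [Nonempty B] {f : ℝ → Ed d → A → B → ℝ} {C : ℝ}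

lemma measurable_of_discretization {g : ℕ → Ω → ℝ} (hg : ∀ k, Measurable (g k)) {kk : ℝ → ℕ}
    (hk : Measurable kk) : Measurable fun q : Ω × ℝ => g (kk q.2) q.1 := by
  have h1 : Measurable fun q : Ω × ℕ => g q.2 q.1 := measurable_from_prod_countable_left hg
  exact h1.comp (measurable_fst.prodMk (hk.comp measurable_snd))

/-- Discretization of time from the right. -/
def timeGrid (t T : ℝ) (n k : ℕ) : ℝ := min T (t + (k + 1) / (n + 1))

lemma timeGrid_mem (htT : t ≤ T) (n k : ℕ) : timeGrid t T n k ∈ Icc t T :=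
  ⟨le_min htT (by have : (0 : ℝ) ≤ ((k : ℝ) + 1) / (n + 1) := by positivity
                  linarith), min_le_left _ _⟩

lemma le_timeGrid {s : ℝ} (hs : s ≤ T) (n : ℕ) :
    s ≤ timeGrid t T n ⌊(s - t) * (n + 1)⌋₊ := by
  refine le_min hs ?_
  have h2 : s - t ≤ (⌊(s - t) * ((n : ℝ) + 1)⌋₊ + 1) / ((n : ℝ) + 1) := by
    rw [le_div_iff₀ (by positivity)]
    exact (Nat.lt_floor_add_one ((s - t) * (n + 1))).le
  linarith

lemma timeGrid_le {s : ℝ} (hs : t ≤ s) (n : ℕ) :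
    timeGrid t T n ⌊(s - t) * (n + 1)⌋₊ ≤ s + 1 / ((n : ℝ) + 1) := by
  refine (min_le_right _ _).trans ?_
  have h1 := Nat.floor_le (mul_nonneg (sub_nonneg.2 hs) (by positivity : (0 : ℝ) ≤ (n : ℝ) + 1))
  have h2 : (⌊(s - t) * ((n : ℝ) + 1)⌋₊ : ℝ) / ((n : ℝ) + 1) ≤ s - t := by
    rw [div_le_iff₀ (by positivity)]
    exact h1
  rw [add_div]
  linarith

lemma tendsto_timeGrid {s : ℝ} (hs : s ∈ Icc t T) :
    Tendsto (fun n : ℕ => timeGrid t T n ⌊(s - t) * (n + 1)⌋₊) atTop (𝓝[Ici s] s) := by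
  refine tendsto_nhdsWithin_iff.2 ⟨?_, Eventually.of_forall fun n => le_timeGrid hs.2 n⟩
  refine tendsto_of_tendsto_of_tendsto_of_le_of_le tendsto_const_nhds
    (h := fun n : ℕ => s + 1 / ((n : ℝ) + 1)) ?_ (fun n => le_timeGrid hs.2 n)
    fun n => timeGrid_le hs.1 n
  simpa using tendsto_one_div_add_atTop_nhds_zero_nat.const_add s

lemma CostHyp.aestronglyMeasurable_ham (h : CostHyp f C) (htT : t ≤ T)
    (hM : ∀ s, Measurable (M s)) (hp : ∀ s ∈ Icc t T, ∀ ω, MemP d 1 (M s ω))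
    (hcad : ∀ ω, CadlagD1 d t T fun s => M s ω) :
    AEStronglyMeasurable (fun q : Ω × ℝ => hamiltonian f q.2 (M q.2 q.1))
      (P.prod (volume.restrict (Icc t T))) := by
  have hgrid : ∀ n : ℕ, Measurable fun q : Ω × ℝ =>
      hamiltonian f (timeGrid t T n ⌊(q.2 - t) * (n + 1)⌋₊)
        (M (timeGrid t T n ⌊(q.2 - t) * (n + 1)⌋₊) q.1) := fun n => by
    exact measurable_of_discretization (kk := fun s => ⌊(s - t) * ((n : ℝ) + 1)⌋₊)
      (fun k => h.measurable_ham _ (hM _) fun ω => (hp _ (timeGrid_mem htT n k) ω).1)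
      (Nat.measurable_floor.comp ((measurable_id.sub_const t).mul_const _))
  refine aestronglyMeasurable_of_tendsto_ae atTop (fun n => (hgrid n).aestronglyMeasurable) ?_
  rw [← Measure.restrict_congr_set (Ico_ae_eq_Icc (μ := volume) (a := t) (b := T))]
  have hae : ∀ᵐ q ∂(P.prod (volume.restrict (Ico t T))), q.2 ∈ Ico t T :=
    Measure.quasiMeasurePreserving_snd.ae (ae_restrict_mem measurableSet_Ico)
  filter_upwards [hae] with q hq
  have hq' : q.2 ∈ Icc t T := ⟨hq.1, hq.2.le⟩
  have hg := tendsto_timeGrid hq'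
  have h1 := ((hcad q.1).1 q.2 hq).comp hg
  have h2 : Tendsto (fun n : ℕ => |timeGrid t T n ⌊(q.2 - t) * (n + 1)⌋₊ - q.2|) atTop (𝓝 0) := by
    have := ((tendsto_nhdsWithin_iff.1 hg).1.sub_const q.2).abs
    simpa using this
  refine tendsto_iff_dist_tendsto_zero.2 (squeeze_zero (fun n => dist_nonneg) (fun n => ?_)
    (by simpa using (h2.add h1).const_mul C))
  exact h.abs_ham_sub_le _ _ (hp _ (timeGrid_mem htT n _) _) (hp _ hq' _)

lemma CostHyp.integrable_ham (h : CostHyp f C) (htT : t ≤ T)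
    (hM : ∀ s, Measurable (M s)) (hp : ∀ s ∈ Icc t T, ∀ ω, MemP d 1 (M s ω))
    (hcad : ∀ ω, CadlagD1 d t T fun s => M s ω) :
    Integrable (fun q : Ω × ℝ => hamiltonian f q.2 (M q.2 q.1))
      (P.prod (volume.restrict (Icc t T))) := by
  refine Integrable.of_bound (C := C) (h.aestronglyMeasurable_ham htT hM hp hcad) ?_
  have hae : ∀ᵐ q ∂(P.prod (volume.restrict (Icc t T))), q.2 ∈ Icc t T :=
    Measure.quasiMeasurePreserving_snd.ae (ae_restrict_mem measurableSet_Icc)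
  filter_upwards [hae] with q hq
  have := (hp q.2 hq q.1).1
  simpa using h.abs_ham_le q.2 (M q.2 q.1)

end Fubini

/-! ### Conclusion -/

section Value

variable {d : ℕ} {t T : ℝ} {m : Measure (Ed d)} {u : ℝ → Measure (Ed d) → ℝ}

lemma MVP.isHeatProc [IsFiniteMeasure m] (X : MVP d T t m) (htT : t ≤ T) :
    let _ := X.mΩ
    IsHeatProc X.P X.M t T m := by
  let _ := X.mΩ
  have := X.probP
  exact ⟨X.meas, X.inP1, bind_eq_of_init (X.meas t) (fun ω => (X.inP1 t ⟨le_rfl, htT⟩ ω).1) X.init,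
    X.cond⟩

/-- The deterministic process that follows the heat flow. -/
def heatMVP (hm : MemP d 2 m) : MVP d T t m where
  Ω := Unit
  mΩ := inferInstance
  P := Measure.dirac ()
  probP := inferInstance
  M s _ := heatFlow d t s m
  meas s := measurable_const
  inP1 s _ _ := (memP_two_heatFlow hm t s).one_of_two
  cadlag _ := by
    have hc : ∀ s, Tendsto (fun r => wdist d 1 (heatFlow d t r m) (heatFlow d t s m)) (𝓝 s)
        (𝓝 0) := fun s => by
      have h : Tendsto (fun r => |√(r - t) - √(s - t)| * gNorm d) (𝓝 s) (𝓝 0) := by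
        have : Continuous fun r => |√(r - t) - √(s - t)| * gNorm d := by fun_prop
        simpa using this.tendsto s
      exact squeeze_zero (fun r => wdist_nonneg 1)
        (fun r => heatFlow_coupling hm.one_of_two t r s) h
    exact ⟨fun s _ => (hc s).mono_left nhdsWithin_le_nhds,
      fun s _ => ⟨heatFlow d t s m, (hc s).mono_left nhdsWithin_le_nhds⟩⟩
  init φ := by simp [heatFlow_of_le le_rfl m]
  cond t₁ t₂ h1 h2 h3 φ := by
    have := hm.1
    have hle : genFiltration d (fun s (_ : Unit) => heatFlow d t s m) t t₁
        ≤ (inferInstance : MeasurableSpace Unit) := genFiltration_le (fun s => measurable_const) t₁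
    rw [condExp_const hle, heatFlow_heatFlow m h1 h2]

variable {A B : Type} [MetricSpace A] [CompactSpace A] [Nonempty A]
    [MetricSpace B] [CompactSpace B] [Nonempty B] {f : ℝ → Ed d → A → B → ℝ} {C : ℝ}

lemma le_mvCost (h : CostHyp f C) (ht : 0 ≤ t) (htT : t ≤ T) (hm : MemP d 2 m)
    (hbdd : BddD1 d T u) (hcont : ContD1 d T u)
    (hsub : IsSubsolution d T (hamiltonian f) u)
    (hconv : ∀ t ∈ Set.Icc 0 T, ∀ m₁ m₂ : Measure (Ed d), MemP d 2 m₁ → MemP d 2 m₂ →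
      ∀ l : ℝ, 0 < l → l < 1 →
        u t (ENNReal.ofReal l • m₁ + ENNReal.ofReal (1 - l) • m₂)
          ≤ l * u t m₁ + (1 - l) * u t m₂)
    (hterm : ∀ m : Measure (Ed d), MemP d 2 m → u T m = 0) (X : MVP d T t m) :
    u t m ≤ mvCost f X := by
  let _ := X.mΩ
  have := X.probP
  have := hm.1
  have hX : IsHeatProc X.P X.M t T m := X.isHeatProc htT
  obtain ⟨c, hc⟩ := hbdd
  have hintg := h.integrable_ham (P := X.P) htT X.meas X.inP1 X.cadlag
  have hcost : mvCost f X
      = ∫ s in t..T, ∫ ω, hamiltonian f s (X.M s ω) ∂X.P := by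
    rw [mvCost, integral_integral_swap (f := fun ω s => hamiltonian f s (X.M s ω)) hintg,
      integral_Icc_eq_integral_Ioc, intervalIntegral.integral_of_le htT]
  have hK : IntervalIntegrable (fun s => ∫ ω, hamiltonian f s (X.M s ω) ∂X.P) volume t T :=
    (intervalIntegrable_iff_integrableOn_Icc_of_le htT).2 hintg.integral_prod_right
  have hKC : ∀ s ∈ Icc t T, |∫ ω, hamiltonian f s (X.M s ω) ∂X.P| ≤ C := fun s hs => by
    have := norm_integral_le_of_norm_le_const (μ := X.P) (C := C)
      (f := fun ω => hamiltonian f s (X.M s ω)) (Eventually.of_forall fun ω => by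
        have := (X.inP1 s hs ω).1
        simpa using h.abs_ham_le s (X.M s ω))
    simpa using this
  have key := le_add_integral_of_step (G := fun s => sSup (partSet X.P X.M t u s))
    (e := fun h => C * (h + √h * gNorm d)) htT hK hKC (by fun_prop) (by simp)
    fun s r h1 h2 h3 => hX.sSup_partSet_le hm ht h ⟨c, hc⟩ hcont hsub hconv h1 h2 h3
  have h0 : u t m ≤ sSup (partSet X.P X.M t u t) := by
    have h1 := persp_piece_mem_partSet (P := X.P) (M := X.M) (t := t) (u := u) t
    rw [hX.bind_init, persp_prob] at h1
    exact le_csSup ⟨c, fun x hx => (abs_le.1 (hX.abs_le_of_mem_partSet hm ⟨le_rfl, htT⟩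
      (hc t ⟨ht, htT⟩) hx)).2⟩ h1
  have hT : sSup (partSet X.P X.M t u T) ≤ 0 := by
    refine csSup_le ⟨_, persp_piece_mem_partSet T⟩ fun x hx => ?_
    exact (abs_le.1 (hX.abs_le_of_mem_partSet hm ⟨htT, le_rfl⟩
      (fun m' hm' => by rw [hterm m' hm', abs_zero]) hx)).2
  rw [hcost]
  linarith

end Value

/-- **characterization, maximality.** Let `u` be a bounded continuous
subsolution on `[0,T) × 𝒫₂` of
`∂_t u + ½ ∫ div[D_m u](t,m,x) dm(x) + H(t,m) = 0` which is convex in `m` and satisfies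
`u(T,m) = 0` for all `m ∈ 𝒫₂`. Then `u ≤ V` on `[0,T] × 𝒫₂` (so that `V` is the largest
bounded continuous subsolution that is convex in `m` and vanishes at time `T`). -/
theorem subsolution_le_gameValue (d : ℕ) (T : ℝ) (hT : 0 ≤ T)
    {A B : Type} [MetricSpace A] [CompactSpace A] [Nonempty A]
    [MetricSpace B] [CompactSpace B] [Nonempty B]
    (f : ℝ → Ed d → A → B → ℝ) (C : ℝ)
    (hfbdd : ∀ s x u v, |f s x u v| ≤ C)
    (hfcont : Continuous fun q : ℝ × Ed d × A × B => f q.1 q.2.1 q.2.2.1 q.2.2.2)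
    (hflip : ∀ (u : A) (v : B), ∀ s s' : ℝ, ∀ x x' : Ed d,
      |f s x u v - f s' x' u v| ≤ C * (‖x - x'‖ + |s - s'|))
    (hIsaacs : ∀ s ∈ Set.Icc 0 T, ∀ μ : Measure (Ed d), MemP d 2 μ →
      (⨅ u : A, ⨆ v : B, ∫ x, f s x u v ∂μ) = ⨆ v : B, ⨅ u : A, ∫ x, f s x u v ∂μ)
    (u : ℝ → Measure (Ed d) → ℝ)
    (hbdd : BddD1 d T u) (hcont : ContD1 d T u)
    (hsub : IsSubsolution d T (hamiltonian f) u)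
    (hconv : ∀ t ∈ Set.Icc 0 T, ∀ m₁ m₂ : Measure (Ed d), MemP d 2 m₁ → MemP d 2 m₂ →
      ∀ l : ℝ, 0 < l → l < 1 →
        u t (ENNReal.ofReal l • m₁ + ENNReal.ofReal (1 - l) • m₂)
          ≤ l * u t m₁ + (1 - l) * u t m₂)
    (hterm : ∀ m : Measure (Ed d), MemP d 2 m → u T m = 0) :
    ∀ t ∈ Set.Icc 0 T, ∀ m : Measure (Ed d), MemP d 2 m →
      u t m ≤ gameValue d f T t m := by
  intro t ht m hm
  refine le_csInf ⟨_, heatMVP hm, rfl⟩ ?_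
  rintro _ ⟨X, rfl⟩
  exact le_mvCost ⟨hfbdd, hfcont, hflip⟩ ht.1 ht.2 hm hbdd hcont hsub hconv hterm X

end
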